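/- arXiv:2206.04353 — 2 statements merged into one kernel-verified Lean document; each statement's English description precedes it below -/
import Mathlib

section
/- Let N ≥ 1 be an integer and s ∈ (0,1). Let u ∈ L¹_loc(ℝ^{N+1}_+) be nonnegative and satisfy div(z^{1-2s}∇u) = 0 in ℝ^{N+1}_+ in the distributional sense, i.e. ∫_{ℝ^{N+1}_+} u(x,z)·div(z^{1-2s}∇φ)(x,z) dx dz = 0 for every φ ∈ C_c^∞(ℝ^{N+1}_+). Then u is C^∞ in ℝ^{N+1}_+, and u admits a boundary trace on ∂ℝ^{N+1}_+ ≃ ℝ^N which is a nonnegative Radon measure μ, in the sense that lim_{z→0⁺} ∫_{ℝ^N} u(x,z)ζ(x) dx = ∫_{ℝ^N} ζ dμ for every ζ ∈ C_c^∞(ℝ^N); moreover μ satisfies ∫_{ℝ^N} (1+|x|)^{-N-2s} dμ(x) < +∞. -/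
open MeasureTheory Filter Topology Set Metric Asymptotics

noncomputable section

/-- Euclidean space `ℝ^N`. -/
abbrev Euc (N : ℕ) : Type := EuclideanSpace ℝ (Fin N)

/-- Second derivative of `u` at `q` in the direction `v`. -/
noncomputable def d2 {N : ℕ} (u : Euc N × ℝ → ℝ) (q v : Euc N × ℝ) : ℝ :=
  fderiv ℝ (fun w => fderiv ℝ u w v) q v

/-- The Caffarelli–Silvestre operator `div(z^{1-2s} ∇u)` written out pointwise:
`z^{1-2s} Δu + (1-2s) z^{-2s} ∂_z u`. -/
noncomputable def CSop (N : ℕ) (s : ℝ) (u : Euc N × ℝ → ℝ) (q : Euc N × ℝ) : ℝ :=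
  q.2 ^ (1 - 2*s) *
      ((∑ i : Fin N, d2 u q (EuclideanSpace.single i (1:ℝ), (0:ℝ))) +
        d2 u q ((0 : Euc N), (1:ℝ)))
    + (1 - 2*s) * q.2 ^ (-(2*s)) * fderiv ℝ u q ((0 : Euc N), (1:ℝ))

/-- The normalizing constant `C_{N,s}` of the Poisson kernel, determined by
`C_{N,s} ∫ (|y|²+1)^{-(N+2s)/2} dy = 1`. -/
noncomputable def PoissonConst (N : ℕ) (s : ℝ) : ℝ :=
  (∫ y : Euc N, (‖y‖^2 + 1) ^ (-((N:ℝ) + 2*s)/2))⁻¹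

/-- The normalizing constant `c_{N,s}` of the fractional Laplacian. -/
noncomputable def cNs (N : ℕ) (s : ℝ) : ℝ :=
  2 ^ (2*s) * Real.pi ^ (-(N:ℝ)/2) * Real.Gamma (((N:ℝ) + 2*s)/2) / Real.Gamma (1 - s)

/-- The truncated integral appearing in the principal-value definition of `(-Δ)^s`. -/
noncomputable def fLapApprox (N : ℕ) (s : ℝ) (w : Euc N → ℝ) (x : Euc N) (ε : ℝ) : ℝ :=
  cNs N s * ∫ y in {y : Euc N | ε < dist x y}, (w x - w y) / dist x y ^ ((N:ℝ) + 2*s)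

/-- `(-Δ)^s w (x) = L` in the principal-value sense. -/
def HasFracLap (N : ℕ) (s : ℝ) (w : Euc N → ℝ) (x : Euc N) (L : ℝ) : Prop :=
  Tendsto (fLapApprox N s w x) (𝓝[>] (0:ℝ)) (𝓝 L)

/-- The fractional Laplacian `(-Δ)^s w (x)`, as a limit (junk value if the limit
does not exist). -/
noncomputable def fracLap (N : ℕ) (s : ℝ) (w : Euc N → ℝ) (x : Euc N) : ℝ :=
  limUnder (𝓝[>] (0:ℝ)) (fLapApprox N s w x)

/-- `w ∈ L¹_{μ_s}(ℝ^N)`, where `μ_s(x) = (1+|x|)^{-N-2s}`. -/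
def L1mu (N : ℕ) (s : ℝ) (w : Euc N → ℝ) : Prop :=
  Integrable (fun x : Euc N => w x * (1 + ‖x‖) ^ (-((N:ℝ) + 2*s)))

/-- The set `E_ε` of self-similar solutions of the lifted fractional Emden equation:
continuous on the closed half-space minus the origin, `C²` in the open half-space,
positively homogeneous of degree `-2s/(p-1)`, satisfying `div(z^{1-2s}∇u) = 0`
in the open half-space, and `∂_{ν^s}u(x,0) + ε|u(x,0)|^{p-1}u(x,0) = 0` for `x ≠ 0`,
where `∂_{ν^s}u(x,0) = -lim_{z→0⁺} z^{1-2s}∂_z u(x,z)`. -/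
def SelfSim (N : ℕ) (s p ε : ℝ) : Set (Euc N × ℝ → ℝ) :=
  {u | ContinuousOn u ({q : Euc N × ℝ | 0 ≤ q.2} \ {0}) ∧
       ContDiffOn ℝ 2 u {q : Euc N × ℝ | 0 < q.2} ∧
       (∀ l : ℝ, 0 < l → ∀ q : Euc N × ℝ, u (l • q.1, l * q.2) = l ^ (-(2*s)/(p-1)) * u q) ∧
       (∀ q : Euc N × ℝ, 0 < q.2 → CSop N s u q = 0) ∧
       (∀ x : Euc N, x ≠ 0 →
          Tendsto (fun z : ℝ => z ^ (1 - 2*s) * fderiv ℝ u (x, z) ((0 : Euc N), (1:ℝ)))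
            (𝓝[>] (0:ℝ)) (𝓝 (ε * |u (x, 0)| ^ (p-1) * u (x, 0))))}

/-- The subset `E_ε⁺` of nonnegative elements of `E_ε`. -/
def SelfSimPos (N : ℕ) (s p ε : ℝ) : Set (Euc N × ℝ → ℝ) :=
  {u ∈ SelfSim N s p ε | ∀ q : Euc N × ℝ, 0 ≤ q.2 → 0 ≤ u q}

/-- The constant `C_s(τ)` such that `(-Δ)^s |x|^τ = C_s(τ)|x|^{τ-2s}`. -/
noncomputable def Cs (N : ℕ) (s τ : ℝ) : ℝ :=
  2 ^ (2*s) * Real.Gamma (((N:ℝ) + τ)/2) * Real.Gamma ((2*s - τ)/2) /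
    (Real.Gamma (-τ/2) * Real.Gamma (((N:ℝ) - 2*s + τ)/2))

/-- The constant `c_p = C_s(-2s/(p-1))^{1/(p-1)}`. -/
noncomputable def cp (N : ℕ) (s p : ℝ) : ℝ := (Cs N s (-(2*s)/(p-1))) ^ (1/(p-1))

end

open scoped ContDiff

theorem contDiffOn_integral_mul {P X : Type*} [NormedAddCommGroup P] [NormedSpace ℝ P]
    [NormedAddCommGroup X] [NormedSpace ℝ X] [FiniteDimensional ℝ X] [MeasurableSpace X]
    [BorelSpace X] {ν : Measure X} {f : X → ℝ} {K : P × X → ℝ} {s : Set P} {k : Set X}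
    (hs : IsOpen s) (hk : IsCompact k) (hKk : ∀ p ∈ s, ∀ x ∉ k, K (p, x) = 0)
    (hf : IntegrableOn f k ν) (hK : ContDiffOn ℝ ∞ K (s ×ˢ univ)) :
    ContDiffOn ℝ ∞ (fun p => ∫ x, f x * K (p, x) ∂ν) s := by
  have h1 : LocallyIntegrable (k.indicator f) ν :=
    ((integrable_indicator_iff hk.measurableSet).2 hf).locallyIntegrable
  have h2 := contDiffOn_convolution_right_with_param (n := ⊤) (μ := ν)
    (ContinuousLinearMap.mul ℝ ℝ) (g := fun p x => K (p, -x)) hs (hk.neg)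
    (fun p x hp hx => hKk p hp _ (by simpa using hx)) h1
    (by
      refine hK.comp (f := fun y : P × X => (y.1, -y.2)) (by fun_prop) ?_
      rintro ⟨p, x⟩ ⟨hp, -⟩
      exact ⟨hp, mem_univ _⟩)
  have h3 := h2.comp (f := fun p : P => (p, (0 : X))) (s := s) (by fun_prop)
    (fun p hp => ⟨hp, mem_univ _⟩)
  refine h3.congr fun p hp => ?_
  simp only [Function.comp, MeasureTheory.convolution, ContinuousLinearMap.mul_apply', zero_sub,
    neg_neg]
  refine integral_congr_ae (Eventually.of_forall fun x => ?_)
  by_cases hx : x ∈ k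
  · simp [hx]
  · simp [hKk p hp x hx]

theorem fderiv_integral_mul {P X : Type*} [NormedAddCommGroup P] [NormedSpace ℝ P]
    [NormedAddCommGroup X] [NormedSpace ℝ X] [FiniteDimensional ℝ X] [MeasurableSpace X]
    [BorelSpace X] {ν : Measure X} {f : X → ℝ} {K : P × X → ℝ} {s : Set P} {k : Set X}
    (hs : IsOpen s) (hk : IsCompact k) (hKk : ∀ p ∈ s, ∀ x ∉ k, K (p, x) = 0)
    (hf : IntegrableOn f k ν) (hK : ContDiffOn ℝ ∞ K (s ×ˢ univ)) {p : P} (hp : p ∈ s) (v : P) :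
    fderiv ℝ (fun p => ∫ x, f x * K (p, x) ∂ν) p v = ∫ x, f x * fderiv ℝ K (p, x) (v, 0) ∂ν := by
  have hopen : IsOpen (s ×ˢ (univ : Set X)) := hs.prod isOpen_univ
  have hd : DifferentiableAt ℝ (fun p => ∫ x, f x * K (p, x) ∂ν) p :=
    ((contDiffOn_integral_mul hs hk hKk hf hK).differentiableOn (by simp)).differentiableAt
      (hs.mem_nhds hp)
  have hKd : ∀ p' ∈ s, ∀ x, HasFDerivAt K (fderiv ℝ K (p', x)) (p', x) := fun p' hp' x =>
    ((hK.differentiableOn (by simp)).differentiableAt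
      (hopen.mem_nhds ⟨hp', mem_univ _⟩)).hasFDerivAt
  have hcont : ContinuousOn (fun y => fderiv ℝ K y (v, 0)) (s ×ˢ univ) :=
    (hK.continuousOn_fderiv_of_isOpen hopen (by simp)).clm_apply continuousOn_const
  have hKc : ContinuousOn K (s ×ˢ univ) := hK.continuousOn
  -- a segment around `p` in direction `v`
  obtain ⟨δ, hδ, hball⟩ : ∃ δ : ℝ, 0 < δ ∧ ∀ t ∈ Icc (-δ) δ, p + t • v ∈ s := by
    have : ∀ᶠ t in 𝓝 (0 : ℝ), p + t • v ∈ s := by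
      have hc : ContinuousAt (fun t : ℝ => p + t • v) 0 := by fun_prop
      exact hc (by simpa using hs.mem_nhds hp)
    obtain ⟨ε, hε, h⟩ := Metric.eventually_nhds_iff.1 this
    refine ⟨ε / 2, by positivity, fun t ht => h ?_⟩
    rw [Real.dist_eq, sub_zero]
    exact lt_of_le_of_lt (abs_le.2 ⟨ht.1, ht.2⟩) (by linarith)
  obtain ⟨C, hC⟩ : ∃ C, ∀ t ∈ Icc (-δ) δ, ∀ x ∈ k, |fderiv ℝ K (p + t • v, x) (v, 0)| ≤ C := by
    have hcomp : IsCompact (Icc (-δ) δ ×ˢ k) := isCompact_Icc.prod hk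
    have hco : ContinuousOn (fun y : ℝ × X => fderiv ℝ K (p + y.1 • v, y.2) (v, 0))
        (Icc (-δ) δ ×ˢ k) :=
      hcont.comp (f := fun y : ℝ × X => (p + y.1 • v, y.2)) (by fun_prop)
        (fun y hy => ⟨hball _ hy.1, mem_univ _⟩)
    obtain ⟨C, hC⟩ := hcomp.exists_bound_of_continuousOn hco
    exact ⟨C, fun t ht x hx => hC (t, x) ⟨ht, hx⟩⟩
  have hz : ∀ p' ∈ s, ∀ x ∉ k, fderiv ℝ K (p', x) (v, 0) = 0 := by
    intro p' hp' x hx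
    have h0 : HasFDerivAt (fun p'' : P => K (p'', x))
        ((fderiv ℝ K (p', x)).comp (ContinuousLinearMap.inl ℝ P X)) p' :=
      (hKd p' hp' x).comp p' (hasFDerivAt_prodMk_left p' x)
    have h1 : HasFDerivAt (fun p'' : P => K (p'', x)) (0 : P →L[ℝ] ℝ) p' := by
      refine (hasFDerivAt_const (0 : ℝ) p').congr_of_eventuallyEq ?_
      filter_upwards [hs.mem_nhds hp'] with p'' hp'' using hKk p'' hp'' x hx
    have := congrArg (fun L => L v) (h0.unique h1)
    simpa using this
  have hind : ∀ (g : X → ℝ), (∀ x ∉ k, g x = 0) →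
      (fun x => f x * g x) = fun x => k.indicator f x * g x := by
    intro g hg
    funext x
    by_cases hx : x ∈ k
    · simp [hx]
    · simp [hx, hg x hx]
  have hfi : Integrable (k.indicator f) ν := (integrable_indicator_iff hk.measurableSet).2 hf
  have hslice : ∀ {g : P × X → ℝ}, ContinuousOn g (s ×ˢ univ) → ∀ p' ∈ s,
      Continuous fun x => g (p', x) := by
    intro g hg p' hp'
    exact hg.comp_continuous (by fun_prop) (fun x => ⟨hp', mem_univ _⟩)
  have hmeas : ∀ {g : P × X → ℝ}, ContinuousOn g (s ×ˢ univ) → ∀ p' ∈ s,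
      AEStronglyMeasurable (fun x => k.indicator f x * g (p', x)) ν := by
    intro g hg p' hp'
    exact hfi.aestronglyMeasurable.mul (hslice hg p' hp').aestronglyMeasurable
  have key := hasDerivAt_integral_of_dominated_loc_of_deriv_le (μ := ν) (𝕜 := ℝ)
    (F := fun (t : ℝ) x => k.indicator f x * K (p + t • v, x))
    (F' := fun (t : ℝ) x => k.indicator f x * fderiv ℝ K (p + t • v, x) (v, 0))
    (x₀ := 0) (s := Icc (-δ) δ) (bound := fun x => |k.indicator f x| * |C|)
    (Icc_mem_nhds (by linarith) hδ)
    (by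
      filter_upwards [Icc_mem_nhds (by linarith : -δ < 0) hδ] with t ht
      exact hmeas hKc _ (hball t ht))
    (by
      obtain ⟨C', hC'⟩ := hk.exists_bound_of_continuousOn (hslice hKc p hp).continuousOn
      refine (hfi.abs.mul_const |C'|).mono' (by simpa using hmeas hKc p hp)
        (Eventually.of_forall fun x => ?_)
      by_cases hx : x ∈ k
      · simp only [norm_mul, Real.norm_eq_abs, zero_smul, add_zero]
        exact mul_le_mul_of_nonneg_left ((hC' x hx).trans (le_abs_self _)) (abs_nonneg _)
      · simp [hx])
    (by simpa using hmeas hcont p hp)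
    (Eventually.of_forall fun x t ht => by
      by_cases hx : x ∈ k
      · rw [norm_mul, Real.norm_eq_abs, Real.norm_eq_abs]
        exact mul_le_mul_of_nonneg_left ((hC t ht x hx).trans (le_abs_self _)) (abs_nonneg _)
      · simp [hx])
    (hfi.abs.mul_const _)
    (Eventually.of_forall fun x t ht => by
      refine HasDerivAt.const_mul _ ?_
      have h1 : HasDerivAt (fun t : ℝ => (p + t • v, x)) (v, (0 : X)) t := by
        refine HasDerivAt.prodMk ?_ (hasDerivAt_const _ _)
        simpa using ((hasDerivAt_id t).smul_const v).const_add p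
      exact (hKd _ (hball t ht) x).comp_hasDerivAt t h1)
  have hline : HasDerivAt (fun t : ℝ => ∫ x, f x * K (p + t • v, x) ∂ν)
      (fderiv ℝ (fun p => ∫ x, f x * K (p, x) ∂ν) p v) 0 := by
    have h1 : HasDerivAt (fun t : ℝ => p + t • v) v 0 := by
      simpa using ((hasDerivAt_id (0 : ℝ)).smul_const v).const_add p
    have hd' : HasFDerivAt (fun p => ∫ x, f x * K (p, x) ∂ν)
      (fderiv ℝ (fun p => ∫ x, f x * K (p, x) ∂ν) p) (p + (0 : ℝ) • v) := by
      simpa using hd.hasFDerivAt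
    exact hd'.comp_hasDerivAt (0 : ℝ) h1
  have hkey2 : HasDerivAt (fun t : ℝ => ∫ x, f x * K (p + t • v, x) ∂ν)
      (∫ x, f x * fderiv ℝ K (p, x) (v, 0) ∂ν) 0 := by
    rw [hind _ (hz p hp)]
    refine HasDerivAt.congr_of_eventuallyEq (by simpa using key.2) ?_
    filter_upwards [Icc_mem_nhds (by linarith : -δ < 0) hδ] with t ht
    rw [hind _ (hKk _ (hball t ht))]
  exact hline.unique hkey2

/-- Integrals against a continuous weight over a compact interval of a smooth kernel. -/
theorem contDiff_intervalIntegral_mul {P : Type*} [NormedAddCommGroup P] [NormedSpace ℝ P]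
    {m : ℝ → ℝ} (hm : Continuous m) {K : P × ℝ → ℝ} (hK : ContDiff ℝ ∞ K) {b : ℝ} (hb : 0 ≤ b) :
    ContDiff ℝ ∞ (fun p => ∫ θ in 0..b, m θ * K (p, θ)) ∧
    ∀ p v, fderiv ℝ (fun p => ∫ θ in 0..b, m θ * K (p, θ)) p v =
      ∫ θ in 0..b, m θ * fderiv ℝ K (p, θ) (v, 0) := by
  let χ : ContDiffBump (0 : ℝ) := ⟨b + 1, b + 2, by linarith, by linarith⟩
  have hχ : ∀ θ ∈ Ioc 0 b, (fun t => χ t) =ᶠ[𝓝 θ] 1 := by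
    intro θ hθ
    apply χ.eventuallyEq_one_of_mem_ball
    rw [mem_ball, Real.dist_eq, sub_zero, abs_of_pos hθ.1]
    exact lt_of_le_of_lt hθ.2 (by change b < b + 1; linarith)
  have hKχ : ContDiffOn ℝ ∞ (fun y : P × ℝ => χ y.2 * K y) (univ ×ˢ univ) :=
    ((χ.contDiff.comp contDiff_snd).mul hK).contDiffOn
  have hsupp : ∀ p ∈ (univ : Set P), ∀ x ∉ closedBall (0 : ℝ) (b + 2), χ x * K (p, x) = 0 := by
    intro p _ x hx
    have : χ x = 0 := χ.zero_of_le_dist (by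
      rw [mem_closedBall, not_le] at hx
      exact hx.le)
    simp [this]
  have hf : IntegrableOn ((Ioc 0 b).indicator m) (closedBall (0 : ℝ) (b + 2)) := by
    refine Integrable.integrableOn ?_
    rw [integrable_indicator_iff measurableSet_Ioc]
    exact (hm.intervalIntegrable 0 b).1
  have heq : (fun p => ∫ θ in 0..b, m θ * K (p, θ)) =
      fun p => ∫ θ, (Ioc 0 b).indicator m θ * (χ θ * K (p, θ)) := by
    funext p
    rw [intervalIntegral.integral_of_le hb, ← integral_indicator measurableSet_Ioc]
    congr 1
    funext θ
    by_cases hθ : θ ∈ Ioc 0 b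
    · have := (hχ θ hθ).eq_of_nhds
      simp only [Pi.one_apply] at this
      simp [hθ, this]
    · simp [hθ]
  constructor
  · rw [heq, ← contDiffOn_univ]
    exact contDiffOn_integral_mul isOpen_univ (isCompact_closedBall _ _) hsupp hf hKχ
  · intro p v
    rw [heq, fderiv_integral_mul (K := fun y : P × ℝ => χ y.2 * K y) isOpen_univ
      (isCompact_closedBall _ _) hsupp hf hKχ (mem_univ p) v,
      intervalIntegral.integral_of_le hb, ← integral_indicator measurableSet_Ioc]
    congr 1
    funext θ
    by_cases hθ : θ ∈ Ioc 0 b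
    · have : (fun y : P × ℝ => χ y.2 * K y) =ᶠ[𝓝 (p, θ)] K := by
        have h2 := (continuous_snd (X := P) (Y := ℝ)).continuousAt (x := (p, θ)) (hχ θ hθ)
        filter_upwards [h2] with y hy
        simp only [mem_preimage, mem_ofPred_eq, Pi.one_apply] at hy
        simp [hy]
      simp [hθ, this.fderiv_eq]
    · simp [hθ]

/-- The operator `z ΔF + (1+2s) ∂_z F`, conjugate to `CSop` by `z^{2s}`. -/
noncomputable def Mop (N : ℕ) (s : ℝ) (F : Euc N × ℝ → ℝ) (q : Euc N × ℝ) : ℝ :=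
  q.2 * ((∑ i : Fin N, d2 F q (EuclideanSpace.single i (1:ℝ), (0:ℝ))) +
        d2 F q ((0 : Euc N), (1:ℝ)))
    + (1 + 2*s) * fderiv ℝ F q ((0 : Euc N), (1:ℝ))

theorem isOpen_halfSpace (N : ℕ) : IsOpen {q : Euc N × ℝ | 0 < q.2} :=
  isOpen_lt continuous_const continuous_snd

theorem d2_congr {N : ℕ} {F G : Euc N × ℝ → ℝ} {q : Euc N × ℝ} (h : F =ᶠ[𝓝 q] G)
    (v : Euc N × ℝ) : d2 F q v = d2 G q v := by
  unfold d2
  congr 1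
  apply Filter.EventuallyEq.fderiv_eq
  filter_upwards [h.eventually_nhds] with w hw
  rw [Filter.EventuallyEq.fderiv_eq hw]

theorem contDiff_fderiv_apply_const {E : Type*} [NormedAddCommGroup E] [NormedSpace ℝ E]
    {F : E → ℝ} (hF : ContDiff ℝ ∞ F) (v : E) : ContDiff ℝ ∞ (fun w => fderiv ℝ F w v) :=
  (hF.fderiv_right (m := ∞) (by simp)).clm_apply contDiff_const

theorem differentiableAt_fderiv_apply {E : Type*} [NormedAddCommGroup E] [NormedSpace ℝ E]
    {F : E → ℝ} {q : E} (hF : ContDiffAt ℝ 2 F q) (v : E) :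
    DifferentiableAt ℝ (fun w => fderiv ℝ F w v) q :=
  ((hF.fderiv_right (m := 1) (by norm_num)).differentiableAt (by simp)).clm_apply
    (differentiableAt_const _)

theorem d2_mul {N : ℕ} {F G : Euc N × ℝ → ℝ} {q : Euc N × ℝ} (hF : ContDiffAt ℝ 2 F q)
    (hG : ContDiffAt ℝ 2 G q) (v : Euc N × ℝ) :
    d2 (fun w => F w * G w) q v =
      d2 F q v * G q + 2 * (fderiv ℝ F q v * fderiv ℝ G q v) + F q * d2 G q v := by
  have hFd : ∀ᶠ w in 𝓝 q, DifferentiableAt ℝ F w := by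
    filter_upwards [hF.eventually (by simp)] with w hw using hw.differentiableAt (by simp)
  have hGd : ∀ᶠ w in 𝓝 q, DifferentiableAt ℝ G w := by
    filter_upwards [hG.eventually (by simp)] with w hw using hw.differentiableAt (by simp)
  have h1 : (fun w => fderiv ℝ (fun w => F w * G w) w v) =ᶠ[𝓝 q]
      fun w => F w * fderiv ℝ G w v + G w * fderiv ℝ F w v := by
    filter_upwards [hFd, hGd] with w h1 h2
    rw [fderiv_fun_mul h1 h2]
    simp
  have hF' := differentiableAt_fderiv_apply hF v
  have hG' := differentiableAt_fderiv_apply hG v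
  unfold d2
  rw [h1.fderiv_eq, fderiv_fun_add (hFd.self_of_nhds.fun_mul hG') (hGd.self_of_nhds.fun_mul hF'),
    fderiv_fun_mul hFd.self_of_nhds hG', fderiv_fun_mul hGd.self_of_nhds hF']
  simp
  ring

theorem fderiv_comp_snd {N : ℕ} {ψ : ℝ → ℝ} {q : Euc N × ℝ} (h : DifferentiableAt ℝ ψ q.2)
    (v : Euc N × ℝ) : fderiv ℝ (fun w : Euc N × ℝ => ψ w.2) q v = deriv ψ q.2 * v.2 := by
  have h1 := h.hasDerivAt.comp_hasFDerivAt q (hasFDerivAt_snd (𝕜 := ℝ) (E := Euc N) (F := ℝ))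
  have h2 : HasFDerivAt (fun w : Euc N × ℝ => ψ w.2) _ q := h1
  rw [h2.fderiv]
  simp

theorem d2_comp_snd {N : ℕ} {ψ : ℝ → ℝ} {q : Euc N × ℝ} (h : ContDiffAt ℝ 2 ψ q.2)
    (v : Euc N × ℝ) :
    d2 (fun w : Euc N × ℝ => ψ w.2) q v = deriv (deriv ψ) q.2 * v.2 ^ 2 := by
  have h1 : (fun w => fderiv ℝ (fun w : Euc N × ℝ => ψ w.2) w v) =ᶠ[𝓝 q]
      fun w => deriv ψ w.2 * v.2 := by
    have : ∀ᶠ w in 𝓝 q, ContDiffAt ℝ 2 ψ w.2 :=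
      (continuous_snd (X := Euc N) (Y := ℝ)).continuousAt (h.eventually (by simp))
    filter_upwards [this] with w hw
    exact fderiv_comp_snd (hw.differentiableAt (by simp)) v
  have h2 : DifferentiableAt ℝ (deriv ψ) q.2 := by
    have := differentiableAt_fderiv_apply h 1
    simpa using this
  have h3 : DifferentiableAt ℝ (fun w : Euc N × ℝ => deriv ψ w.2) q :=
    h2.comp q differentiableAt_snd
  unfold d2
  rw [h1.fderiv_eq, fderiv_mul_const h3]
  have := fderiv_comp_snd (N := N) (q := q) h2 v
  simp only [smul_apply, smul_eq_mul]
  rw [this]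
  ring

theorem hasFDerivAt_radial {N : ℕ} (x : Euc N) {P P' : ℝ → ℝ}
    (hP : ∀ t, HasDerivAt P (P' t) t) (q : Euc N × ℝ) :
    HasFDerivAt (fun w : Euc N × ℝ => ‖w.1 - x‖ ^ 2 + P w.2)
      ((2 : ℝ) • (innerSL ℝ (q.1 - x)).comp (ContinuousLinearMap.fst ℝ (Euc N) ℝ)
        + P' q.2 • ContinuousLinearMap.snd ℝ (Euc N) ℝ) q := by
  have h1 : HasFDerivAt (fun w : Euc N × ℝ => w.1 - x) (ContinuousLinearMap.fst ℝ (Euc N) ℝ) q :=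
    (hasFDerivAt_fst).sub_const x
  have h2 := h1.norm_sq
  have h3 := (hP q.2).comp_hasFDerivAt q (hasFDerivAt_snd (𝕜 := ℝ) (E := Euc N) (F := ℝ))
  have h4 : HasFDerivAt (fun w : Euc N × ℝ => ‖w.1 - x‖ ^ 2 + P w.2) _ q := h2.add h3
  refine h4.congr_fderiv ?_
  ext <;> simp

theorem fderiv_radial {N : ℕ} (x : Euc N) {f f' P P' : ℝ → ℝ} (hf : ∀ t, HasDerivAt f (f' t) t)
    (hP : ∀ t, HasDerivAt P (P' t) t) (q v : Euc N × ℝ) :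
    fderiv ℝ (fun w : Euc N × ℝ => f (‖w.1 - x‖ ^ 2 + P w.2)) q v =
      f' (‖q.1 - x‖ ^ 2 + P q.2) * (2 * inner ℝ (q.1 - x) v.1 + P' q.2 * v.2) := by
  have h := (hf (‖q.1 - x‖ ^ 2 + P q.2)).comp_hasFDerivAt q (hasFDerivAt_radial x hP q)
  have h2 : HasFDerivAt (fun w : Euc N × ℝ => f (‖w.1 - x‖ ^ 2 + P w.2)) _ q := h
  rw [h2.fderiv]
  simp [inner_sub_left]
  ring

theorem d2_radial {N : ℕ} (x : Euc N) {f f' f'' P P' P'' : ℝ → ℝ}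
    (hf : ∀ t, HasDerivAt f (f' t) t) (hf' : ∀ t, HasDerivAt f' (f'' t) t)
    (hP : ∀ t, HasDerivAt P (P' t) t) (hP' : ∀ t, HasDerivAt P' (P'' t) t) (q v : Euc N × ℝ) :
    d2 (fun w : Euc N × ℝ => f (‖w.1 - x‖ ^ 2 + P w.2)) q v =
      f'' (‖q.1 - x‖ ^ 2 + P q.2) * (2 * inner ℝ (q.1 - x) v.1 + P' q.2 * v.2) ^ 2
      + f' (‖q.1 - x‖ ^ 2 + P q.2) * (2 * ‖v.1‖ ^ 2 + P'' q.2 * v.2 ^ 2) := by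
  unfold d2
  have h0 : (fun w => fderiv ℝ (fun w : Euc N × ℝ => f (‖w.1 - x‖ ^ 2 + P w.2)) w v) =
      fun q => f' (‖q.1 - x‖ ^ 2 + P q.2) * (2 * inner ℝ v.1 (q.1 - x) + P' q.2 * v.2) := by
    funext w
    rw [fderiv_radial x hf hP w v, real_inner_comm]
  rw [h0]
  have h1 := (hf' (‖q.1 - x‖ ^ 2 + P q.2)).comp_hasFDerivAt q (hasFDerivAt_radial x hP q)
  have h2 : HasFDerivAt (fun w : Euc N × ℝ => w.1 - x) (ContinuousLinearMap.fst ℝ (Euc N) ℝ) q :=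
    (hasFDerivAt_fst).sub_const x
  have h3 := (((innerSL ℝ v.1).hasFDerivAt (x := q.1 - x)).comp q h2).const_mul (2 : ℝ)
  have h4 := ((hP' q.2).comp_hasFDerivAt q
    (hasFDerivAt_snd (𝕜 := ℝ) (E := Euc N) (F := ℝ))).mul_const v.2
  have h5 : HasFDerivAt (fun q : Euc N × ℝ => f' (‖q.1 - x‖ ^ 2 + P q.2) *
    (2 * inner ℝ v.1 (q.1 - x) + P' q.2 * v.2)) _ q := h1.mul (h3.add h4)
  rw [h5.fderiv]
  have h6 : inner ℝ v.1 (q.1 - x) = inner ℝ q.1 v.1 - inner ℝ x v.1 := by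
    rw [real_inner_comm, inner_sub_left]
  simp [inner_sub_left, h6]
  ring

theorem Mop_radial {N : ℕ} (s : ℝ) (x : Euc N) {f f' f'' P P' P'' : ℝ → ℝ}
    (hf : ∀ t, HasDerivAt f (f' t) t) (hf' : ∀ t, HasDerivAt f' (f'' t) t)
    (hP : ∀ t, HasDerivAt P (P' t) t) (hP' : ∀ t, HasDerivAt P' (P'' t) t) (q : Euc N × ℝ) :
    Mop N s (fun w : Euc N × ℝ => f (‖w.1 - x‖ ^ 2 + P w.2)) q =
      q.2 * (f'' (‖q.1 - x‖ ^ 2 + P q.2) * (4 * ‖q.1 - x‖ ^ 2 + P' q.2 ^ 2)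
      + f' (‖q.1 - x‖ ^ 2 + P q.2) * (2 * N + P'' q.2)) +
      (1 + 2 * s) * (f' (‖q.1 - x‖ ^ 2 + P q.2) * P' q.2) := by
  have hsum : ∑ i : Fin N, d2 (fun w : Euc N × ℝ => f (‖w.1 - x‖ ^ 2 + P w.2)) q
      (EuclideanSpace.single i (1:ℝ), (0:ℝ)) =
      f'' (‖q.1 - x‖ ^ 2 + P q.2) * (4 * ‖q.1 - x‖ ^ 2)
      + f' (‖q.1 - x‖ ^ 2 + P q.2) * (2 * N) := by
    simp only [d2_radial x hf hf' hP hP']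
    rw [EuclideanSpace.real_norm_sq_eq (q.1 - x), Finset.sum_add_distrib, ← Finset.mul_sum]
    congr 1
    · congr 1
      rw [Finset.mul_sum]
      refine Finset.sum_congr rfl fun i _ => ?_
      rw [EuclideanSpace.inner_single_right]
      simp
      ring
    · simp
      ring
  unfold Mop
  rw [hsum, d2_radial x hf hf' hP hP', fderiv_radial x hf hP]
  simp only [inner_zero_right, norm_zero]
  ring

theorem Mop_mul_comp_snd {N : ℕ} (s : ℝ) {F : Euc N × ℝ → ℝ} {ψ : ℝ → ℝ} {q : Euc N × ℝ}
    (hF : ContDiffAt ℝ 2 F q) (hψ : ContDiffAt ℝ 2 ψ q.2) :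
    Mop N s (fun w => F w * ψ w.2) q = ψ q.2 * Mop N s F q +
      2 * q.2 * fderiv ℝ F q (0, 1) * deriv ψ q.2 +
      F q * (q.2 * deriv (deriv ψ) q.2 + (1 + 2 * s) * deriv ψ q.2) := by
  have hψ2 : ContDiffAt ℝ 2 (fun w : Euc N × ℝ => ψ w.2) q := hψ.comp q contDiffAt_snd
  have hψd := hψ.differentiableAt (by simp)
  unfold Mop
  simp only [d2_mul hF hψ2, d2_comp_snd hψ, fderiv_comp_snd hψd]
  rw [fderiv_fun_mul (hF.differentiableAt (by simp)) (hψ2.differentiableAt (by simp))]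
  simp [fderiv_comp_snd hψd]
  rw [← Finset.sum_mul]
  ring

theorem CSop_rpow_mul {N : ℕ} (s : ℝ) {F : Euc N × ℝ → ℝ} {q : Euc N × ℝ}
    (hF : ContDiffAt ℝ 2 F q) (hq : 0 < q.2) :
    CSop N s (fun w => F w * w.2 ^ (2 * s)) q = Mop N s F q := by
  have hψ : ContDiffAt ℝ 2 (fun z : ℝ => z ^ (2 * s)) q.2 := Real.contDiffAt_rpow_const_of_ne hq.ne'
  have hψ2 : ContDiffAt ℝ 2 (fun w : Euc N × ℝ => w.2 ^ (2 * s)) q :=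
    hψ.comp q contDiffAt_snd
  have hψd := hψ.differentiableAt (by simp)
  have e1 : deriv (fun z : ℝ => z ^ (2 * s)) q.2 = 2 * s * q.2 ^ (2 * s - 1) :=
    (Real.hasDerivAt_rpow_const (Or.inl hq.ne')).deriv
  have e2 : deriv (deriv (fun z : ℝ => z ^ (2 * s))) q.2 =
      2 * s * ((2 * s - 1) * q.2 ^ (2 * s - 1 - 1)) := by
    have : deriv (fun z : ℝ => z ^ (2 * s)) =ᶠ[𝓝 q.2] fun z => 2 * s * z ^ (2 * s - 1) := by
      filter_upwards [lt_mem_nhds hq] with z hz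
      exact (Real.hasDerivAt_rpow_const (Or.inl hz.ne')).deriv
    rw [this.deriv_eq, deriv_const_mul _
      (Real.differentiableAt_rpow_const_of_ne _ hq.ne'), (Real.hasDerivAt_rpow_const (Or.inl hq.ne')).deriv]
  unfold CSop Mop
  simp only [d2_mul hF hψ2, d2_comp_snd hψ, fderiv_comp_snd hψd]
  rw [fderiv_fun_mul (hF.differentiableAt (by simp)) (hψ2.differentiableAt (by simp))]
  simp only [add_apply, smul_apply, smul_eq_mul,
    fderiv_comp_snd hψd, e1, e2]
  have r1 : q.2 ^ (1 - 2 * s) = q.2 * (q.2 ^ (2 * s))⁻¹ := by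
    rw [Real.rpow_sub hq, Real.rpow_one]; rfl
  have r2 : q.2 ^ (-(2 * s)) = (q.2 ^ (2 * s))⁻¹ := Real.rpow_neg hq.le _
  have r3 : q.2 ^ (2 * s - 1) = q.2 ^ (2 * s) * q.2⁻¹ := by
    rw [Real.rpow_sub hq, Real.rpow_one]; rfl
  have r4 : q.2 ^ (2 * s - 1 - 1) = q.2 ^ (2 * s) * q.2⁻¹ * q.2⁻¹ := by
    rw [Real.rpow_sub hq, Real.rpow_one, r3]; rfl
  have hne : q.2 ^ (2 * s) ≠ 0 := (Real.rpow_pos_of_pos hq _).ne'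
  rw [r1, r2, r3, r4]
  simp only [mul_zero, add_zero, ne_eq, OfNat.ofNat_ne_zero, not_false_eq_true,
    zero_pow]
  rw [← Finset.sum_mul]
  field_simp
  ring

/-- Distributional solutions of the transposed equation of `Mop`. -/
def WeakSol (N : ℕ) (s : ℝ) (w : Euc N × ℝ → ℝ) : Prop :=
  LocallyIntegrableOn w {q : Euc N × ℝ | 0 < q.2} ∧
  ∀ F : Euc N × ℝ → ℝ, ContDiff ℝ ∞ F → HasCompactSupport F →
    tsupport F ⊆ {q : Euc N × ℝ | 0 < q.2} →
    ∫ q in {q : Euc N × ℝ | 0 < q.2}, w q * Mop N s F q = 0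

theorem contDiff_mul_of_tsupport {E : Type*} [NormedAddCommGroup E] [NormedSpace ℝ E]
    {F G : E → ℝ} {U : Set E} (hU : IsOpen U) (hF : ContDiff ℝ ∞ F) (hs : tsupport F ⊆ U)
    (hG : ContDiffOn ℝ ∞ G U) : ContDiff ℝ ∞ (fun w => F w * G w) := by
  rw [contDiff_iff_contDiffAt]
  intro q
  by_cases hq : q ∈ tsupport F
  · exact hF.contDiffAt.mul (hG.contDiffAt (hU.mem_nhds (hs hq)))
  · refine (contDiffAt_const (c := (0 : ℝ))).congr_of_eventuallyEq ?_
    filter_upwards [notMem_tsupport_iff_eventuallyEq.1 hq] with w hw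
    simp [hw]

theorem contDiffOn_rpow_snd (N : ℕ) (a : ℝ) :
    ContDiffOn ℝ ∞ (fun w : Euc N × ℝ => w.2 ^ a) {q : Euc N × ℝ | 0 < q.2} := fun _ hq =>
  (contDiffAt_snd.rpow_const_of_ne (ne_of_gt hq)).contDiffWithinAt

theorem weakSol_of_CSop {N : ℕ} {s : ℝ} {u : Euc N × ℝ → ℝ}
    (hloc : LocallyIntegrableOn u {q : Euc N × ℝ | 0 < q.2})
    (hweak : ∀ φ : Euc N × ℝ → ℝ, ContDiff ℝ (⊤ : ℕ∞) φ → HasCompactSupport φ →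
      tsupport φ ⊆ {q : Euc N × ℝ | 0 < q.2} →
      ∫ q in {q : Euc N × ℝ | 0 < q.2}, u q * CSop N s φ q = 0) : WeakSol N s u := by
  refine ⟨hloc, fun F hF hc hs => ?_⟩
  have h := hweak (fun w : Euc N × ℝ => F w * w.2 ^ (2 * s))
    (contDiff_mul_of_tsupport (isOpen_halfSpace N) hF hs (contDiffOn_rpow_snd N _))
    hc.mul_right ((tsupport_mul_subset_left).trans hs)
  refine Eq.trans ?_ h
  refine setIntegral_congr_fun (isOpen_halfSpace N).measurableSet fun q hq => ?_
  rw [CSop_rpow_mul s (hF.contDiffAt.of_le (WithTop.coe_le_coe.2 le_top)) hq]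

instance isAddHaarMeasure_volume_prod (N : ℕ) :
    (volume : Measure (Euc N × ℝ)).IsAddHaarMeasure :=
  Measure.prod.instIsAddHaarMeasure volume volume

theorem integral_fderiv_eq_zero {E : Type*} [NormedAddCommGroup E] [NormedSpace ℝ E]
    [FiniteDimensional ℝ E] [MeasurableSpace E] [BorelSpace E] {ν : Measure E}
    [ν.IsAddHaarMeasure] {G : E → ℝ} (hG : ContDiff ℝ ∞ G) (hc : HasCompactSupport G) (v : E) :
    ∫ q, fderiv ℝ G q v ∂ν = 0 := by
  have h1 : Integrable (fun q => fderiv ℝ G q v) ν :=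
    (contDiff_fderiv_apply_const hG v).continuous.integrable_of_hasCompactSupport
      (hc.fderiv_apply (𝕜 := ℝ) v)
  have := integral_mul_fderiv_eq_neg_fderiv_mul_of_integrable (μ := ν) (f := fun _ : E => (1:ℝ))
    (g := G) (v := v) (by simp) (by simpa using h1)
    (by simpa using hG.continuous.integrable_of_hasCompactSupport hc)
    (fun x _ => differentiableAt_const _) (fun x _ => hG.differentiable (by simp) x)
  simpa using this

theorem weakSol_one (N : ℕ) (s : ℝ) : WeakSol N s (fun _ => 1) := by
  refine ⟨continuousOn_const.locallyIntegrableOn (isOpen_halfSpace N).measurableSet,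
    fun F hF hc hs => ?_⟩
  have hFs : ∀ v : Euc N × ℝ, tsupport (fun w => fderiv ℝ F w v) ⊆ tsupport F := fun v =>
    tsupport_fderiv_apply_subset ℝ v
  have hG : ∀ v : Euc N × ℝ, ContDiff ℝ ∞ (fun w : Euc N × ℝ => fderiv ℝ F w v * w.2) := fun v =>
    (contDiff_fderiv_apply_const hF v).mul contDiff_snd
  have hGc : ∀ v : Euc N × ℝ, HasCompactSupport (fun w : Euc N × ℝ => fderiv ℝ F w v * w.2) :=
    fun v => (hc.fderiv_apply (𝕜 := ℝ) v).mul_right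
  have hz : ∀ v v' : Euc N × ℝ,
      ∫ q, fderiv ℝ (fun w : Euc N × ℝ => fderiv ℝ F w v * w.2) q v' = 0 :=
    fun v v' => integral_fderiv_eq_zero (hG v) (hGc v) v'
  have hi : ∀ v v' : Euc N × ℝ, Integrable
      (fun q => fderiv ℝ (fun w : Euc N × ℝ => fderiv ℝ F w v * w.2) q v') :=
    fun v v' => (contDiff_fderiv_apply_const (hG v) v').continuous.integrable_of_hasCompactSupport
      ((hGc v).fderiv_apply (𝕜 := ℝ) v')
  have hiF : Integrable (fun q => fderiv ℝ F q (0, 1)) :=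
    (contDiff_fderiv_apply_const hF _).continuous.integrable_of_hasCompactSupport
      (hc.fderiv_apply (𝕜 := ℝ) _)
  let ei : Fin N → Euc N × ℝ := fun i => (EuclideanSpace.single i (1:ℝ), (0:ℝ))
  have hd : ∀ v v' q : Euc N × ℝ, fderiv ℝ (fun w : Euc N × ℝ => fderiv ℝ F w v * w.2) q v' =
      fderiv ℝ F q v * v'.2 + q.2 * fderiv ℝ (fun w => fderiv ℝ F w v) q v' := by
    intro v v' q
    rw [fderiv_fun_mul (differentiableAt_fderiv_apply
      (hF.contDiffAt.of_le (WithTop.coe_le_coe.2 le_top)) v) differentiableAt_snd]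
    simp [fderiv_snd]
  have hS : ∫ q, Mop N s F q = 0 := by
    have : Mop N s F = fun q => ((∑ i, fderiv ℝ (fun w : Euc N × ℝ => fderiv ℝ F w (ei i) * w.2) q
        (ei i)) + fderiv ℝ (fun w : Euc N × ℝ => fderiv ℝ F w (0, 1) * w.2) q (0, 1)) +
        2 * s * fderiv ℝ F q (0, 1) := by
      funext q
      simp only [hd, Mop, d2, ei, mul_zero, zero_add, ← Finset.mul_sum]
      ring
    have h2 : Integrable (fun q => (∑ i, fderiv ℝ (fun w : Euc N × ℝ => fderiv ℝ F w (ei i) * w.2) q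
        (ei i)) + fderiv ℝ (fun w : Euc N × ℝ => fderiv ℝ F w (0, 1) * w.2) q (0, 1)) :=
      (integrable_finsetSum _ fun i _ => hi _ _).add (hi _ _)
    rw [this, integral_add h2 (hiF.const_mul _), integral_add (integrable_finsetSum _ fun i _ => hi _ _) (hi _ _),
      integral_finsetSum _ fun i _ => hi _ _, integral_const_mul, integral_fderiv_eq_zero hF hc]
    simp [hz]
  simp only [one_mul]
  refine Eq.trans (setIntegral_eq_integral_of_forall_compl_eq_zero fun q hq => ?_) hS
  have h0 : ∀ v, fderiv ℝ F q v = 0 := fun v =>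
    image_eq_zero_of_notMem_tsupport (f := fun q => fderiv ℝ F q v) fun h => hq (hs (hFs v h))
  have h1 : ∀ v, d2 F q v = 0 := fun v =>
    image_eq_zero_of_notMem_tsupport (f := fun q => fderiv ℝ (fun w => fderiv ℝ F w v) q v)
      fun h => hq (hs (hFs v (tsupport_fderiv_apply_subset ℝ v h)))
  simp [Mop, h0, h1]

/-- There is a smooth profile supported in `(-∞, 1]`, with positive derivative on `(-∞, 1)`. -/
theorem exists_profile : ∃ f : ℝ → ℝ, ContDiff ℝ ∞ f ∧ (∀ t, 1 ≤ t → f t = 0) ∧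
    (∀ t, 1 ≤ t → deriv f t = 0) ∧ (∀ t, t < 1 → 0 < deriv f t) := by
  have hd : ∀ t, HasDerivAt (fun σ => -expNegInvGlue (1 - σ))
      ((1 - t)⁻¹ ^ 2 * expNegInvGlue (1 - t)) t := by
    intro t
    have h := expNegInvGlue.hasDerivAt_polynomial_eval_inv_mul 1 (1 - t)
    have h2 : HasDerivAt (fun σ => -expNegInvGlue (1 - σ)) _ t :=
      (((h.scomp t ((hasDerivAt_id t).const_sub 1)).congr_of_eventuallyEq
        (f₁ := fun σ => expNegInvGlue (1 - σ)) (Eventually.of_forall fun x => by simp)).neg)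
    simpa using h2
  refine ⟨fun σ => -expNegInvGlue (1 - σ), (expNegInvGlue.contDiff.comp (by fun_prop)).neg,
    fun t ht => ?_, fun t ht => ?_, fun t ht => ?_⟩
  · simp only
    rw [expNegInvGlue.zero_of_nonpos (by linarith), neg_zero]
  · rw [(hd t).deriv, expNegInvGlue.zero_of_nonpos (by linarith), mul_zero]
  · rw [(hd t).deriv]
    exact mul_pos (pow_pos (inv_pos.2 (by linarith)) 2) (expNegInvGlue.pos_of_pos (by linarith))

/-- The squared distance in `ℝ^N × ℝ²` between points at angle `θ`. -/
noncomputable def capDist {N : ℕ} (p q : Euc N × ℝ) (θ : ℝ) : ℝ :=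
  ‖q.1 - p.1‖ ^ 2 + (p.2 ^ 2 + q.2 ^ 2 - 2 * p.2 * q.2 * Real.cos θ)

/-- Averages over the angle of a function of the scaled squared distance. -/
noncomputable def capKernel {N : ℕ} (s : ℝ) (g : ℝ → ℝ)
    (y : (ℝ × (Euc N × ℝ)) × (Euc N × ℝ)) : ℝ :=
  ∫ θ in 0..(Real.pi / 2), Real.sin θ ^ (2 * s) * g (y.1.1 * capDist y.1.2 y.2 θ)

theorem continuous_sin_rpow {a : ℝ} (ha : 0 ≤ a) : Continuous fun θ => Real.sin θ ^ a :=
  Real.continuous_sin.rpow_const fun _ => Or.inr ha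

theorem ContDiff.capDist {N : ℕ} {E : Type*} [NormedAddCommGroup E] [NormedSpace ℝ E]
    {p q : E → Euc N × ℝ} {θ : E → ℝ} (hp : ContDiff ℝ ∞ p) (hq : ContDiff ℝ ∞ q)
    (hθ : ContDiff ℝ ∞ θ) : ContDiff ℝ ∞ (fun y => capDist (p y) (q y) (θ y)) := by
  unfold _root_.capDist
  have h1 : ContDiff ℝ ∞ (fun y => Real.cos (θ y)) := hθ.cos
  have h2 : ContDiff ℝ ∞ (fun y => ‖(q y).1 - (p y).1‖ ^ 2) :=
    ContDiff.norm_sq ℝ (by fun_prop)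
  fun_prop

theorem contDiff_capKernel_integrand {N : ℕ} {g : ℝ → ℝ} (hg : ContDiff ℝ ∞ g) :
    ContDiff ℝ ∞ (fun y : ((ℝ × (Euc N × ℝ)) × (Euc N × ℝ)) × ℝ =>
      g (y.1.1.1 * capDist y.1.1.2 y.1.2 y.2)) := by
  have h : ContDiff ℝ ∞ (fun y : ((ℝ × (Euc N × ℝ)) × (Euc N × ℝ)) × ℝ =>
      capDist y.1.1.2 y.1.2 y.2) :=
    ContDiff.capDist contDiff_fst.fst.snd contDiff_fst.snd contDiff_snd
  exact ContDiff.comp hg (contDiff_fst.fst.fst.mul h)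

theorem contDiff_capKernel {N : ℕ} {s : ℝ} (hs : 0 ≤ s) {g : ℝ → ℝ} (hg : ContDiff ℝ ∞ g) :
    ContDiff ℝ ∞ (capKernel (N := N) s g) :=
  (contDiff_intervalIntegral_mul (continuous_sin_rpow (by linarith))
    (contDiff_capKernel_integrand hg) (by positivity)).1

theorem fderiv_capKernel {N : ℕ} {s : ℝ} (hs : 0 ≤ s) {g : ℝ → ℝ} (hg : ContDiff ℝ ∞ g)
    (y : (ℝ × (Euc N × ℝ)) × (Euc N × ℝ)) :
    y.1.1 * fderiv ℝ (capKernel s g) y ((1, 0), 0) = capKernel s (fun t => t * deriv g t) y := by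
  have h := (contDiff_intervalIntegral_mul (continuous_sin_rpow (a := 2 * s) (by linarith))
    (contDiff_capKernel_integrand (N := N) hg) (b := Real.pi / 2) (by positivity)).2 y ((1, 0), 0)
  change y.1.1 * fderiv ℝ (fun p => ∫ θ in 0..(Real.pi / 2), Real.sin θ ^ (2 * s) *
    g (p.1.1 * capDist p.1.2 p.2 θ)) y ((1, 0), 0) = _
  rw [h, ← intervalIntegral.integral_const_mul, capKernel]
  congr 1
  funext θ
  have h1 : HasDerivAt (fun t : ℝ => (((y.1.1 + t, y.1.2), y.2), θ))
      (((((1 : ℝ), (0 : Euc N × ℝ)), (0 : Euc N × ℝ)), (0 : ℝ))) 0 := by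
    refine HasDerivAt.prodMk (HasDerivAt.prodMk (HasDerivAt.prodMk ?_ (hasDerivAt_const _ _))
      (hasDerivAt_const _ _)) (hasDerivAt_const _ _)
    exact (hasDerivAt_id (0 : ℝ)).const_add _
  have h2 := ((contDiff_capKernel_integrand (N := N) hg).differentiable (by simp)
    (((y.1.1 + 0, y.1.2), y.2), θ)).hasFDerivAt.comp_hasDerivAt (0 : ℝ) h1
  have h3 : HasDerivAt (fun t : ℝ => g ((y.1.1 + t) * capDist y.1.2 y.2 θ))
      (deriv g (y.1.1 * capDist y.1.2 y.2 θ) * capDist y.1.2 y.2 θ) 0 := by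
    have h4 := (hg.differentiable (by simp) ((y.1.1 + 0) * capDist y.1.2 y.2 θ)).hasDerivAt
    have h5 : HasDerivAt (fun t : ℝ => (y.1.1 + t) * capDist y.1.2 y.2 θ)
        (capDist y.1.2 y.2 θ) 0 := by
      simpa using ((hasDerivAt_id (0 : ℝ)).const_add y.1.1).mul_const (capDist y.1.2 y.2 θ)
    have h7 : HasDerivAt (fun t : ℝ => g ((y.1.1 + t) * capDist y.1.2 y.2 θ)) _ 0 :=
      h4.comp (0 : ℝ) h5
    rwa [add_zero] at h7
  have h6 := h2.unique h3
  simp only [add_zero] at h6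
  rw [h6]
  ring

theorem capDist_ge {N : ℕ} {p q : Euc N × ℝ} {θ : ℝ} (h : 0 ≤ p.2 * q.2) :
    ‖q.1 - p.1‖ ^ 2 + (q.2 - p.2) ^ 2 ≤ capDist p q θ := by
  unfold capDist
  nlinarith [Real.cos_le_one θ]

theorem capDist_lt_imp {N : ℕ} {p q : Euc N × ℝ} {θ κ : ℝ} (hp : 0 < p.2) (hκ : 1 ≤ κ * p.2 ^ 2)
    (hκ0 : 0 < κ) (hθ : 0 ≤ Real.cos θ) (h : κ * capDist p q θ < 1) : 0 < q.2 := by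
  by_contra! hq
  have h1 : p.2 ^ 2 ≤ capDist p q θ := by
    unfold capDist
    have := mul_nonneg (mul_nonneg hp.le (neg_nonneg.2 hq)) hθ
    nlinarith [sq_nonneg ‖q.1 - p.1‖, sq_nonneg q.2]
  nlinarith [mul_le_mul_of_nonneg_left h1 hκ0.le]

theorem mem_closedBall_of_capDist_lt {N : ℕ} {p q : Euc N × ℝ} {θ κ : ℝ} (hp : 0 < p.2)
    (hκ : 1 ≤ κ * p.2 ^ 2)
    (hκ0 : 0 < κ) (hθ : 0 ≤ Real.cos θ) (h : κ * capDist p q θ < 1) :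
    q ∈ closedBall p (Real.sqrt κ⁻¹) := by
  have hq := capDist_lt_imp hp hκ hκ0 hθ h
  have h1 := capDist_ge (p := p) (q := q) (θ := θ) (by positivity)
  have h2 : ‖q.1 - p.1‖ ^ 2 + (q.2 - p.2) ^ 2 ≤ κ⁻¹ := by
    rw [← one_div, le_div_iff₀ hκ0]
    nlinarith
  rw [mem_closedBall, Prod.dist_eq, max_le_iff]
  constructor
  · rw [dist_eq_norm]
    exact Real.le_sqrt_of_sq_le (by nlinarith [sq_nonneg (q.2 - p.2)])
  · rw [Real.dist_eq]
    exact Real.le_sqrt_of_sq_le (by rw [sq_abs]; nlinarith [sq_nonneg ‖q.1 - p.1‖])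

theorem capKernel_eq_zero {N : ℕ} {s : ℝ} {g : ℝ → ℝ} (hg : ∀ t, 1 ≤ t → g t = 0)
    {κ : ℝ} {p q : Euc N × ℝ} (hp : 0 < p.2) (hκ0 : 0 < κ) (hκ : 1 ≤ κ * p.2 ^ 2)
    (hq : q ∉ closedBall p (Real.sqrt κ⁻¹)) : capKernel s g ((κ, p), q) = 0 := by
  unfold capKernel
  rw [intervalIntegral.integral_congr (g := fun _ => 0), intervalIntegral.integral_zero]
  intro θ hθ
  rw [uIcc_of_le (by positivity)] at hθ
  have hc : 0 ≤ Real.cos θ := Real.cos_nonneg_of_mem_Icc ⟨by linarith [hθ.1, Real.pi_pos], hθ.2⟩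
  simp only
  rw [hg _ (by by_contra! h; exact hq (mem_closedBall_of_capDist_lt hp hκ hκ0 hc h)), mul_zero]

theorem closedBall_subset_halfSpace {N : ℕ} {p : Euc N × ℝ} {r : ℝ} (hr : r < p.2) :
    closedBall p r ⊆ {q : Euc N × ℝ | 0 < q.2} := by
  intro q hq
  rw [mem_closedBall, Prod.dist_eq, max_le_iff, Real.dist_eq] at hq
  have := abs_le.1 hq.2
  change 0 < q.2
  linarith

theorem sqrt_inv_lt {κ t : ℝ} (ht : 0 < t) (hκ0 : 0 < κ) (hκ : 1 < κ * t ^ 2) :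
    Real.sqrt κ⁻¹ < t := by
  rw [Real.sqrt_lt' ht, inv_lt_iff_one_lt_mul₀ hκ0]
  linarith

theorem fderiv_slice {P : Type*} [NormedAddCommGroup P] [NormedSpace ℝ P] {K : P × ℝ → ℝ}
    (hK : ContDiff ℝ ∞ K) (p v : P) (θ : ℝ) :
    fderiv ℝ (fun w => K (w, θ)) p v = fderiv ℝ K (p, θ) (v, 0) := by
  have h : HasFDerivAt (fun w => K (w, θ))
      ((fderiv ℝ K (p, θ)).comp (ContinuousLinearMap.inl ℝ P ℝ)) p :=
    (hK.differentiable (by simp) (p, θ)).hasFDerivAt.comp p (hasFDerivAt_prodMk_left p θ)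
  rw [h.fderiv]
  simp

theorem Mop_intervalIntegral {N : ℕ} (s : ℝ) {m : ℝ → ℝ} (hm : Continuous m)
    {K : (Euc N × ℝ) × ℝ → ℝ} (hK : ContDiff ℝ ∞ K) {b : ℝ} (hb : 0 ≤ b) (q : Euc N × ℝ) :
    Mop N s (fun q => ∫ θ in 0..b, m θ * K (q, θ)) q =
      ∫ θ in 0..b, m θ * Mop N s (fun w => K (w, θ)) q := by
  have h1 : ∀ v, ContDiff ℝ ∞ (fun y : (Euc N × ℝ) × ℝ => fderiv ℝ K y (v, 0)) := fun v =>
    contDiff_fderiv_apply_const hK (v, 0)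
  have h2 : ∀ p v, fderiv ℝ (fun q => ∫ θ in 0..b, m θ * K (q, θ)) p v =
      ∫ θ in 0..b, m θ * fderiv ℝ (fun w => K (w, θ)) p v := by
    intro p v
    simp only [fderiv_slice hK]
    exact (contDiff_intervalIntegral_mul hm hK hb).2 p v
  have h3 : ∀ v, d2 (fun q => ∫ θ in 0..b, m θ * K (q, θ)) q v =
      ∫ θ in 0..b, m θ * d2 (fun w => K (w, θ)) q v := by
    intro v
    unfold d2
    simp only [h2]
    simp only [fderiv_slice hK]
    rw [(contDiff_intervalIntegral_mul hm (h1 v) hb).2 q v]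
    simp only [← fderiv_slice (h1 v)]
  have hi : ∀ {g : ℝ → ℝ}, Continuous g → IntervalIntegrable (fun θ => m θ * g θ) volume 0 b :=
    fun hg => (hm.mul hg).intervalIntegrable _ _
  have c1 : ∀ v, Continuous fun θ => fderiv ℝ (fun w => K (w, θ)) q v := by
    intro v
    simp only [fderiv_slice hK]
    exact (h1 v).continuous.comp (by fun_prop)
  have c2 : ∀ v, Continuous fun θ => d2 (fun w => K (w, θ)) q v := by
    intro v
    unfold d2
    simp only [fderiv_slice hK]
    simp only [fderiv_slice (h1 v)]
    exact (contDiff_fderiv_apply_const (h1 v) (v, 0)).continuous.comp (by fun_prop)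
  have c3 : Continuous fun θ => ∑ i : Fin N,
      m θ * d2 (fun w => K (w, θ)) q (EuclideanSpace.single i 1, 0) :=
    continuous_finsetSum _ fun i _ => hm.mul (c2 _)
  unfold Mop
  rw [h2]
  simp only [h3]
  rw [← intervalIntegral.integral_finsetSum (fun i _ => hi (c2 _)),
    ← intervalIntegral.integral_add (c3.intervalIntegrable _ _) (hi (c2 _)),
    ← intervalIntegral.integral_const_mul, ← intervalIntegral.integral_const_mul,
    ← intervalIntegral.integral_add]
  · congr 1
    funext θ
    rw [← Finset.mul_sum]
    ring
  · refine Continuous.intervalIntegrable ?_ _ _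
    exact continuous_const.mul (c3.add (hm.mul (c2 _)))
  · exact (continuous_const.mul (hm.mul (c1 _))).intervalIntegrable _ _

theorem hasDerivAt_capDist {N : ℕ} (p q : Euc N × ℝ) (θ : ℝ) :
    HasDerivAt (capDist p q) (2 * p.2 * q.2 * Real.sin θ) θ := by
  unfold capDist
  have := (((Real.hasDerivAt_cos θ).const_mul (2 * p.2 * q.2)).const_sub
    (p.2 ^ 2 + q.2 ^ 2)).const_add (‖q.1 - p.1‖ ^ 2)
  simpa using this

theorem continuous_capDist {N : ℕ} (p q : Euc N × ℝ) : Continuous (capDist p q) := by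
  unfold capDist
  fun_prop

theorem hasDerivAt_deriv_of_contDiff {f : ℝ → ℝ} (hf : ContDiff ℝ ∞ f) (t : ℝ) :
    HasDerivAt f (deriv f t) t := (hf.differentiable (by simp) t).hasDerivAt

theorem contDiff_deriv_infty {f : ℝ → ℝ} (hf : ContDiff ℝ ∞ f) : ContDiff ℝ ∞ (deriv f) := by
  simpa using contDiff_fderiv_apply_const hf 1

theorem Mop_capKernel {N : ℕ} {s : ℝ} (hs : 0 < s) {f : ℝ → ℝ} (hf : ContDiff ℝ ∞ f)
    (hf1 : ∀ t, 1 ≤ t → deriv f t = 0) {κ : ℝ} {p : Euc N × ℝ} (hκ0 : 0 < κ)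
    (hκ : 1 ≤ κ * p.2 ^ 2) (q : Euc N × ℝ) :
    Mop N s (fun q => capKernel s f ((κ, p), q)) q =
      q.2 * κ * capKernel s (fun t => 4 * (t * deriv (deriv f) t) + 2 * (N + 2 + 2 * s) * deriv f t)
        ((κ, p), q) := by
  have hf' := contDiff_deriv_infty hf
  have hf'' := contDiff_deriv_infty hf'
  have hK : ContDiff ℝ ∞ (fun y : (Euc N × ℝ) × ℝ => f (κ * capDist p y.1 y.2)) :=
    hf.comp (contDiff_const.mul (ContDiff.capDist contDiff_const contDiff_fst contDiff_snd))
  have h1 := Mop_intervalIntegral s (continuous_sin_rpow (a := 2 * s) (by linarith)) hK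
    (b := Real.pi / 2) (by positivity) q
  have e1 : (fun q => capKernel s f ((κ, p), q)) = fun q => ∫ θ in 0..(Real.pi / 2),
    Real.sin θ ^ (2 * s) * f (κ * capDist p q θ) := rfl
  rw [e1]
  rw [h1]
  have hM : ∀ θ, Mop N s (fun w => f (κ * capDist p w θ)) q =
      q.2 * (κ ^ 2 * deriv (deriv f) (κ * capDist p q θ) *
        (4 * ‖q.1 - p.1‖ ^ 2 + (2 * q.2 - 2 * p.2 * Real.cos θ) ^ 2)
      + κ * deriv f (κ * capDist p q θ) * (2 * N + 2)) +
      (1 + 2 * s) * (κ * deriv f (κ * capDist p q θ) * (2 * q.2 - 2 * p.2 * Real.cos θ)) := by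
    intro θ
    have a1 : ∀ {g : ℝ → ℝ}, ContDiff ℝ ∞ g → ∀ t, HasDerivAt (fun t => g (κ * t))
        (κ * deriv g (κ * t)) t := by
      intro g hg t
      have := (hasDerivAt_deriv_of_contDiff hg (κ * t)).comp t ((hasDerivAt_id t).const_mul κ)
      have h2 : HasDerivAt (fun t => g (κ * t)) _ t := this
      refine h2.congr_deriv (by simp [mul_comm])
    have a2 : ∀ t, HasDerivAt (fun t => p.2 ^ 2 + t ^ 2 - 2 * p.2 * t * Real.cos θ)
        (2 * t - 2 * p.2 * Real.cos θ) t := by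
      intro t
      have : HasDerivAt (fun t => p.2 ^ 2 + t ^ 2 - 2 * p.2 * t * Real.cos θ) _ t :=
        (((hasDerivAt_id t).pow 2).const_add (p.2 ^ 2)).sub
        (((hasDerivAt_id t).const_mul (2 * p.2)).mul_const (Real.cos θ))
      simpa using this
    have a3 : ∀ t, HasDerivAt (fun t => 2 * t - 2 * p.2 * Real.cos θ) 2 t := by
      intro t
      have := ((hasDerivAt_id t).const_mul 2).sub_const (2 * p.2 * Real.cos θ)
      simpa using this
    have a4 : ∀ t, HasDerivAt (fun t => κ * deriv f (κ * t)) (κ ^ 2 * deriv (deriv f) (κ * t)) t := by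
      intro t
      exact ((a1 hf' t).const_mul κ).congr_deriv (by ring)
    exact Mop_radial s p.1 (a1 hf) a4 a2 a3 q
  have hB : ∀ θ, HasDerivAt
      (fun θ => Real.sin θ ^ (1 + 2 * s) * deriv f (κ * capDist p q θ))
      ((1 + 2 * s) * Real.sin θ ^ (2 * s) * Real.cos θ * deriv f (κ * capDist p q θ) +
        Real.sin θ ^ (1 + 2 * s) * (deriv (deriv f) (κ * capDist p q θ) *
          (κ * (2 * p.2 * q.2 * Real.sin θ)))) θ := by
    intro θ
    have b1 := (Real.hasDerivAt_sin θ).rpow_const (p := 1 + 2 * s) (Or.inr (by linarith))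
    have b3 := (hasDerivAt_capDist p q θ).const_mul κ
    have b2 : HasDerivAt (fun θ => deriv f (κ * capDist p q θ)) _ θ :=
      HasDerivAt.comp θ (h₂ := deriv f) (h := fun θ => κ * capDist p q θ)
        (hasDerivAt_deriv_of_contDiff hf' (κ * capDist p q θ)) b3
    refine (b1.mul b2).congr_deriv ?_
    rw [show 1 + 2 * s - 1 = 2 * s by ring]
    ring
  have cQ := continuous_capDist p q
  have cs1 := continuous_sin_rpow (a := 2 * s) (by linarith)
  have cs2 := continuous_sin_rpow (a := 1 + 2 * s) (by linarith)
  have cf' : Continuous fun θ => deriv f (κ * capDist p q θ) :=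
    hf'.continuous.comp (continuous_const.mul cQ)
  have cf'' : Continuous fun θ => deriv (deriv f) (κ * capDist p q θ) :=
    hf''.continuous.comp (continuous_const.mul cQ)
  have hzero : ∫ θ in 0..(Real.pi / 2), ((1 + 2 * s) * Real.sin θ ^ (2 * s) * Real.cos θ *
        deriv f (κ * capDist p q θ) +
        Real.sin θ ^ (1 + 2 * s) * (deriv (deriv f) (κ * capDist p q θ) *
          (κ * (2 * p.2 * q.2 * Real.sin θ)))) = 0 := by
    rw [intervalIntegral.integral_eq_sub_of_hasDerivAt (fun θ _ => hB θ)
      (Continuous.intervalIntegrable (by fun_prop) _ _)]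
    have : 1 ≤ κ * capDist p q (Real.pi / 2) := by
      refine hκ.trans (mul_le_mul_of_nonneg_left ?_ hκ0.le)
      unfold capDist
      rw [Real.cos_pi_div_two]
      nlinarith [sq_nonneg ‖q.1 - p.1‖, sq_nonneg q.2]
    rw [hf1 _ this, Real.sin_zero, Real.zero_rpow (by positivity)]
    simp
  have e2 : ∫ θ in 0..(Real.pi / 2), Real.sin θ ^ (2 * s) *
      Mop N s (fun w => f (κ * capDist p w θ)) q = ∫ θ in 0..(Real.pi / 2),
      (q.2 * κ * (Real.sin θ ^ (2 * s) * (4 * (κ * capDist p q θ *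
        deriv (deriv f) (κ * capDist p q θ)) + 2 * (N + 2 + 2 * s) *
        deriv f (κ * capDist p q θ))) - 2 * κ * p.2 *
      ((1 + 2 * s) * Real.sin θ ^ (2 * s) * Real.cos θ * deriv f (κ * capDist p q θ) +
        Real.sin θ ^ (1 + 2 * s) * (deriv (deriv f) (κ * capDist p q θ) *
          (κ * (2 * p.2 * q.2 * Real.sin θ))))) := by
    refine intervalIntegral.integral_congr fun θ hθ => ?_
    rw [uIcc_of_le (by positivity)] at hθ
    have hsin : 0 ≤ Real.sin θ := Real.sin_nonneg_of_mem_Icc ⟨hθ.1, by linarith [hθ.2, Real.pi_pos]⟩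
    have r1 : Real.sin θ ^ (1 + 2 * s) = Real.sin θ * Real.sin θ ^ (2 * s) := by
      rw [Real.rpow_add_of_nonneg hsin (by norm_num) (by positivity), Real.rpow_one]
    have r2 : Real.sin θ ^ 2 = 1 - Real.cos θ ^ 2 := Real.sin_sq θ
    simp only [hM, r1]
    have r3 : ‖q.1 - p.1‖ ^ 2 = capDist p q θ - (p.2 ^ 2 + q.2 ^ 2 - 2 * p.2 * q.2 * Real.cos θ) := by
      unfold capDist; ring
    rw [r3]
    linear_combination (4 * κ ^ 2 * p.2 ^ 2 * q.2 * Real.sin θ ^ (2 * s) *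
      deriv (deriv f) (κ * capDist p q θ)) * r2
  rw [e2, intervalIntegral.integral_sub, intervalIntegral.integral_const_mul,
    intervalIntegral.integral_const_mul, hzero, mul_zero, sub_zero]
  · rfl
  · exact Continuous.intervalIntegrable (by fun_prop) _ _
  · exact Continuous.intervalIntegrable (by fun_prop) _ _

/-- The admissible scale/centre pairs. -/
def capDom (N : ℕ) : Set (ℝ × (Euc N × ℝ)) := {y | 0 < y.1 ∧ 0 < y.2.2 ∧ 1 < y.1 * y.2.2 ^ 2}

/-- The average of `w` against `capKernel`. -/
noncomputable def capInt (N : ℕ) (s : ℝ) (w : Euc N × ℝ → ℝ) (g : ℝ → ℝ)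
    (y : ℝ × (Euc N × ℝ)) : ℝ :=
  ∫ q in {q : Euc N × ℝ | 0 < q.2}, w q * (q.2 * capKernel s g (y, q))

theorem isOpen_capDom (N : ℕ) : IsOpen (capDom N) := by
  have h : Continuous fun y : ℝ × (Euc N × ℝ) => y.1 * y.2.2 ^ 2 := by fun_prop
  exact (isOpen_lt continuous_const continuous_fst).inter ((isOpen_lt continuous_const
    (continuous_snd.comp continuous_snd)).inter (isOpen_lt continuous_const h))

theorem exists_local_support {N : ℕ} {y₀ : ℝ × (Euc N × ℝ)} (hy : y₀ ∈ capDom N) :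
    ∃ V : Set (ℝ × (Euc N × ℝ)), IsOpen V ∧ y₀ ∈ V ∧ V ⊆ capDom N ∧
      ∃ k : Set (Euc N × ℝ), IsCompact k ∧ k ⊆ {q : Euc N × ℝ | 0 < q.2} ∧
      ∀ (s : ℝ) (g : ℝ → ℝ), (∀ t, 1 ≤ t → g t = 0) → ∀ y ∈ V, ∀ q ∉ k,
        capKernel s g (y, q) = 0 := by
  obtain ⟨R, hR1, hR2⟩ := exists_between (sqrt_inv_lt hy.2.1 hy.1 hy.2.2)
  have hc : ContinuousOn (fun y : ℝ × (Euc N × ℝ) => Real.sqrt y.1⁻¹ + dist y.2 y₀.2)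
      (capDom N) := by
    refine ContinuousOn.add (ContinuousOn.sqrt (continuousOn_fst.inv₀ fun y hy => hy.1.ne')) ?_
    fun_prop
  refine ⟨_, hc.isOpen_inter_preimage (isOpen_capDom N) (isOpen_Iio (a := R)), ⟨hy, ?_⟩,
    inter_subset_left, closedBall y₀.2 R, isCompact_closedBall _ _,
    closedBall_subset_halfSpace hR2, fun s g hg y hyV q hq => ?_⟩
  · simpa using hR1
  · have h1 : Real.sqrt y.1⁻¹ + dist y.2 y₀.2 < R := hyV.2
    refine capKernel_eq_zero hg hyV.1.2.1 hyV.1.1 hyV.1.2.2.le fun h => hq ?_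
    rw [mem_closedBall] at h ⊢
    linarith [dist_triangle q y.2 y₀.2]

section
variable {N : ℕ} {s : ℝ} {w : Euc N × ℝ → ℝ} {g : ℝ → ℝ}

theorem integrableOn_of_isCompact (hw : LocallyIntegrableOn w {q : Euc N × ℝ | 0 < q.2})
    {k : Set (Euc N × ℝ)} (hk : IsCompact k) (hkU : k ⊆ {q : Euc N × ℝ | 0 < q.2}) :
    IntegrableOn w k (volume.restrict {q : Euc N × ℝ | 0 < q.2}) :=
  (hw.integrableOn_compact_subset hkU hk).mono_measure Measure.restrict_le_self

theorem contDiffAt_capInt (hs : 0 < s) (hw : LocallyIntegrableOn w {q : Euc N × ℝ | 0 < q.2})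
    (hg : ContDiff ℝ ∞ g) (hg1 : ∀ t, 1 ≤ t → g t = 0) {y : ℝ × (Euc N × ℝ)} (hy : y ∈ capDom N) :
    ContDiffAt ℝ ∞ (capInt N s w g) y ∧
      y.1 * fderiv ℝ (capInt N s w g) y (1, 0) = capInt N s w (fun t => t * deriv g t) y := by
  obtain ⟨V, hV, hyV, hVd, k, hk, hkU, h⟩ := exists_local_support hy
  have hK : ContDiff ℝ ∞ (fun x : (ℝ × (Euc N × ℝ)) × (Euc N × ℝ) => x.2.2 * capKernel s g x) :=
    contDiff_snd.snd.mul (contDiff_capKernel hs.le hg)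
  have hz : ∀ y ∈ V, ∀ q ∉ k, q.2 * capKernel s g (y, q) = 0 := fun y hy q hq => by
    rw [h s g hg1 y hy q hq, mul_zero]
  refine ⟨(contDiffOn_integral_mul hV hk hz (integrableOn_of_isCompact hw hk hkU)
    hK.contDiffOn).contDiffAt (hV.mem_nhds hyV), ?_⟩
  have := fderiv_integral_mul hV hk hz (integrableOn_of_isCompact hw hk hkU)
    hK.contDiffOn hyV (1, 0)
  change y.1 * fderiv ℝ (fun y => ∫ q in {q : Euc N × ℝ | 0 < q.2},
    w q * (q.2 * capKernel s g (y, q))) y (1, 0) = _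
  rw [this, ← integral_const_mul]
  unfold capInt
  congr 1
  funext q
  rw [← fderiv_capKernel hs.le hg]
  have hd : HasFDerivAt (fun x : (ℝ × (Euc N × ℝ)) × (Euc N × ℝ) => x.2.2 * capKernel s g x) _
    (y, q) := (hasFDerivAt_snd (𝕜 := ℝ)).snd.mul
      ((contDiff_capKernel hs.le hg).differentiable (by simp) (y, q)).hasFDerivAt
  rw [hd.fderiv]
  simp
  ring

theorem integrable_capInt (hs : 0 < s) (hw : LocallyIntegrableOn w {q : Euc N × ℝ | 0 < q.2})
    (hg : ContDiff ℝ ∞ g) (hg1 : ∀ t, 1 ≤ t → g t = 0) {y : ℝ × (Euc N × ℝ)} (hy : y ∈ capDom N) :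
    Integrable (fun q => w q * (q.2 * capKernel s g (y, q)))
      (volume.restrict {q : Euc N × ℝ | 0 < q.2}) := by
  obtain ⟨V, hV, hyV, hVd, k, hk, hkU, h⟩ := exists_local_support hy
  have hc : Continuous fun q : Euc N × ℝ => q.2 * capKernel s g (y, q) :=
    continuous_snd.mul ((contDiff_capKernel hs.le hg).continuous.comp (by fun_prop))
  have h1 : IntegrableOn (fun q => w q * (q.2 * capKernel s g (y, q))) k
      (volume.restrict {q : Euc N × ℝ | 0 < q.2}) :=
    (integrableOn_of_isCompact hw hk hkU).mul_continuousOn hc.continuousOn hk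
  refine h1.integrable_of_forall_notMem_eq_zero fun q hq => ?_
  rw [h s g hg1 y hyV q hq, mul_zero, mul_zero]

theorem capKernel_lincomb (hs : 0 < s) {g₁ g₂ : ℝ → ℝ} (h₁ : Continuous g₁) (h₂ : Continuous g₂)
    (a b : ℝ) (y : ℝ × (Euc N × ℝ)) (q : Euc N × ℝ) :
    capKernel s (fun t => a * g₁ t + b * g₂ t) (y, q) =
      a * capKernel s g₁ (y, q) + b * capKernel s g₂ (y, q) := by
  unfold capKernel
  have c1 := continuous_sin_rpow (a := 2 * s) (by linarith)
  have cQ := continuous_capDist y.2 q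
  rw [← intervalIntegral.integral_const_mul, ← intervalIntegral.integral_const_mul,
    ← intervalIntegral.integral_add]
  · congr 1
    funext θ
    ring
  · exact Continuous.intervalIntegrable (by fun_prop) _ _
  · exact Continuous.intervalIntegrable (by fun_prop) _ _

theorem deriv_eq_zero_of_forall_ge (hg : ContDiff ℝ ∞ g) {c : ℝ} (hg1 : ∀ t, c ≤ t → g t = 0)
    {t : ℝ} (ht : c ≤ t) : deriv g t = 0 := by
  have h1 : HasDerivWithinAt g (deriv g t) (Ici t) t :=
    (hasDerivAt_deriv_of_contDiff hg t).hasDerivWithinAt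
  have h2 : HasDerivWithinAt g 0 (Ici t) t :=
    (hasDerivWithinAt_const t (Ici t) (0 : ℝ)).congr (fun x hx => hg1 x (ht.trans hx)) (hg1 t ht)
  exact (uniqueDiffWithinAt_Ici t).eq_deriv _ h1 h2

theorem capInt_relation (hs : 0 < s) (hw : WeakSol N s w) {f : ℝ → ℝ} (hf : ContDiff ℝ ∞ f)
    (hf0 : ∀ t, 1 ≤ t → f t = 0) {y : ℝ × (Euc N × ℝ)} (hy : y ∈ capDom N) :
    2 * capInt N s w (fun t => t * deriv (deriv f) t) y +
      (N + 2 + 2 * s) * capInt N s w (deriv f) y = 0 := by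
  obtain ⟨V, hV, hyV, hVd, k, hk, hkU, h⟩ := exists_local_support hy
  have hf' := contDiff_deriv_infty hf
  have hf'' := contDiff_deriv_infty hf'
  have hf1 : ∀ t, 1 ≤ t → deriv f t = 0 := fun t ht => deriv_eq_zero_of_forall_ge hf hf0 ht
  have hf2 : ∀ t, 1 ≤ t → deriv (deriv f) t = 0 := fun t ht =>
    deriv_eq_zero_of_forall_ge hf' hf1 ht
  have hsub : Function.support (fun q => capKernel s f (y, q)) ⊆ k := by
    intro q hq
    by_contra hqk
    exact hq (h s f hf0 y hyV q hqk)
  have hts : tsupport (fun q => capKernel s f (y, q)) ⊆ k := closure_minimal hsub hk.isClosed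
  have h1 := hw.2 (fun q => capKernel s f (y, q))
    ((contDiff_capKernel hs.le hf).comp (contDiff_const.prodMk contDiff_id))
    (HasCompactSupport.of_support_subset_isCompact hk hsub) (hts.trans hkU)
  obtain ⟨κ, p⟩ := y
  have hi1 := integrable_capInt hs hw.1 (contDiff_id.mul hf'') (g := fun t => t * deriv (deriv f) t)
    (fun t ht => by rw [hf2 t ht, mul_zero]) hy
  have hi2 := integrable_capInt hs hw.1 hf' hf1 hy
  have h2 : ∀ q, w q * Mop N s (fun q => capKernel s f ((κ, p), q)) q =
      2 * κ * (2 * (w q * (q.2 * capKernel s (fun t => t * deriv (deriv f) t) ((κ, p), q))) +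
        (N + 2 + 2 * s) * (w q * (q.2 * capKernel s (deriv f) ((κ, p), q)))) := by
    intro q
    rw [Mop_capKernel hs hf hf1 hy.1 hy.2.2.le, capKernel_lincomb hs (g₁ := fun t => t * deriv (deriv f) t)
      (continuous_id.mul hf''.continuous) hf'.continuous]
    ring
  simp only [h2] at h1
  rw [integral_const_mul, integral_add (hi1.const_mul _) (hi2.const_mul _), integral_const_mul,
    integral_const_mul] at h1
  have : 2 * κ ≠ 0 := by have : 0 < κ := hy.1; positivity
  exact (mul_eq_zero.1 h1).resolve_left this

theorem capInt_scaling (hs : 0 < s) (hw : WeakSol N s w) {f : ℝ → ℝ} (hf : ContDiff ℝ ∞ f)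
    (hf0 : ∀ t, 1 ≤ t → f t = 0) {p : Euc N × ℝ} {κ₁ κ₂ : ℝ}
    (h₁ : (κ₁, p) ∈ capDom N) (h₂ : (κ₂, p) ∈ capDom N) :
    κ₁ ^ (((N : ℝ) + 2 + 2 * s) / 2) * capInt N s w (deriv f) (κ₁, p) =
    κ₂ ^ (((N : ℝ) + 2 + 2 * s) / 2) * capInt N s w (deriv f) (κ₂, p) := by
  set D := ((N : ℝ) + 2 + 2 * s) / 2 with hD
  have hp : 0 < p.2 := h₁.2.1
  have hmem : ∀ κ, κ ∈ Ioi (p.2 ^ 2)⁻¹ ↔ (κ, p) ∈ capDom N := by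
    intro κ
    have h3 : 0 < (p.2 ^ 2)⁻¹ := by positivity
    constructor
    · intro h
      refine ⟨h3.trans h, hp, ?_⟩
      exact (inv_lt_iff_one_lt_mul₀ (by positivity)).1 h
    · intro h
      exact (inv_lt_iff_one_lt_mul₀ (by positivity)).2 h.2.2
  have hder : ∀ κ, (κ, p) ∈ capDom N →
      HasDerivAt (fun κ => κ ^ D * capInt N s w (deriv f) (κ, p)) 0 κ := by
    intro κ hκ
    obtain ⟨hc, hd⟩ := contDiffAt_capInt hs hw.1 (contDiff_deriv_infty hf)
      (fun t ht => deriv_eq_zero_of_forall_ge hf hf0 ht) hκ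
    have e1 : HasDerivAt (fun κ => (κ, p)) ((1 : ℝ), (0 : Euc N × ℝ)) κ :=
      (hasDerivAt_id κ).prodMk (hasDerivAt_const _ _)
    have e2 : HasDerivAt (fun κ => capInt N s w (deriv f) (κ, p)) _ κ :=
      HasFDerivAt.comp_hasDerivAt (l := capInt N s w (deriv f)) κ
        (hc.differentiableAt (by simp)).hasFDerivAt e1
    have hκ0 : 0 < κ := hκ.1
    refine ((Real.hasDerivAt_rpow_const (p := D) (Or.inl hκ0.ne')).mul e2).congr_deriv ?_
    have h4 := capInt_relation hs hw hf hf0 hκ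
    rw [← hd] at h4
    rw [Real.rpow_sub hκ0, Real.rpow_one]
    field_simp
    rw [hD]
    simp only at h4
    linear_combination κ ^ (((N : ℝ) + 2 + 2 * s) / 2) * h4 / 2
  refine IsOpen.is_const_of_deriv_eq_zero isOpen_Ioi isPreconnected_Ioi
    (f := fun κ => κ ^ D * capInt N s w (deriv f) (κ, p))
    (fun κ hκ => (hder κ ((hmem κ).1 hκ)).differentiableAt.differentiableWithinAt)
    (fun κ hκ => (hder κ ((hmem κ).1 hκ)).deriv) ((hmem _).2 h₁) ((hmem _).2 h₂)

end

theorem abs_capKernel_le {N : ℕ} {s : ℝ} (hs : 0 < s) {h : ℝ → ℝ} {H : ℝ}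
    (hH : ∀ t, 0 ≤ t → |h t| ≤ H) (h1 : ∀ t, 1 ≤ t → h t = 0) {p q : Euc N × ℝ} (hp : 0 < p.2) {r : ℝ}
    (hr : 0 < r) (hrp : r ≤ p.2 / 2) (hq : q ∈ closedBall p r) :
    |capKernel s h (((r ^ 2)⁻¹, p), q)| ≤
      H * (Real.pi / (p.2 * Real.sqrt 2)) ^ (1 + 2 * s) * r ^ (1 + 2 * s) := by
  have h2 : Real.sqrt 2 ^ 2 = 2 := Real.sq_sqrt (by norm_num)
  have h2' : 0 < Real.sqrt 2 := by positivity
  have h21 : 1 ≤ Real.sqrt 2 := Real.one_le_sqrt.2 (by norm_num)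
  have hπ := Real.pi_pos
  have hH0 : 0 ≤ H := (abs_nonneg _).trans (hH 0 le_rfl)
  set θ₀ := Real.pi / (p.2 * Real.sqrt 2) * r with hθ₀
  have hθ0 : 0 < θ₀ := by positivity
  have hθ1 : θ₀ ≤ Real.pi / 2 := by
    rw [hθ₀, div_mul_eq_mul_div, div_le_div_iff₀ (by positivity) (by norm_num)]
    nlinarith [mul_le_mul_of_nonneg_left h21 hp.le]
  have hq2 : |q.2 - p.2| ≤ r := by
    have := (norm_snd_le (q - p)).trans (mem_closedBall_iff_norm.1 hq)
    simpa using this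
  have hq3 : p.2 / 2 ≤ q.2 := by linarith [(abs_le.1 hq2).1]
  have hQ0 : ∀ θ, 0 ≤ capDist p q θ := fun θ =>
    le_trans (by positivity) (capDist_ge (mul_nonneg hp.le (by linarith)))
  have hbound : ∀ θ ∈ uIoc 0 (Real.pi / 2),
      ‖Real.sin θ ^ (2 * s) * h ((r ^ 2)⁻¹ * capDist p q θ)‖ ≤
        {x : ℝ | x ≤ θ₀}.indicator (fun _ => H * θ₀ ^ (2 * s)) θ := by
    intro θ hθ
    rw [uIoc_of_le (by positivity)] at hθ
    have hsin : 0 ≤ Real.sin θ := Real.sin_nonneg_of_nonneg_of_le_pi hθ.1.le (by linarith [hθ.2])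
    by_cases hc : θ ≤ θ₀
    · rw [indicator_of_mem (by exact hc), norm_mul, mul_comm]
      refine mul_le_mul (hH _ (mul_nonneg (by positivity) (hQ0 θ))) ?_ (norm_nonneg _) hH0
      rw [Real.norm_of_nonneg (by positivity)]
      exact Real.rpow_le_rpow hsin ((Real.sin_le hθ.1.le).trans hc) (by linarith)
    · rw [indicator_of_notMem (by exact hc), h1, mul_zero, norm_zero]
      push Not at hc
      have hcos := Real.cos_le_one_sub_mul_cos_sq (x := θ)
        (by rw [abs_of_pos hθ.1]; linarith [hθ.2])
      have e1 : r ^ 2 = p.2 ^ 2 * (2 / Real.pi ^ 2 * θ₀ ^ 2) := by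
        rw [hθ₀, mul_pow, div_pow, mul_pow, h2]
        field_simp
      have e2 : θ₀ ^ 2 ≤ θ ^ 2 := by gcongr
      have e3 : 2 / Real.pi ^ 2 * θ₀ ^ 2 ≤ 1 - Real.cos θ := by
        have : 2 / Real.pi ^ 2 * θ₀ ^ 2 ≤ 2 / Real.pi ^ 2 * θ ^ 2 := by gcongr
        linarith
      have e0 : 0 ≤ 2 / Real.pi ^ 2 * θ₀ ^ 2 := by positivity
      have e4 : p.2 ^ 2 * (2 / Real.pi ^ 2 * θ₀ ^ 2) ≤ 2 * p.2 * q.2 * (1 - Real.cos θ) := by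
        refine mul_le_mul ?_ e3 e0 (by nlinarith)
        nlinarith
      rw [inv_mul_eq_div, le_div_iff₀ (by positivity), one_mul, e1]
      refine e4.trans ?_
      unfold capDist
      nlinarith [sq_nonneg ‖q.1 - p.1‖, sq_nonneg (p.2 - q.2)]
  unfold capKernel
  refine (intervalIntegral.norm_integral_le_of_norm_le (by positivity) (ae_of_all _ fun θ hθ =>
    hbound θ (by rwa [uIoc_of_le (by positivity)])) ?_).trans ?_
  · exact (intervalIntegrable_const).mono_fun
      ((measurable_const.indicator measurableSet_Iic).aestronglyMeasurable)
      (ae_of_all _ fun x => norm_indicator_le_norm_self _ _)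
  · rw [intervalIntegral.integral_indicator ⟨hθ0.le, hθ1⟩, intervalIntegral.integral_const,
      smul_eq_mul, sub_zero, mul_assoc H, ← Real.mul_rpow (by positivity) hr.le, ← hθ₀,
      add_comm 1, Real.rpow_add_one hθ0.ne']
    exact le_of_eq (by ring)

theorem contDiff_capKernel_right {N : ℕ} {s : ℝ} (hs : 0 < s) {h : ℝ → ℝ} (hh : ContDiff ℝ ∞ h)
    (y : ℝ × (Euc N × ℝ)) : ContDiff ℝ ∞ fun q => capKernel s h (y, q) :=
  (contDiff_capKernel hs.le hh).comp (contDiff_const.prodMk contDiff_id)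

theorem mem_capDom_inv_sq {N : ℕ} {p : Euc N × ℝ} (hp : 0 < p.2) {r : ℝ} (hr : 0 < r)
    (hrp : r ≤ p.2 / 2) : ((r ^ 2)⁻¹, p) ∈ capDom N := by
  refine ⟨by positivity, hp, ?_⟩
  change 1 < (r ^ 2)⁻¹ * p.2 ^ 2
  rw [inv_mul_eq_div, one_lt_div (by positivity)]
  gcongr
  linarith

theorem capKernel_eq_zero_inv_sq {N : ℕ} {s : ℝ} {h : ℝ → ℝ} (h1 : ∀ t, 1 ≤ t → h t = 0)
    {p q : Euc N × ℝ} (hp : 0 < p.2) {r : ℝ} (hr : 0 < r) (hrp : r ≤ p.2 / 2)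
    (hq : q ∉ closedBall p r) : capKernel s h (((r ^ 2)⁻¹, p), q) = 0 := by
  have hd := mem_capDom_inv_sq hp hr hrp
  refine capKernel_eq_zero h1 hp hd.1 hd.2.2.le ?_
  rwa [inv_inv, Real.sqrt_sq hr.le]

theorem capInt_one_pos {N : ℕ} {s : ℝ} (hs : 0 < s) {h : ℝ → ℝ} (hh : ContDiff ℝ ∞ h)
    (h0 : ∀ t, 0 ≤ h t) (h00 : 0 < h 0)
    (h1 : ∀ t, 1 ≤ t → h t = 0) {p : Euc N × ℝ} (hp : 0 < p.2) {r : ℝ}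
    (hr : 0 < r) (hrp : r ≤ p.2 / 2) :
    0 < capInt N s (fun _ => 1) h ((r ^ 2)⁻¹, p) := by
  have hsub : closedBall p r ⊆ {q : Euc N × ℝ | 0 < q.2} :=
    closedBall_subset_halfSpace (by linarith)
  have hz := fun q => capKernel_eq_zero_inv_sq (q := q) (s := s) h1 hp hr hrp
  have hnn : ∀ q, 0 ≤ capKernel s h (((r ^ 2)⁻¹, p), q) := fun q =>
    intervalIntegral.integral_nonneg (by positivity) fun θ hθ => mul_nonneg (Real.rpow_nonneg
      (Real.sin_nonneg_of_nonneg_of_le_pi hθ.1 (by linarith [hθ.2, Real.pi_pos])) _) (h0 _)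
  have : capInt N s (fun _ => 1) h ((r ^ 2)⁻¹, p) =
      ∫ q : Euc N × ℝ, q.2 * capKernel s h (((r ^ 2)⁻¹, p), q) := by
    unfold capInt
    simp only [one_mul]
    refine setIntegral_eq_integral_of_forall_compl_eq_zero fun q hq => ?_
    rw [hz q fun h => hq (hsub h), mul_zero]
  rw [this]
  refine Continuous.integral_pos_of_hasCompactSupport_nonneg_nonzero (x := p)
    (continuous_snd.mul (contDiff_capKernel_right hs hh _).continuous)
    (HasCompactSupport.of_support_subset_isCompact (isCompact_closedBall p r) fun q hq => ?_)
    (fun q => ?_) (mul_ne_zero hp.ne' (ne_of_gt ?_))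
  · by_contra hqn
    exact hq (by simp [hz q hqn])
  · by_cases hq : q ∈ closedBall p r
    · exact mul_nonneg (hsub hq).le (hnn q)
    · simp [hz q hq]
  · unfold capKernel
    have cQ := continuous_capDist p p
    have c1 := continuous_sin_rpow (a := 2 * s) (by linarith)
    have hc := hh.continuous
    obtain ⟨δ, hδ, hδ'⟩ : ∃ δ, 0 < δ ∧ ∀ θ, 0 ≤ θ → θ ≤ δ → 0 < h ((r ^ 2)⁻¹ * capDist p p θ) := by
      have : ∀ᶠ θ in 𝓝 (0 : ℝ), 0 < h ((r ^ 2)⁻¹ * capDist p p θ) := by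
        have hct : Continuous fun θ => h ((r ^ 2)⁻¹ * capDist p p θ) := by fun_prop
        refine hct.continuousAt.eventually_const_lt ?_
        have : capDist p p 0 = 0 := by simp [capDist]; ring
        simpa [this] using h00
      obtain ⟨δ, hδ, hb⟩ := Metric.eventually_nhds_iff.1 this
      exact ⟨δ / 2, by positivity, fun θ h1 h2 => hb (by
        rw [Real.dist_eq, sub_zero, abs_of_nonneg h1]; linarith)⟩
    refine intervalIntegral.integral_pos (by positivity) (by fun_prop)
      (fun θ hθ => mul_nonneg (Real.rpow_nonneg
      (Real.sin_nonneg_of_nonneg_of_le_pi hθ.1.le (by linarith [hθ.2, Real.pi_pos])) _) (h0 _))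
      ⟨min δ (Real.pi / 2), ⟨le_min hδ.le (by positivity), min_le_right _ _⟩,
      mul_pos (Real.rpow_pos_of_pos (Real.sin_pos_of_pos_of_lt_pi (lt_min hδ (by positivity)) ?_) _)
        (hδ' _ (le_min hδ.le (by positivity)) (min_le_left _ _))⟩
    linarith [min_le_right δ (Real.pi / 2), Real.pi_pos]

theorem capInt_eq_of_lebesgue {N : ℕ} {s : ℝ} (hs : 0 < s) {w : Euc N × ℝ → ℝ}
    (hw : WeakSol N s w) {f : ℝ → ℝ} (hf : ContDiff ℝ ∞ f) (hf0 : ∀ t, 1 ≤ t → f t = 0)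
    {p : Euc N × ℝ} (hp : 0 < p.2)
    (hL : Tendsto (fun r => ⨍ y in closedBall p r, ‖w y - w p‖) (𝓝[>] 0) (𝓝 0)) :
    capInt N s w (deriv f) (((p.2 / 2) ^ 2)⁻¹, p) =
      w p * capInt N s (fun _ => 1) (deriv f) (((p.2 / 2) ^ 2)⁻¹, p) := by
  set h := deriv f with hh
  have hh' : ContDiff ℝ ∞ h := contDiff_deriv_infty hf
  have h1 : ∀ t, 1 ≤ t → h t = 0 := fun t ht => deriv_eq_zero_of_forall_ge hf hf0 ht
  obtain ⟨H, hH⟩ : ∃ H, ∀ t, 0 ≤ t → |h t| ≤ H := by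
    obtain ⟨H, hH⟩ := (isCompact_Icc (a := (0 : ℝ)) (b := 1)).exists_bound_of_continuousOn
      hh'.continuous.continuousOn
    refine ⟨H, fun t ht => ?_⟩
    by_cases h2 : t ≤ 1
    · exact hH t ⟨ht, h2⟩
    · rw [h1 t (by linarith), abs_zero]
      exact (norm_nonneg _).trans (hH 0 (by simp))
  have hH0 : 0 ≤ H := (abs_nonneg _).trans (hH 0 le_rfl)
  have hp2 : 0 < p.2 / 2 := by positivity
  set D := ((N : ℝ) + 2 + 2 * s) / 2 with hD
  set C₀ := H * (Real.pi / (p.2 * Real.sqrt 2)) ^ (1 + 2 * s) with hC₀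
  have hC₀' : 0 ≤ C₀ := by positivity
  set V := (volume : Measure (Euc N × ℝ)).real (closedBall 0 1) with hV
  set Δ : ℝ → ℝ := fun r => capInt N s w h ((r ^ 2)⁻¹, p) -
    w p * capInt N s (fun _ => 1) h ((r ^ 2)⁻¹, p) with hΔ
  have key : ∀ r, 0 < r → r ≤ p.2 / 2 → |(((p.2 / 2) ^ 2)⁻¹) ^ D * Δ (p.2 / 2)| ≤
      (3 / 2 * p.2 * C₀ * V) * ⨍ y in closedBall p r, ‖w y - w p‖ := by
    intro r hr hrp
    have hsub : closedBall p r ⊆ {q : Euc N × ℝ | 0 < q.2} :=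
      closedBall_subset_halfSpace (by linarith)
    have hdom := mem_capDom_inv_sq hp hr hrp
    have e1 : (((p.2 / 2) ^ 2)⁻¹) ^ D * Δ (p.2 / 2) = ((r ^ 2)⁻¹) ^ D * Δ r := by
      have a1 := capInt_scaling hs hw hf hf0 (mem_capDom_inv_sq hp hp2 le_rfl) hdom
      have a2 := capInt_scaling hs (weakSol_one N s) hf hf0 (mem_capDom_inv_sq hp hp2 le_rfl) hdom
      simp only [hΔ, mul_sub]
      rw [a1, mul_left_comm, a2, mul_left_comm]
    have e2 : Δ r = ∫ q in closedBall p r,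
        (w q - w p) * (q.2 * capKernel s h (((r ^ 2)⁻¹, p), q)) := by
      have i1 := integrable_capInt hs hw.1 hh' h1 hdom
      have i2 := integrable_capInt hs (weakSol_one N s).1 hh' h1 hdom
      simp only [hΔ, capInt]
      rw [← integral_const_mul, ← integral_sub i1 (i2.const_mul _)]
      refine (setIntegral_congr_fun (isOpen_halfSpace N).measurableSet fun q _ => ?_).trans
        (setIntegral_eq_of_subset_of_forall_sdiff_eq_zero (isOpen_halfSpace N).measurableSet hsub
          fun q hq => ?_)
      · ring
      · rw [capKernel_eq_zero_inv_sq h1 hp hr hrp hq.2, mul_zero, mul_zero]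
    have hwi : IntegrableOn (fun q => ‖w q - w p‖) (closedBall p r) :=
      ((hw.1.integrableOn_compact_subset hsub (isCompact_closedBall p r)).sub
        (integrableOn_const (isCompact_closedBall p r).measure_lt_top.ne)).norm
    have e3 : |Δ r| ≤ (3 / 2 * p.2 * (C₀ * r ^ (1 + 2 * s))) *
        ∫ q in closedBall p r, ‖w q - w p‖ := by
      rw [e2, ← integral_const_mul, ← Real.norm_eq_abs]
      refine norm_integral_le_of_norm_le (hwi.const_mul _) ?_
      filter_upwards [ae_restrict_mem measurableSet_closedBall] with q hq
      rw [norm_mul, mul_comm, norm_mul]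
      refine mul_le_mul_of_nonneg_right (mul_le_mul ?_ (abs_capKernel_le hs hH h1 hp hr hrp hq)
        (norm_nonneg _) (by positivity)) (norm_nonneg _)
      have hq2 : |q.2 - p.2| ≤ r := by
        have := (norm_snd_le (q - p)).trans (mem_closedBall_iff_norm.1 hq)
        simpa using this
      rw [Real.norm_of_nonneg (hsub hq).le]
      linarith [(abs_le.1 hq2).2]
    have hvol : (volume : Measure (Euc N × ℝ)).real (closedBall p r) = r ^ (N + 1) * V := by
      rw [Measure.addHaar_real_closedBall' _ _ hr.le, ← hV]
      simp
    have hVpos : 0 < V := by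
      rw [hV, measureReal_def]
      exact ENNReal.toReal_pos (measure_closedBall_pos _ _ one_pos).ne'
        (isCompact_closedBall _ _).measure_lt_top.ne
    have hpow : ((r ^ 2)⁻¹) ^ D * r ^ (1 + 2 * s) * r ^ (N + 1) = 1 := by
      rw [← Real.rpow_natCast r 2, ← Real.rpow_neg hr.le, ← Real.rpow_mul hr.le,
        ← Real.rpow_natCast r (N + 1), ← Real.rpow_add hr, ← Real.rpow_add hr, hD]
      rw [show (-((2 : ℕ) : ℝ)) * ((N + 2 + 2 * s) / 2) + (1 + 2 * s) + ((N + 1 : ℕ) : ℝ) = 0 by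
        push_cast; ring, Real.rpow_zero]
    rw [e1, abs_mul, abs_of_nonneg (by positivity : 0 ≤ ((r ^ 2)⁻¹) ^ D), setAverage_eq, hvol,
      smul_eq_mul]
    calc _ ≤ ((r ^ 2)⁻¹) ^ D * ((3 / 2 * p.2 * (C₀ * r ^ (1 + 2 * s))) *
        ∫ q in closedBall p r, ‖w q - w p‖) := by gcongr
      _ = (3 / 2 * p.2 * C₀ * V) * ((((r ^ 2)⁻¹) ^ D * r ^ (1 + 2 * s) * r ^ (N + 1)) *
        ((r ^ (N + 1) * V)⁻¹ * ∫ q in closedBall p r, ‖w q - w p‖)) := by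
          field_simp
      _ = _ := by rw [hpow, one_mul]
  have hlim := hL.const_mul (3 / 2 * p.2 * C₀ * V)
  rw [mul_zero] at hlim
  have h0 := ge_of_tendsto hlim (by
    filter_upwards [Ioc_mem_nhdsGT hp2] with r hr using key r hr.1 hr.2)
  have h2 := abs_nonpos_iff.1 h0
  have h3 : (((p.2 / 2) ^ 2)⁻¹) ^ D ≠ 0 := by positivity
  exact sub_eq_zero.1 ((mul_eq_zero.1 h2).resolve_left h3)

theorem contDiffAt_comp_graph {E : Type*} [NormedAddCommGroup E] [NormedSpace ℝ E]
    {F : ℝ × E → ℝ} {c : E → ℝ} {p : E} (hc : ContDiffAt ℝ ∞ c p)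
    (hF : ContDiffAt ℝ ∞ F (c p, p)) : ContDiffAt ℝ ∞ (fun x => F (c x, x)) p :=
  ContDiffAt.comp (f := fun x => (c x, x)) p hF (hc.prodMk contDiffAt_id)

theorem WeakSol.exists_smooth {N : ℕ} {s : ℝ} (hs : 0 < s) {w : Euc N × ℝ → ℝ}
    (hw : WeakSol N s w) (hpos : ∀ q : Euc N × ℝ, 0 < q.2 → 0 ≤ w q) :
    ∃ v : Euc N × ℝ → ℝ, ContDiffOn ℝ ∞ v {q : Euc N × ℝ | 0 < q.2} ∧
      (∀ q : Euc N × ℝ, 0 < q.2 → 0 ≤ v q) ∧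
      ∀ᵐ q ∂(volume.restrict {q : Euc N × ℝ | 0 < q.2}), w q = v q := by
  obtain ⟨f, hf, hf0, hf1, hf2⟩ := exists_profile
  have hh' : ContDiff ℝ ∞ (deriv f) := contDiff_deriv_infty hf
  have h0 : ∀ t, 0 ≤ deriv f t := fun t => by
    rcases le_or_gt 1 t with ht | ht
    · exact (hf1 t ht).ge
    · exact (hf2 t ht).le
  let A : (Euc N × ℝ → ℝ) → Euc N × ℝ → ℝ := fun w p =>
    capInt N s w (deriv f) (((p.2 / 2) ^ 2)⁻¹, p)
  have hA1 : ∀ p : Euc N × ℝ, 0 < p.2 → 0 < A (fun _ => 1) p := fun p hp =>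
    capInt_one_pos hs hh' h0 (hf2 0 one_pos) hf1 hp (by positivity) le_rfl
  have hAs : ∀ w, WeakSol N s w → ContDiffOn ℝ ∞ (A w) {q : Euc N × ℝ | 0 < q.2} := by
    intro w hw p hp
    have hp' : 0 < p.2 := hp
    have h1 := (contDiffAt_capInt hs hw.1 hh' hf1
      (mem_capDom_inv_sq hp' (half_pos hp') le_rfl)).1
    have h2 : ContDiffAt ℝ ∞ (fun p : Euc N × ℝ => ((p.2 / 2) ^ 2)⁻¹) p :=
      ((contDiffAt_snd.div_const 2).pow 2).inv (by positivity)
    exact (contDiffAt_comp_graph h2 h1).contDiffWithinAt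
  refine ⟨fun p => A w p / A (fun _ => 1) p, (hAs w hw).div (hAs _ (weakSol_one N s)) fun p hp =>
    (hA1 p hp).ne', fun p hp => div_nonneg ?_ (hA1 p hp).le, ?_⟩
  · refine setIntegral_nonneg (isOpen_halfSpace N).measurableSet fun q hq => mul_nonneg (hpos q hq)
      (mul_nonneg (le_of_lt hq) ?_)
    exact intervalIntegral.integral_nonneg (by positivity) fun θ hθ => mul_nonneg (Real.rpow_nonneg
      (Real.sin_nonneg_of_nonneg_of_le_pi hθ.1 (by linarith [hθ.2, Real.pi_pos])) _) (h0 _)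
  · have hloc : ∀ n : ℕ, LocallyIntegrable
        (({q : Euc N × ℝ | 1 / ((n : ℝ) + 1) ≤ q.2}).indicator w) volume := by
      intro n p
      have hn : (0 : ℝ) < 1 / ((n : ℝ) + 1) := by positivity
      have hm : MeasurableSet {q : Euc N × ℝ | 1 / ((n : ℝ) + 1) ≤ q.2} :=
        measurableSet_le measurable_const measurable_snd
      rcases le_or_gt p.2 0 with hp | hp
      · have hO : {q : Euc N × ℝ | q.2 < 1 / ((n : ℝ) + 1)} ∈ 𝓝 p :=
          (isOpen_lt continuous_snd continuous_const).mem_nhds (hp.trans_lt hn)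
        refine ⟨_, hO, (integrableOn_zero).congr_fun (fun q hq => ?_)
          (measurableSet_lt measurable_snd measurable_const)⟩
        rw [indicator_of_notMem (by simpa using hq)]
      · have h1 := hw.1 p hp
        rw [(isOpen_halfSpace N).nhdsWithin_eq hp] at h1
        obtain ⟨t, ht, hti⟩ := h1
        exact ⟨t, ht, hti.indicator hm⟩
    have hae := ae_all_iff.2 fun n =>
      IsUnifLocDoublingMeasure.ae_tendsto_average_norm_sub volume (hloc n) 1
    filter_upwards [ae_restrict_mem (isOpen_halfSpace N).measurableSet,
      ae_restrict_of_ae hae] with p hp hp'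
    have hp0 : 0 < p.2 := hp
    obtain ⟨n, hn⟩ := exists_nat_one_div_lt hp0
    have h1 := hp' n (fun r : ℝ => p) (fun r => r) (l := 𝓝[>] (0 : ℝ)) tendsto_id (by
      filter_upwards [self_mem_nhdsWithin] with r hr
      exact mem_closedBall_self (by simpa using (le_of_lt hr)))
    have h2 : Tendsto (fun r => ⨍ y in closedBall p r, ‖w y - w p‖) (𝓝[>] 0) (𝓝 0) := by
      refine h1.congr' ?_
      filter_upwards [Ioo_mem_nhdsGT (sub_pos.2 hn)] with r hr
      have : ∀ q ∈ closedBall p r, ({q : Euc N × ℝ | 1 / ((n : ℝ) + 1) ≤ q.2}).indicator w q =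
          w q := by
        intro q hq
        refine indicator_of_mem ?_ _
        have hq2 : |q.2 - p.2| ≤ r := by
          have := (norm_snd_le (q - p)).trans (mem_closedBall_iff_norm.1 hq)
          simpa using this
        change 1 / ((n : ℝ) + 1) ≤ q.2
        linarith [(abs_le.1 hq2).1, hr.2]
      refine setAverage_congr_fun measurableSet_closedBall (ae_of_all _ fun q hq => ?_)
      rw [this q hq, this p (mem_closedBall_self hr.1.le)]
    simp only [A]
    rw [capInt_eq_of_lebesgue hs hw hf hf0 hp0 h2]
    exact (mul_div_cancel_right₀ _ (hA1 p hp).ne').symm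

/-- The integral of `v * Ψ` over the horizontal slice at height `z`. -/
noncomputable def slice {N : ℕ} (v Ψ : Euc N × ℝ → ℝ) (z : ℝ) : ℝ := ∫ x, v (x, z) * Ψ (x, z)

theorem ContDiff.Mop {N : ℕ} (s : ℝ) {F : Euc N × ℝ → ℝ} (hF : ContDiff ℝ ∞ F) :
    ContDiff ℝ ∞ (Mop N s F) := by
  have h2 : ∀ v, ContDiff ℝ ∞ fun q => d2 F q v := fun v =>
    contDiff_fderiv_apply_const (contDiff_fderiv_apply_const hF v) v
  have h1 := contDiff_fderiv_apply_const hF (0, 1)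
  unfold _root_.Mop
  exact (contDiff_snd.mul ((ContDiff.sum fun i _ => h2 _).add (h2 _))).add (contDiff_const.mul h1)

theorem fderiv_eq_zero_of_notMem {N : ℕ} {Ψ : Euc N × ℝ → ℝ} {k : Set (Euc N)} (hk : IsClosed k)
    (hΨk : ∀ x ∉ k, ∀ z, Ψ (x, z) = 0) (v : Euc N × ℝ) {x : Euc N} (hx : x ∉ k) (z : ℝ) :
    fderiv ℝ Ψ (x, z) v = 0 := by
  have : Ψ =ᶠ[𝓝 (x, z)] fun _ => 0 := by
    filter_upwards [(hk.isOpen_compl.preimage continuous_fst).mem_nhds hx] with q hq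
    exact hΨk q.1 hq q.2
  rw [this.fderiv_eq]
  simp

theorem Mop_eq_zero_of_notMem {N : ℕ} (s : ℝ) {Ψ : Euc N × ℝ → ℝ} {k : Set (Euc N)} (hk : IsClosed k)
    (hΨk : ∀ x ∉ k, ∀ z, Ψ (x, z) = 0) {x : Euc N} (hx : x ∉ k) (z : ℝ) :
    Mop N s Ψ (x, z) = 0 := by
  have h1 : ∀ v, ∀ x ∉ k, ∀ z, fderiv ℝ Ψ (x, z) v = 0 := fun v x hx z =>
    fderiv_eq_zero_of_notMem hk hΨk v hx z
  have h2 : ∀ v, d2 Ψ (x, z) v = 0 := fun v => fderiv_eq_zero_of_notMem hk (h1 v) v hx z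
  simp [Mop, h2, h1 _ x hx z]

section
variable {N : ℕ} {s : ℝ} {v : Euc N × ℝ → ℝ} {Ψ : Euc N × ℝ → ℝ} {k : Set (Euc N)}

theorem continuous_slice_integrand (hv : ContDiffOn ℝ ∞ v {q : Euc N × ℝ | 0 < q.2})
    (hΨ : Continuous Ψ) {z : ℝ} (hz : 0 < z) : Continuous fun x => v (x, z) * Ψ (x, z) := by
  have : Continuous fun x => v (x, z) :=
    hv.continuousOn.comp_continuous (f := fun x : Euc N => (x, z)) (by fun_prop) fun x => hz
  exact this.mul (hΨ.comp (by fun_prop))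

theorem integrable_slice (hv : ContDiffOn ℝ ∞ v {q : Euc N × ℝ | 0 < q.2})
    (hΨ : Continuous Ψ) (hk : IsCompact k) (hΨk : ∀ x ∉ k, ∀ z, Ψ (x, z) = 0)
    {z : ℝ} (hz : 0 < z) : Integrable fun x => v (x, z) * Ψ (x, z) :=
  (continuous_slice_integrand hv hΨ hz).integrable_of_hasCompactSupport
    (HasCompactSupport.intro hk fun x hx => by rw [hΨk x hx, mul_zero])

theorem contDiffOn_slice (hv : ContDiffOn ℝ ∞ v {q : Euc N × ℝ | 0 < q.2})
    (hΨ : ContDiff ℝ ∞ Ψ) (hk : IsCompact k) (hΨk : ∀ x ∉ k, ∀ z, Ψ (x, z) = 0) :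
    ContDiffOn ℝ ∞ (slice v Ψ) (Ioi 0) := by
  have h1 : ContDiffOn ℝ ∞ (fun y : ℝ × Euc N => v (y.2, y.1) * Ψ (y.2, y.1))
      (Ioi 0 ×ˢ univ) :=
    ContDiffOn.mul (hv.comp (f := fun y : ℝ × Euc N => (y.2, y.1))
      (contDiff_snd.prodMk contDiff_fst).contDiffOn fun y hy => hy.1)
      (hΨ.comp (contDiff_snd.prodMk contDiff_fst)).contDiffOn
  have := contDiffOn_integral_mul (ν := volume) (f := fun _ => (1 : ℝ)) isOpen_Ioi hk
    (K := fun y : ℝ × Euc N => v (y.2, y.1) * Ψ (y.2, y.1))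
    (fun z _ x hx => by simp [hΨk x hx])
    (integrableOn_const hk.measure_lt_top.ne) h1
  simp only [one_mul] at this
  exact this

theorem slice_weak (hv : ContDiffOn ℝ ∞ v {q : Euc N × ℝ | 0 < q.2}) (hw : WeakSol N s v)
    (hΨ : ContDiff ℝ ∞ Ψ) (hk : IsCompact k) (hΨk : ∀ x ∉ k, ∀ z, Ψ (x, z) = 0)
    {ψ : ℝ → ℝ} (hψ : ContDiff ℝ ∞ ψ) (hψc : HasCompactSupport ψ) (hψs : tsupport ψ ⊆ Ioi 0) :
    ∫ z, (ψ z * slice v (Mop N s Ψ) z + 2 * z * deriv ψ z * slice v (fun q => fderiv ℝ Ψ q (0, 1)) z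
      + (z * deriv (deriv ψ) z + (1 + 2 * s) * deriv ψ z) * slice v Ψ z) = 0 := by
  have hF : ContDiff ℝ ∞ fun q : Euc N × ℝ => Ψ q * ψ q.2 := hΨ.mul (hψ.comp contDiff_snd)
  have hsub : Function.support (fun q : Euc N × ℝ => Ψ q * ψ q.2) ⊆ k ×ˢ tsupport ψ := by
    intro q hq
    constructor
    · by_contra h
      exact hq (by simp [show Ψ q = 0 from hΨk q.1 h q.2])
    · by_contra h
      exact hq (by simp [image_eq_zero_of_notMem_tsupport h])
  have hts : tsupport (fun q : Euc N × ℝ => Ψ q * ψ q.2) ⊆ {q : Euc N × ℝ | 0 < q.2} :=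
    (closure_minimal hsub (hk.isClosed.prod (isClosed_tsupport ψ))).trans fun q hq => hψs hq.2
  have hFc : HasCompactSupport fun q : Euc N × ℝ => Ψ q * ψ q.2 :=
    HasCompactSupport.of_support_subset_isCompact (hk.prod hψc) hsub
  have h0 := hw.2 _ hF hFc hts
  have hMs : tsupport (Mop N s fun q => Ψ q * ψ q.2) ⊆ tsupport fun q : Euc N × ℝ => Ψ q * ψ q.2 := by
    refine closure_minimal (fun q hq => ?_) (isClosed_tsupport _)
    by_contra h
    have e := notMem_tsupport_iff_eventuallyEq.1 h
    refine hq ?_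
    have e1 : ∀ v, d2 (fun q : Euc N × ℝ => Ψ q * ψ q.2) q v = 0 := fun v => by
      rw [d2_congr e v]
      simp [d2]
    unfold Mop
    rw [e.fderiv_eq]
    simp [e1]
  have hint : Integrable (fun q => v q * Mop N s (fun q => Ψ q * ψ q.2) q) := by
    have := contDiff_mul_of_tsupport (isOpen_halfSpace N) (hF.Mop s) (hMs.trans hts) hv
    simp only [mul_comm (v _)]
    exact this.continuous.integrable_of_hasCompactSupport (HasCompactSupport.mul_right
      (HasCompactSupport.of_support_subset_isCompact hFc ((subset_tsupport _).trans hMs)))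
  rw [setIntegral_eq_integral_of_forall_compl_eq_zero (fun q hq => by
    rw [image_eq_zero_of_notMem_tsupport (fun h => hq (hts (hMs h))), mul_zero])] at h0
  refine Eq.trans ?_ ((integral_prod_symm _ hint).symm.trans h0)
  refine integral_congr_ae (ae_of_all _ fun z => ?_)
  simp only
  have hM : ∀ x, Mop N s (fun q => Ψ q * ψ q.2) (x, z) = ψ z * Mop N s Ψ (x, z) +
      2 * z * fderiv ℝ Ψ (x, z) (0, 1) * deriv ψ z +
      Ψ (x, z) * (z * deriv (deriv ψ) z + (1 + 2 * s) * deriv ψ z) := fun x =>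
    Mop_mul_comp_snd (q := (x, z)) s (hΨ.contDiffAt.of_le (WithTop.coe_le_coe.2 le_top))
      (hψ.contDiffAt.of_le (WithTop.coe_le_coe.2 le_top))
  simp only [hM]
  by_cases hz : 0 < z
  · have i1 := integrable_slice hv (hΨ.Mop s).continuous hk
      (fun x hx z => Mop_eq_zero_of_notMem s hk.isClosed hΨk hx z) hz
    have i2 := integrable_slice hv (contDiff_fderiv_apply_const hΨ (0, 1)).continuous hk
      (fun x hx z => fderiv_eq_zero_of_notMem hk.isClosed hΨk (0, 1) hx z) hz
    have i3 := integrable_slice hv hΨ.continuous hk hΨk hz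
    have i12 : Integrable fun x => ψ z * (v (x, z) * Mop N s Ψ (x, z)) +
        2 * z * deriv ψ z * (v (x, z) * fderiv ℝ Ψ (x, z) (0, 1)) :=
      (i1.const_mul _).add (i2.const_mul _)
    unfold slice
    rw [← integral_const_mul, ← integral_const_mul, ← integral_const_mul,
      ← integral_add (i1.const_mul _) (i2.const_mul _), ← integral_add i12 (i3.const_mul _)]
    congr 1
    funext x
    ring
  · have hzt : z ∉ tsupport ψ := fun h => hz (hψs h)
    have e := notMem_tsupport_iff_eventuallyEq.1 hzt
    have e1 : deriv ψ =ᶠ[𝓝 z] fun _ => 0 := by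
      filter_upwards [e.eventuallyEq_nhds] with y hy
      rw [hy.deriv_eq]
      simp
    rw [e.self_of_nhds, e1.self_of_nhds, e1.deriv_eq]
    simp

theorem hasDerivAt_slice_flux (hv : ContDiffOn ℝ ∞ v {q : Euc N × ℝ | 0 < q.2})
    (hw : WeakSol N s v)
    (hΨ : ContDiff ℝ ∞ Ψ) (hk : IsCompact k) (hΨk : ∀ x ∉ k, ∀ z, Ψ (x, z) = 0)
    {z : ℝ} (hz : 0 < z) :
    HasDerivAt (fun z => z * deriv (slice v Ψ) z - 2 * s * slice v Ψ z -
      2 * z * slice v (fun q => fderiv ℝ Ψ q (0, 1)) z) (-slice v (Mop N s Ψ) z) z := by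
  set B := slice v Ψ with hB
  set E := slice v (fun q => fderiv ℝ Ψ q (0, 1)) with hE
  set D := slice v (Mop N s Ψ) with hD
  have cB : ContDiffOn ℝ ∞ B (Ioi 0) := contDiffOn_slice hv hΨ hk hΨk
  have cE : ContDiffOn ℝ ∞ E (Ioi 0) := contDiffOn_slice hv (contDiff_fderiv_apply_const hΨ (0, 1))
    hk (fun x hx z => fderiv_eq_zero_of_notMem hk.isClosed hΨk (0, 1) hx z)
  have cD : ContDiffOn ℝ ∞ D (Ioi 0) := contDiffOn_slice hv (hΨ.Mop s) hk
    (fun x hx z => Mop_eq_zero_of_notMem s hk.isClosed hΨk hx z)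
  have cB' : ContDiffOn ℝ ∞ (deriv B) (Ioi 0) := cB.deriv_of_isOpen isOpen_Ioi (by simp)
  set W := fun z => z * deriv B z - 2 * s * B z - 2 * z * E z with hW
  have cW : ContDiffOn ℝ ∞ W (Ioi 0) := by
    have : ContDiffOn ℝ ∞ (fun z : ℝ => z) (Ioi 0) := contDiffOn_id
    exact ((this.mul cB').sub (contDiffOn_const.mul cB)).sub ((contDiffOn_const.mul this).mul cE)
  have cW' : ContDiffOn ℝ ∞ (deriv W) (Ioi 0) := cW.deriv_of_isOpen isOpen_Ioi (by simp)
  have hWd : ∀ z, 0 < z → HasDerivAt W (deriv W z) z := fun z hz =>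
    ((cW.contDiffAt (Ioi_mem_nhds hz)).differentiableAt (by simp)).hasDerivAt
  have hBd : ∀ z, 0 < z → HasDerivAt B (deriv B z) z := fun z hz =>
    ((cB.contDiffAt (Ioi_mem_nhds hz)).differentiableAt (by simp)).hasDerivAt
  suffices h : deriv W z + D z = 0 by
    rw [← eq_neg_of_add_eq_zero_left h]
    exact hWd z hz
  have hcont : ContinuousOn (fun z => deriv W z + D z) (Ioi 0) :=
    cW'.continuousOn.add cD.continuousOn
  have hae : ∀ᵐ z ∂(volume : Measure ℝ), z ∈ Ioi (0 : ℝ) → deriv W z + D z = 0 := by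
    refine isOpen_Ioi.ae_eq_zero_of_integral_contDiff_smul_eq_zero
      (hcont.locallyIntegrableOn measurableSet_Ioi) fun ψ hψ hψc hψs => ?_
    have hz' := slice_weak hv hw hΨ hk hΨk hψ hψc hψs
    rw [← hB, ← hE, ← hD] at hz'
    have hψ' : ContDiff ℝ ∞ (deriv ψ) := contDiff_deriv_infty hψ
    have hψs' : tsupport (deriv ψ) ⊆ Ioi 0 := (tsupport_deriv_subset (𝕜 := ℝ)).trans hψs
    have g1 : ContDiff ℝ ∞ fun z => deriv ψ z * (z * B z) :=
      contDiff_mul_of_tsupport isOpen_Ioi hψ' hψs' (contDiffOn_id.mul cB)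
    have g2 : ContDiff ℝ ∞ fun z => ψ z * W z :=
      contDiff_mul_of_tsupport isOpen_Ioi hψ hψs cW
    have gc : HasCompactSupport fun z => deriv ψ z * (z * B z) - ψ z * W z :=
      (hψc.deriv.mul_right).sub hψc.mul_right
    have hG := integral_fderiv_eq_zero (ν := volume) (g1.sub g2) gc 1
    have i1 : Integrable (fun z => ψ z * (deriv W z + D z)) :=
      (contDiff_mul_of_tsupport isOpen_Ioi hψ hψs (cW'.add cD)).continuous.integrable_of_hasCompactSupport
        hψc.mul_right
    have i2 := (contDiff_fderiv_apply_const (g1.sub g2) (1 : ℝ)).continuous.integrable_of_hasCompactSupport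
      (μ := volume) (gc.fderiv_apply (𝕜 := ℝ) 1)
    have hsum := integral_add i1 i2
    rw [hG, add_zero] at hsum
    simp only [smul_eq_mul]
    refine hsum.symm.trans (Eq.trans ?_ hz')
    refine integral_congr_ae (ae_of_all _ fun y => ?_)
    simp only [fderiv_eq_smul_deriv, one_smul]
    by_cases hy : 0 < y
    · have d0 : HasDerivAt (fun z => z * B z) (1 * B y + y * deriv B y) y :=
        (hasDerivAt_id y).mul (hBd y hy)
      have d1 : HasDerivAt (fun z => deriv ψ z * (z * B z) - ψ z * W z)
          (deriv (deriv ψ) y * (y * B y) + deriv ψ y * (1 * B y + y * deriv B y) -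
            (deriv ψ y * W y + ψ y * deriv W y)) y :=
        ((hasDerivAt_deriv_of_contDiff hψ' y).mul d0).sub
          ((hasDerivAt_deriv_of_contDiff hψ y).mul (hWd y hy))
      rw [d1.deriv]
      simp only [hW]
      ring
    · have hzt : y ∉ tsupport ψ := fun h => hy (hψs h)
      have e := notMem_tsupport_iff_eventuallyEq.1 hzt
      have e1 : deriv ψ =ᶠ[𝓝 y] fun _ => 0 := by
        filter_upwards [e.eventuallyEq_nhds] with y hy
        rw [hy.deriv_eq]
        simp
      have e2 : (fun z => deriv ψ z * (z * B z) - ψ z * W z) =ᶠ[𝓝 y] fun _ => 0 := by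
        filter_upwards [e, e1] with x hx hx'
        simp [hx, hx']
      rw [e2.deriv_eq, e.self_of_nhds, e1.self_of_nhds, e1.deriv_eq]
      simp
  have := Measure.eqOn_open_of_ae_eq (μ := (volume : Measure ℝ)) (U := Ioi 0)
    (f := fun z => deriv W z + D z) (g := fun _ => 0)
    ((ae_restrict_iff' measurableSet_Ioi).2 hae) isOpen_Ioi hcont continuousOn_const
  exact this hz

end

theorem exists_ramp : ∃ θ θ' θ'' : ℝ → ℝ, ContDiff ℝ ∞ θ ∧ (∀ t, HasDerivAt θ (θ' t) t) ∧
    (∀ t, HasDerivAt θ' (θ'' t) t) ∧ (∀ t, t ≤ 0 → θ t = 0) ∧ (∀ t, 0 ≤ θ t) ∧ (∀ t, 0 ≤ θ' t) ∧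
    (∀ t, θ' t ≤ 1) ∧ (∀ t, 0 ≤ θ'' t) ∧ (∀ t, t - 1 ≤ θ t) := by
  have hc : ContDiff ℝ ∞ Real.smoothTransition := Real.smoothTransition.contDiff
  have hi : ∀ a b, IntervalIntegrable Real.smoothTransition volume a b :=
    fun a b => hc.continuous.intervalIntegrable a b
  have hd : ∀ t, HasDerivAt (fun t => ∫ x in (0 : ℝ)..t, Real.smoothTransition x)
      (Real.smoothTransition t) t := fun t =>
    intervalIntegral.integral_hasDerivAt_right (hi 0 t)
      (hc.continuous.stronglyMeasurableAtFilter _ _) hc.continuous.continuousAt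
  have h0 : ∀ t, t ≤ 0 → ∫ x in (0 : ℝ)..t, Real.smoothTransition x = 0 := fun t ht => by
    rw [intervalIntegral.integral_symm, neg_eq_zero]
    refine (intervalIntegral.integral_congr (g := fun _ => (0 : ℝ)) fun x hx => ?_).trans (by simp)
    rw [uIcc_of_le ht] at hx
    exact Real.smoothTransition.zero_of_nonpos hx.2
  have h1 : ∀ t, 0 ≤ ∫ x in (0 : ℝ)..t, Real.smoothTransition x := fun t => by
    rcases le_total t 0 with ht | ht
    · rw [h0 t ht]
    · exact intervalIntegral.integral_nonneg ht fun x _ => Real.smoothTransition.nonneg x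
  refine ⟨_, Real.smoothTransition, deriv Real.smoothTransition, ?_, hd,
    fun t => hasDerivAt_deriv_of_contDiff hc t, h0, h1, Real.smoothTransition.nonneg,
    Real.smoothTransition.le_one, fun t => Real.smoothTransition.monotone.deriv_nonneg, fun t => ?_⟩
  · refine contDiff_infty_iff_deriv.2 ⟨fun t => (hd t).differentiableAt, ?_⟩
    rwa [funext fun t => (hd t).deriv]
  · rcases le_total t 1 with ht | ht
    · exact (sub_nonpos.2 ht).trans (h1 t)
    · rw [← intervalIntegral.integral_add_adjacent_intervals (hi 0 1) (hi 1 t)]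
      have : ∫ x in (1 : ℝ)..t, Real.smoothTransition x = t - 1 := by
        refine (intervalIntegral.integral_congr (g := fun _ => (1 : ℝ)) fun x hx => ?_).trans
          (by simp)
        rw [uIcc_of_le ht] at hx
        exact Real.smoothTransition.one_of_one_le hx.1
      rw [this]
      linarith [h1 1]

theorem le_of_flux_inequality {B B' : ℝ → ℝ} {s c K : ℝ} (hs : 0 < s) (hs1 : s < 1) (hK : 0 ≤ K)
    (hB : ∀ z ∈ Ioc (0 : ℝ) 1, HasDerivAt B (B' z) z)
    (h : ∀ z ∈ Ioc (0 : ℝ) 1, 2 * s * B z ≤ z * B' z + c + K * z ^ 2) {z : ℝ}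
    (hz : z ∈ Ioc (0 : ℝ) 1) :
    B z ≤ c / (2 * s) + z ^ (2 * s) * (B 1 - c / (2 * s) + K / (2 - 2 * s)) := by
  have hs' : 0 < 2 - 2 * s := by linarith
  have hd : ∀ y ∈ Ioc (0 : ℝ) 1, HasDerivAt
      (fun y : ℝ => y ^ (-(2 * s)) * (B y - c / (2 * s)) + K * y ^ (2 - 2 * s) / (2 - 2 * s))
      (y ^ (-(2 * s) - 1) * (y * B' y + c + K * y ^ 2 - 2 * s * B y)) y := fun y hy => by
    have a1 : HasDerivAt (fun y : ℝ => y ^ (-(2 * s))) (-(2 * s) * y ^ (-(2 * s) - 1)) y :=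
      Real.hasDerivAt_rpow_const (Or.inl hy.1.ne')
    have a2 : HasDerivAt (fun y : ℝ => y ^ (2 - 2 * s)) ((2 - 2 * s) * y ^ (2 - 2 * s - 1)) y :=
      Real.hasDerivAt_rpow_const (Or.inl hy.1.ne')
    have a3 : HasDerivAt
      (fun y : ℝ => y ^ (-(2 * s)) * (B y - c / (2 * s)) + K * y ^ (2 - 2 * s) / (2 - 2 * s)) _ y :=
      (a1.mul ((hB y hy).sub_const (c / (2 * s)))).add ((a2.const_mul K).div_const (2 - 2 * s))
    convert a3 using 1
    have e1 : y ^ (-(2 * s)) = y ^ (-(2 * s) - 1) * y := by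
      rw [← Real.rpow_add_one hy.1.ne']
      ring_nf
    have e2 : y ^ (2 - 2 * s - 1) = y ^ (-(2 * s) - 1) * y ^ 2 := by
      rw [← Real.rpow_natCast y 2, ← Real.rpow_add hy.1]
      norm_num
      ring_nf
    rw [e1, e2]
    have hs2 : 1 - s ≠ 0 := by linarith
    field_simp
    ring
  have hmono := monotoneOn_of_deriv_nonneg (D := Icc z 1)
    (f := fun y : ℝ => y ^ (-(2 * s)) * (B y - c / (2 * s)) + K * y ^ (2 - 2 * s) / (2 - 2 * s))
    (convex_Icc _ _)
    (fun y hy => (hd y ⟨hz.1.trans_le hy.1, hy.2⟩).continuousAt.continuousWithinAt)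
    (fun y hy => by
      rw [interior_Icc] at hy
      exact (hd y ⟨hz.1.trans hy.1, hy.2.le⟩).differentiableAt.differentiableWithinAt)
    (fun y hy => by
      rw [interior_Icc] at hy
      have hy' : y ∈ Ioc (0 : ℝ) 1 := ⟨hz.1.trans hy.1, hy.2.le⟩
      rw [(hd y hy').deriv]
      exact mul_nonneg (Real.rpow_nonneg hy'.1.le _) (by linarith [h y hy']))
  have hle := hmono (left_mem_Icc.2 hz.2) (right_mem_Icc.2 hz.2) hz.2
  simp only [Real.one_rpow, one_mul, mul_one] at hle
  have hp : 0 < z ^ (2 * s) := Real.rpow_pos_of_pos hz.1 _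
  have h3 : 0 ≤ K * z ^ (2 - 2 * s) / (2 - 2 * s) :=
    div_nonneg (mul_nonneg hK (Real.rpow_nonneg hz.1.le _)) hs'.le
  have h4 : z ^ (-(2 * s)) * (B z - c / (2 * s)) ≤ B 1 - c / (2 * s) + K / (2 - 2 * s) := by
    linarith
  have h5 := mul_le_mul_of_nonneg_left h4 hp.le
  rw [← mul_assoc, ← Real.rpow_add hz.1, add_neg_cancel, Real.rpow_zero, one_mul] at h5
  linarith

theorem exists_bound_and_tendsto_of_abs_deriv_le {F F' : ℝ → ℝ} {C b : ℝ} (hb : 0 < b)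
    (hF : ∀ z ∈ Ioc (0 : ℝ) 1, HasDerivAt F (F' z) z)
    (h : ∀ z ∈ Ioc (0 : ℝ) 1, |F' z| ≤ C * z ^ (b - 1)) :
    (∃ M, ∀ z ∈ Ioc (0 : ℝ) 1, |F z| ≤ M) ∧ ∃ l, Tendsto F (𝓝[>] 0) (𝓝 l) := by
  have hC : 0 ≤ C := by
    have := (abs_nonneg _).trans (h 1 ⟨one_pos, le_rfl⟩)
    simpa using this
  have key : ∀ G G' : ℝ → ℝ, (∀ z ∈ Ioc (0 : ℝ) 1, HasDerivAt G (G' z) z) →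
      (∀ z ∈ Ioc (0 : ℝ) 1, |G' z| ≤ C * z ^ (b - 1)) →
      MonotoneOn (fun z => G z + C / b * z ^ b) (Ioc 0 1) := by
    intro G G' hG h
    have hd : ∀ y ∈ Ioc (0 : ℝ) 1,
        HasDerivAt (fun z => G z + C / b * z ^ b) (G' y + C * y ^ (b - 1)) y := fun y hy => by
      have a1 : HasDerivAt (fun z => G z + C / b * z ^ b) _ y :=
        (hG y hy).add ((Real.hasDerivAt_rpow_const (p := b) (Or.inl hy.1.ne')).const_mul (C / b))
      convert a1 using 1
      field_simp
    refine monotoneOn_of_deriv_nonneg (convex_Ioc _ _)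
      (fun y hy => (hd y hy).continuousAt.continuousWithinAt)
      (fun y hy => (hd y (interior_subset hy)).differentiableAt.differentiableWithinAt)
      (fun y hy => ?_)
    rw [(hd y (interior_subset hy)).deriv]
    linarith [neg_abs_le (G' y), h y (interior_subset hy)]
  have m1 := key F F' hF h
  have m2 := key (-F) (-F') (fun z hz => (hF z hz).neg) (fun z hz => by simpa using h z hz)
  have hr : ∀ z ∈ Ioc (0 : ℝ) 1, 0 ≤ C / b * z ^ b := fun z hz =>
    mul_nonneg (div_nonneg hC hb.le) (Real.rpow_nonneg hz.1.le _)
  have hM : ∀ z ∈ Ioc (0 : ℝ) 1, |F z| ≤ |F 1| + C / b := fun z hz => by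
    have h1 := m1 hz (right_mem_Ioc.2 one_pos) hz.2
    have h2 := m2 hz (right_mem_Ioc.2 one_pos) hz.2
    simp only [Real.one_rpow, mul_one, Pi.neg_apply] at h1 h2
    have := hr z hz
    rw [abs_le]
    constructor <;> linarith [neg_abs_le (F 1), le_abs_self (F 1)]
  refine ⟨⟨_, hM⟩, ?_⟩
  have hbdd : BddBelow ((fun z => F z + C / b * z ^ b) '' Ioo 0 1) := by
    refine ⟨-(|F 1| + C / b), ?_⟩
    rintro _ ⟨z, hz, rfl⟩
    have hz' : z ∈ Ioc (0 : ℝ) 1 := ⟨hz.1, hz.2.le⟩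
    have := (abs_le.1 (hM z hz')).1
    simp only
    linarith [hr z hz']
  have ht := (m1.mono Ioo_subset_Ioc_self).tendsto_nhdsWithin_Ioo_right ⟨1 / 2, by norm_num⟩ hbdd
  have ht2 : Tendsto (fun z : ℝ => C / b * z ^ b) (𝓝[>] 0) (𝓝 (C / b * 0 ^ b)) :=
    ((Real.continuousAt_rpow_const 0 b (Or.inr hb.le)).tendsto.const_mul _).mono_left
      nhdsWithin_le_nhds
  have := ht.sub ht2
  simp only [add_sub_cancel_right] at this
  exact ⟨_, this⟩

section
variable {N : ℕ} {s : ℝ} {v : Euc N × ℝ → ℝ} {Ψ : Euc N × ℝ → ℝ} {k : Set (Euc N)}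

theorem slice_nonneg (hv0 : ∀ q : Euc N × ℝ, 0 < q.2 → 0 ≤ v q) {z : ℝ} (hz : 0 < z)
    (h : ∀ x, 0 ≤ Ψ (x, z)) : 0 ≤ slice v Ψ z :=
  integral_nonneg fun x => mul_nonneg (hv0 (x, z) hz) (h x)

theorem integrableOn_slice_closedBall (hv : ContDiffOn ℝ ∞ v {q : Euc N × ℝ | 0 < q.2}) {z : ℝ} (hz : 0 < z)
    (R : ℝ) : IntegrableOn (fun x => v (x, z)) (closedBall 0 R) := by
  have : Continuous fun x => v (x, z) :=
    hv.continuousOn.comp_continuous (f := fun x : Euc N => (x, z)) (by fun_prop) fun x => hz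
  exact this.continuousOn.integrableOn_compact (isCompact_closedBall 0 R)

theorem neg_mul_le_slice (hv : ContDiffOn ℝ ∞ v {q : Euc N × ℝ | 0 < q.2})
    (hv0 : ∀ q : Euc N × ℝ, 0 < q.2 → 0 ≤ v q)
    (hΨ : Continuous Ψ) (hk : IsCompact k) (hΨk : ∀ x ∉ k, ∀ z, Ψ (x, z) = 0)
    {z : ℝ} (hz : 0 < z) {M R : ℝ} (h1 : ∀ x, ‖x‖ ≤ R → -M ≤ Ψ (x, z))
    (h2 : ∀ x, R < ‖x‖ → 0 ≤ Ψ (x, z)) :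
    -(M * ∫ x in closedBall 0 R, v (x, z)) ≤ slice v Ψ z := by
  rw [← neg_mul, ← integral_const_mul, ← integral_indicator measurableSet_closedBall]
  refine integral_mono ((integrable_indicator_iff measurableSet_closedBall).2
    ((integrableOn_slice_closedBall hv hz R).const_mul _)) (integrable_slice hv hΨ hk hΨk hz) fun x => ?_
  simp only
  have := hv0 (x, z) hz
  by_cases hx : ‖x‖ ≤ R
  · rw [indicator_of_mem (by simpa using hx)]
    nlinarith [h1 x hx]
  · rw [indicator_of_notMem (by simpa using hx)]
    exact mul_nonneg this (h2 x (not_le.1 hx))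

theorem abs_slice_le (hv : ContDiffOn ℝ ∞ v {q : Euc N × ℝ | 0 < q.2})
    (hv0 : ∀ q : Euc N × ℝ, 0 < q.2 → 0 ≤ v q) {R : ℝ}
    (hΨk : ∀ x ∉ closedBall (0 : Euc N) R, ∀ z, Ψ (x, z) = 0)
    {z : ℝ} (hz : 0 < z) {M : ℝ} (h1 : ∀ x, |Ψ (x, z)| ≤ M) :
    |slice v Ψ z| ≤ M * ∫ x in closedBall 0 R, v (x, z) := by
  rw [← integral_const_mul, ← integral_indicator measurableSet_closedBall]
  refine norm_integral_le_of_norm_le (μ := volume) (f := fun x => v (x, z) * Ψ (x, z)) ((integrable_indicator_iff measurableSet_closedBall).2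
    ((integrableOn_slice_closedBall hv hz R).const_mul _)) (ae_of_all _ fun x => ?_)
  have := hv0 (x, z) hz
  by_cases hx : x ∈ closedBall (0 : Euc N) R
  · rw [indicator_of_mem hx, Real.norm_eq_abs, abs_mul, abs_of_nonneg this, mul_comm]
    exact mul_le_mul_of_nonneg_right (h1 x) this
  · rw [indicator_of_notMem hx, hΨk x hx]
    simp

end

section
variable {N : ℕ} {s : ℝ} {v : Euc N × ℝ → ℝ} {Ψ : Euc N × ℝ → ℝ} {k : Set (Euc N)}

theorem hasDerivAt_slice (hv : ContDiffOn ℝ ∞ v {q : Euc N × ℝ | 0 < q.2})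
    (hΨ : ContDiff ℝ ∞ Ψ) (hk : IsCompact k) (hΨk : ∀ x ∉ k, ∀ z, Ψ (x, z) = 0)
    {z : ℝ} (hz : 0 < z) : HasDerivAt (slice v Ψ) (deriv (slice v Ψ) z) z :=
  (((contDiffOn_slice hv hΨ hk hΨk).contDiffAt (Ioi_mem_nhds hz)).differentiableAt
    (by simp)).hasDerivAt

theorem flux_sub_le (hv : ContDiffOn ℝ ∞ v {q : Euc N × ℝ | 0 < q.2}) (hw : WeakSol N s v)
    (hΨ : ContDiff ℝ ∞ Ψ) (hk : IsCompact k) (hΨk : ∀ x ∉ k, ∀ z, Ψ (x, z) = 0)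
    {a b m : ℝ} (ha : 0 < a) (hab : a ≤ b)
    (hD : ∀ y ∈ Icc a b, -m ≤ slice v (Mop N s Ψ) y) :
    (b * deriv (slice v Ψ) b - 2 * s * slice v Ψ b -
      2 * b * slice v (fun q => fderiv ℝ Ψ q (0, 1)) b) -
    (a * deriv (slice v Ψ) a - 2 * s * slice v Ψ a -
      2 * a * slice v (fun q => fderiv ℝ Ψ q (0, 1)) a) ≤ m * (b - a) := by
  have hd := fun y (hy : y ∈ Icc a b) =>
    hasDerivAt_slice_flux (s := s) hv hw hΨ hk hΨk (ha.trans_le hy.1)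
  refine (convex_Icc a b).image_sub_le_mul_sub_of_deriv_le
    (f := fun z => z * deriv (slice v Ψ) z - 2 * s * slice v Ψ z -
      2 * z * slice v (fun q => fderiv ℝ Ψ q (0, 1)) z)
    (fun y hy => (hd y hy).continuousAt.continuousWithinAt)
    (fun y hy => (hd y (interior_subset hy)).differentiableAt.differentiableWithinAt)
    (fun y hy => ?_) a (left_mem_Icc.2 hab) b (right_mem_Icc.2 hab) hab
  rw [(hd y (interior_subset hy)).deriv]
  linarith [hD y (interior_subset hy)]

theorem exists_bound_integral_closedBall (hs : 0 < s) (hs1 : s < 1)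
    (hv : ContDiffOn ℝ ∞ v {q : Euc N × ℝ | 0 < q.2}) (hw : WeakSol N s v)
    (hv0 : ∀ q : Euc N × ℝ, 0 < q.2 → 0 ≤ v q) (R : ℝ) :
    ∃ C, ∀ z ∈ Ioc (0 : ℝ) 1, ∫ x in closedBall 0 R, v (x, z) ≤ C := by
  obtain ⟨θ, θ', θ'', cθ, hθ, hθ', θ0, θn, θ'n, -, θ''n, θl⟩ := exists_ramp
  set A := R ^ 2 + 2 with hA
  set P : ℝ → ℝ := fun z => -(2 * N) * (1 - Real.cos z) with hPdef
  have hN0 : (0 : ℝ) ≤ N := N.cast_nonneg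
  have hP : ∀ z, HasDerivAt P (-(2 * N) * Real.sin z) z := fun z => by
    have : HasDerivAt (fun z => -(2 * N) * (1 - Real.cos z)) (-(2 * N : ℝ) * -(-Real.sin z)) z :=
      ((Real.hasDerivAt_cos z).const_sub 1).const_mul _
    rwa [neg_neg] at this
  have hP' : ∀ z, HasDerivAt (fun z => -(2 * N : ℝ) * Real.sin z) (-(2 * N) * Real.cos z) z :=
    fun z => (Real.hasDerivAt_sin z).const_mul _
  have hf : ∀ t, HasDerivAt (fun t => θ (A - t)) ((fun t => -θ' (A - t)) t) t := fun t => by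
    have := (hθ (A - t)).comp t ((hasDerivAt_id t).const_sub A)
    simpa [Function.comp_def] using this
  have hf' : ∀ t, HasDerivAt (fun t => -θ' (A - t)) ((fun t => θ'' (A - t)) t) t := fun t => by
    have : HasDerivAt (fun t => -θ' (A - t)) (-(θ'' (A - t) * -1)) t :=
      ((hθ' (A - t)).comp t ((hasDerivAt_id t).const_sub A)).neg
    simpa using this
  set Ψ : Euc N × ℝ → ℝ := fun w => (fun t => θ (A - t)) (‖w.1 - 0‖ ^ 2 + P w.2) with hΨdef
  have cP : ContDiff ℝ ∞ P := contDiff_const.mul (contDiff_const.sub Real.contDiff_cos)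
  have cΨ : ContDiff ℝ ∞ Ψ :=
    cθ.comp (contDiff_const.sub (((contDiff_fst.sub contDiff_const).norm_sq ℝ).add
      (cP.comp contDiff_snd)))
  have hPb : ∀ z, P z ≤ 0 ∧ -(4 * N) ≤ P z := fun z => by
    have h1 := Real.cos_le_one z
    have h2 := Real.neg_one_le_cos z
    simp only [hPdef]
    constructor <;> nlinarith
  have hk : IsCompact (closedBall (0 : Euc N) (A + 4 * N)) := isCompact_closedBall _ _
  have hΨk : ∀ x ∉ closedBall (0 : Euc N) (A + 4 * N), ∀ z, Ψ (x, z) = 0 := fun x hx z => by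
    have hx' : A + 4 * N < ‖x‖ := by simpa using hx
    refine θ0 _ ?_
    simp only [sub_zero]
    nlinarith [(hPb z).2, sq_nonneg R]
  have hM : ∀ x, ∀ z ∈ Ioc (0 : ℝ) 1, 0 ≤ Mop N s Ψ (x, z) := fun x z hz => by
    rw [hΨdef, Mop_radial s 0 hf hf' hP hP' (x, z)]
    simp only [sub_zero]
    set τ := A - (‖x‖ ^ 2 + P z)
    have h1 := Real.one_sub_sq_div_two_le_cos (x := z)
    have h2 := Real.sin_ge_sub_cube hz.1.le
    have h3 : 0 ≤ z * Real.cos z + (1 + 2 * s) * Real.sin z - z := by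
      have hz3 : z ^ 3 ≤ z := by
        have : z ^ 2 ≤ 1 := pow_le_one₀ hz.1.le hz.2
        nlinarith [hz.1]
      have hsin : 0 ≤ Real.sin z := by linarith [hz.1]
      have : z * (1 - z ^ 2 / 2) ≤ z * Real.cos z := mul_le_mul_of_nonneg_left h1 hz.1.le
      have : 0 ≤ s * Real.sin z := mul_nonneg hs.le hsin
      nlinarith [hz.1]
    have h4 : 0 ≤ z * (θ'' τ * (4 * ‖x‖ ^ 2 + (-(2 * N) * Real.sin z) ^ 2)) :=
      mul_nonneg hz.1.le (mul_nonneg (θ''n _) (by positivity))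
    have h5 : 0 ≤ θ' τ * (2 * N) * (z * Real.cos z + (1 + 2 * s) * Real.sin z - z) :=
      mul_nonneg (mul_nonneg (θ'n _) (by positivity)) h3
    linarith
  have hE : ∀ x, ∀ z ∈ Ioc (0 : ℝ) 1, 0 ≤ fderiv ℝ Ψ (x, z) (0, 1) := fun x z hz => by
    rw [hΨdef, fderiv_radial 0 hf hP (x, z) (0, 1)]
    simp only [inner_zero_right, mul_zero, zero_add, mul_one]
    have := Real.sin_nonneg_of_nonneg_of_le_pi hz.1.le (hz.2.trans (by linarith [Real.pi_gt_three]))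
    have := mul_nonneg (θ'n (A - (‖x - 0‖ ^ 2 + P z))) (mul_nonneg hN0 this)
    linarith
  set W := fun z => z * deriv (slice v Ψ) z - 2 * s * slice v Ψ z -
      2 * z * slice v (fun q => fderiv ℝ Ψ q (0, 1)) z with hW
  have hW1 : ∀ z ∈ Ioc (0 : ℝ) 1, W 1 ≤ W z := fun z hz => by
    have := flux_sub_le (m := 0) hv hw cΨ hk hΨk hz.1 hz.2 fun y hy => by
      rw [neg_zero]
      have hy' : y ∈ Ioc (0 : ℝ) 1 := ⟨hz.1.trans_le hy.1, hy.2⟩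
      exact slice_nonneg hv0 hy'.1 fun x => hM x y hy'
    simp only [hW]
    linarith
  have hB := fun z (hz : z ∈ Ioc (0 : ℝ) 1) => le_of_flux_inequality (K := 0) (c := -W 1) hs hs1 le_rfl
    (fun z hz => hasDerivAt_slice hv cΨ hk hΨk hz.1) (fun z hz => by
      have h1 := hW1 z hz
      have h2 := mul_nonneg hz.1.le
        (slice_nonneg (Ψ := fun q => fderiv ℝ Ψ q (0, 1)) hv0 hz.1 fun x => hE x z hz)
      have h3 : W z = z * deriv (slice v Ψ) z - 2 * s * slice v Ψ z -
        2 * z * slice v (fun q => fderiv ℝ Ψ q (0, 1)) z := rfl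
      linarith) hz
  refine ⟨|-W 1 / (2 * s)| + |slice v Ψ 1 - -W 1 / (2 * s) + 0 / (2 - 2 * s)|, fun z hz => ?_⟩
  have hl := neg_mul_le_slice (M := -1) (R := R) hv hv0 cΨ.continuous hk hΨk hz.1 (fun x hx => by
    refine le_trans ?_ (θl _)
    have : ‖x‖ ^ 2 ≤ R ^ 2 := by nlinarith [norm_nonneg x]
    simp only [sub_zero]
    linarith [(hPb z).1]) (fun x _ => θn _)
  have h1 := hB z hz
  have h2 : z ^ (2 * s) ≤ 1 := Real.rpow_le_one hz.1.le hz.2 (by linarith)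
  have h3 : 0 ≤ z ^ (2 * s) := Real.rpow_nonneg hz.1.le _
  have h4 : z ^ (2 * s) * (slice v Ψ 1 - -W 1 / (2 * s) + 0 / (2 - 2 * s)) ≤
      |slice v Ψ 1 - -W 1 / (2 * s) + 0 / (2 - 2 * s)| :=
    (mul_le_mul_of_nonneg_left (le_abs_self _) h3).trans (mul_le_of_le_one_left (abs_nonneg _) h2)
  linarith [le_abs_self (-W 1 / (2 * s))]

theorem fderiv_comp_fst_zero {ζ : Euc N → ℝ} (hζ : ContDiff ℝ ∞ ζ) (q : Euc N × ℝ) :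
    fderiv ℝ (fun q : Euc N × ℝ => ζ q.1) q (0, 1) = 0 := by
  have h : HasFDerivAt (fun q : Euc N × ℝ => ζ q.1) _ q :=
    ((hζ.differentiable (by simp) q.1).hasFDerivAt).comp q hasFDerivAt_fst
  rw [h.fderiv]
  simp

theorem exists_tendsto_slice (hs : 0 < s) (hs1 : s < 1)
    (hv : ContDiffOn ℝ ∞ v {q : Euc N × ℝ | 0 < q.2}) (hw : WeakSol N s v)
    (hv0 : ∀ q : Euc N × ℝ, 0 < q.2 → 0 ≤ v q) {ζ : Euc N → ℝ} (hζ : ContDiff ℝ ∞ ζ)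
    (hζc : HasCompactSupport ζ) :
    ∃ l, Tendsto (fun z => ∫ x, v (x, z) * ζ x) (𝓝[>] 0) (𝓝 l) := by
  obtain ⟨R, hR⟩ := hζc.isBounded.subset_closedBall (0 : Euc N)
  set Ψ : Euc N × ℝ → ℝ := fun q => ζ q.1 with hΨdef
  have cΨ : ContDiff ℝ ∞ Ψ := hζ.comp contDiff_fst
  have hk : IsCompact (closedBall (0 : Euc N) R) := isCompact_closedBall _ _
  have hΨk : ∀ x ∉ closedBall (0 : Euc N) R, ∀ z, Ψ (x, z) = 0 := fun x hx z =>
    image_eq_zero_of_notMem_tsupport (f := ζ) fun h => hx (hR h)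
  have hE : (fun q => fderiv ℝ Ψ q (0, 1)) = fun _ => 0 := funext fun q => fderiv_comp_fst_zero hζ q
  obtain ⟨m, hm⟩ := exists_bound_integral_closedBall hs hs1 hv hw hv0 R
  set G : Euc N × ℝ → ℝ := fun q => ∑ i, d2 Ψ q (EuclideanSpace.single i 1, 0) with hG
  have hMG : ∀ q, Mop N s Ψ q = q.2 * G q := fun q => by
    have h1 : d2 Ψ q (0, 1) = 0 := by
      unfold d2
      rw [hE]
      simp
    have h2 : fderiv ℝ Ψ q (0, 1) = 0 := congrFun hE q
    simp only [Mop, h1, h2, hG]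
    ring
  have cG : Continuous G := continuous_finsetSum _ fun i _ =>
    (contDiff_fderiv_apply_const (contDiff_fderiv_apply_const cΨ _) _).continuous
  obtain ⟨C, hC⟩ := (hk.prod (isCompact_Icc (a := (0 : ℝ)) (b := 1))).exists_bound_of_continuousOn
    cG.continuousOn
  have hC' : ∀ z ∈ Ioc (0 : ℝ) 1, ∀ x, |Mop N s Ψ (x, z)| ≤ |C| * z := fun z hz x => by
    by_cases hx : x ∈ closedBall (0 : Euc N) R
    · rw [hMG, abs_mul, abs_of_pos hz.1, mul_comm]
      exact mul_le_mul_of_nonneg_right ((hC (x, z) ⟨hx, hz.1.le, hz.2⟩).trans (le_abs_self C)) hz.1.le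
    · rw [Mop_eq_zero_of_notMem s hk.isClosed hΨk hx, abs_zero]
      exact mul_nonneg (abs_nonneg C) hz.1.le
  have hD : ∀ z ∈ Ioc (0 : ℝ) 1, |slice v (Mop N s Ψ) z| ≤ |C| * m * z := fun z hz => by
    refine (abs_slice_le hv hv0 (fun x hx z => Mop_eq_zero_of_notMem s hk.isClosed hΨk hx z) hz.1
      (hC' z hz)).trans ?_
    have := mul_le_mul_of_nonneg_left (hm z hz) (mul_nonneg (abs_nonneg C) hz.1.le)
    linarith
  set F := slice v Ψ with hF
  have hY : ∀ z ∈ Ioc (0 : ℝ) 1, HasDerivAt (fun z => z ^ (-(2 * s)) * (z * deriv F z))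
      (-(z ^ (-(2 * s)) * slice v (Mop N s Ψ) z)) z := fun z hz => by
    have h1 := hasDerivAt_slice_flux (s := s) hv hw cΨ hk hΨk hz.1
    rw [hE] at h1
    simp only [slice, mul_zero, integral_zero, sub_zero] at h1
    have h2 := hasDerivAt_slice hv cΨ hk hΨk hz.1
    have h3 : HasDerivAt (fun z => z * deriv F z) (-slice v (Mop N s Ψ) z + 2 * s * deriv F z) z := by
      have : HasDerivAt (fun z => (z * deriv F z - 2 * s * F z) + 2 * s * F z)
        (-slice v (Mop N s Ψ) z + 2 * s * deriv F z) z := HasDerivAt.add h1 (h2.const_mul (2 * s))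
      simpa using this
    have h4 : HasDerivAt (fun y : ℝ => y ^ (-(2 * s)) * (y * deriv F y)) _ z :=
      (Real.hasDerivAt_rpow_const (p := -(2 * s)) (Or.inl hz.1.ne')).mul h3
    convert h4 using 1
    have e1 : z ^ (-(2 * s)) = z ^ (-(2 * s) - 1) * z := by
      rw [← Real.rpow_add_one hz.1.ne']
      ring_nf
    rw [e1]
    ring
  obtain ⟨⟨M, hM⟩, -⟩ := exists_bound_and_tendsto_of_abs_deriv_le (C := |C| * m) (b := 2 - 2 * s)
    (by linarith) hY (fun z hz => by
      rw [abs_neg, abs_mul, abs_of_pos (Real.rpow_pos_of_pos hz.1 _)]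
      have e1 : z ^ (2 - 2 * s - 1) = z ^ (-(2 * s)) * z := by
        rw [← Real.rpow_add_one hz.1.ne']
        ring_nf
      rw [e1]
      have := mul_le_mul_of_nonneg_left (hD z hz) (Real.rpow_nonneg hz.1.le (-(2 * s)))
      linarith)
  exact (exists_bound_and_tendsto_of_abs_deriv_le (F := F) (C := M) (b := 2 * s) (by linarith)
    (fun z hz => hasDerivAt_slice hv cΨ hk hΨk hz.1) (fun z hz => by
      have h1 := hM z hz
      have e1 : deriv F z = (z ^ (-(2 * s)) * (z * deriv F z)) * z ^ (2 * s - 1) := by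
        have : z ^ (-(2 * s)) * z * z ^ (2 * s - 1) = 1 := by
          rw [← Real.rpow_add_one hz.1.ne', ← Real.rpow_add hz.1]
          ring_nf
          exact Real.rpow_zero z
        linear_combination (-deriv F z) * this
      rw [e1, abs_mul, abs_of_pos (Real.rpow_pos_of_pos hz.1 (2 * s - 1))]
      exact mul_le_mul_of_nonneg_right h1 (Real.rpow_nonneg hz.1.le _))).2

end

section
variable {N : ℕ} {s : ℝ} {v : Euc N × ℝ → ℝ}

open scoped CompactlySupported in
theorem exists_trace_measure (hs : 0 < s) (hs1 : s < 1)
    (hv : ContDiffOn ℝ ∞ v {q : Euc N × ℝ | 0 < q.2}) (hw : WeakSol N s v)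
    (hv0 : ∀ q : Euc N × ℝ, 0 < q.2 → 0 ≤ v q) :
    ∃ μ : Measure (Euc N), IsLocallyFiniteMeasure μ ∧
      ∀ ζ : Euc N → ℝ, ContDiff ℝ ∞ ζ → HasCompactSupport ζ →
        Tendsto (fun z => ∫ x, v (x, z) * ζ x) (𝓝[>] 0) (𝓝 (∫ x, ζ x ∂μ)) := by
  set 𝒰 : Ultrafilter ℝ := Ultrafilter.of (𝓝[>] 0) with h𝒰
  have hle : (𝒰 : Filter ℝ) ≤ 𝓝[>] 0 := Ultrafilter.of_le _
  have hpos : ∀ᶠ z in (𝒰 : Filter ℝ), 0 < z := hle self_mem_nhdsWithin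
  have hint : ∀ f : C_c(Euc N, ℝ), ∀ z, 0 < z → Integrable fun x => v (x, z) * f x := fun f z hz =>
    integrable_slice (Ψ := fun q => f q.1) hv (f.continuous.comp continuous_fst) f.hasCompactSupport
      (fun x hx z => image_eq_zero_of_notMem_tsupport (f := f) hx) hz
  have hlim : ∀ f : C_c(Euc N, ℝ), ∃ l, Tendsto (fun z => ∫ x, v (x, z) * f x) 𝒰 (𝓝 l) := by
    intro f
    obtain ⟨R, hR⟩ := f.hasCompactSupport.isBounded.subset_closedBall (0 : Euc N)
    obtain ⟨m, hm⟩ := exists_bound_integral_closedBall hs hs1 hv hw hv0 R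
    obtain ⟨M, hM⟩ := f.continuous.bounded_above_of_compact_support f.hasCompactSupport
    have hM0 : 0 ≤ M := (norm_nonneg _).trans (hM 0)
    have hb : ∀ᶠ z in (𝒰 : Filter ℝ), ∫ x, v (x, z) * f x ∈ Icc (-(M * m)) (M * m) := by
      filter_upwards [hle (Ioc_mem_nhdsGT one_pos)] with z hz
      have := abs_slice_le (Ψ := fun q => f q.1) (R := R) hv hv0
        (fun x hx z => image_eq_zero_of_notMem_tsupport (f := f) fun h => hx (hR h)) hz.1 hM
      exact abs_le.1 (this.trans (mul_le_mul_of_nonneg_left (hm z hz) hM0))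
    obtain ⟨l, -, hl⟩ := isCompact_Icc.ultrafilter_le_nhds' (𝒰.map fun z => ∫ x, v (x, z) * f x) hb
    exact ⟨l, hl⟩
  choose L hL using hlim
  set Λ : C_c(Euc N, ℝ) →ₚ[ℝ] ℝ := PositiveLinearMap.mk₀
    { toFun := L
      map_add' := fun f g => by
        refine tendsto_nhds_unique (hL (f + g)) (((hL f).add (hL g)).congr' ?_)
        filter_upwards [hpos] with z hz
        rw [← integral_add (hint f z hz) (hint g z hz)]
        congr 1
        funext x
        simp [mul_add]
      map_smul' := fun c f => by
        refine tendsto_nhds_unique (hL (c • f)) (((hL f).const_smul c).congr' ?_)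
        filter_upwards [hpos] with z hz
        rw [smul_eq_mul, ← integral_const_mul]
        congr 1
        funext x
        simp [mul_left_comm] }
    (fun f hf => by
      refine ge_of_tendsto (hL f) ?_
      filter_upwards [hpos] with z hz
      exact integral_nonneg fun x => mul_nonneg (hv0 (x, z) hz) (hf x)) with hΛ
  refine ⟨RealRMK.rieszMeasure Λ, inferInstance, fun ζ hζ hζc => ?_⟩
  obtain ⟨l, hl⟩ := exists_tendsto_slice hs hs1 hv hw hv0 hζ hζc
  have h1 := RealRMK.integral_rieszMeasure Λ ⟨⟨ζ, hζ.continuous⟩, hζc⟩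
  have h2 := hL ⟨⟨ζ, hζ.continuous⟩, hζc⟩
  have h3 := tendsto_nhds_unique (hl.mono_left hle) h2
  rw [h3] at hl
  have h4 : ∫ x, ζ x ∂(RealRMK.rieszMeasure Λ) = L ⟨⟨ζ, hζ.continuous⟩, hζc⟩ := h1
  rwa [h4]

end

theorem exists_smooth_rpow_neg (k : ℝ) : ∃ η η' η'' : ℝ → ℝ, ContDiff ℝ ∞ η ∧
    (∀ t, HasDerivAt η (η' t) t) ∧ (∀ t, HasDerivAt η' (η'' t) t) ∧ Continuous η' ∧
    Continuous η'' ∧ (∀ t, 0 ≤ η t) ∧ (∀ t, 1 ≤ t → η t = t ^ (-k)) ∧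
    (∀ t, 1 ≤ t → t * η'' t + (k + 1) * η' t = 0) := by
  set η : ℝ → ℝ := fun t => Real.smoothTransition (4 * t - 1) * t ^ (-k) with hη
  have c : ContDiff ℝ ∞ η := by
    refine contDiff_iff_contDiffAt.2 fun t => ?_
    rcases lt_or_ge 0 t with ht | ht
    · exact ContDiffAt.mul (Real.smoothTransition.contDiff.comp
        ((contDiff_const.mul contDiff_id).sub contDiff_const)).contDiffAt
        (contDiffAt_id.rpow_const_of_ne ht.ne')
    · have : η =ᶠ[𝓝 t] fun _ => 0 := by
        filter_upwards [Iio_mem_nhds (ht.trans_lt (by norm_num : (0 : ℝ) < 1 / 4))] with y hy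
        have hy' : y < 1 / 4 := hy
        simp only [hη]
        rw [Real.smoothTransition.zero_of_nonpos (by linarith), zero_mul]
      exact contDiffAt_const.congr_of_eventuallyEq this
  have heq : ∀ t, 1 / 2 ≤ t → η t = t ^ (-k) := fun t ht => by
    simp only [hη]
    rw [Real.smoothTransition.one_of_one_le (by linarith), one_mul]
  have hev : ∀ t, 1 / 2 < t → η =ᶠ[𝓝 t] fun t => t ^ (-k) := fun t ht => by
    filter_upwards [Ioi_mem_nhds ht] with y hy using heq y (le_of_lt hy)
  have hd : ∀ t, 1 / 2 < t → deriv η t = -k * t ^ (-k - 1) := fun t ht => by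
    rw [(hev t ht).deriv_eq]
    exact (Real.hasDerivAt_rpow_const (Or.inl (by linarith))).deriv
  have hd2 : ∀ t, 1 / 2 < t → deriv (deriv η) t = -k * ((-k - 1) * t ^ (-k - 1 - 1)) :=
    fun t ht => by
    have : deriv η =ᶠ[𝓝 t] fun t => -k * t ^ (-k - 1) := by
      filter_upwards [Ioi_mem_nhds ht] with y hy using hd y hy
    rw [this.deriv_eq]
    exact ((Real.hasDerivAt_rpow_const (Or.inl (by linarith))).const_mul _).deriv
  refine ⟨η, deriv η, deriv (deriv η), c, fun t => hasDerivAt_deriv_of_contDiff c t,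
    fun t => hasDerivAt_deriv_of_contDiff (contDiff_deriv_infty c) t, (contDiff_deriv_infty c).continuous,
    (contDiff_deriv_infty (contDiff_deriv_infty c)).continuous, fun t => ?_,
    fun t ht => heq t (by linarith), fun t ht => ?_⟩
  · rcases le_or_gt 0 t with ht | ht
    · exact mul_nonneg (Real.smoothTransition.nonneg _) (Real.rpow_nonneg ht _)
    · simp only [hη]
      rw [Real.smoothTransition.zero_of_nonpos (by linarith), zero_mul]
  · rw [hd t (by linarith), hd2 t (by linarith)]
    have : t ^ (-k - 1) = t ^ (-k - 1 - 1) * t := by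
      rw [← Real.rpow_add_one (by linarith)]
      ring_nf
    rw [this]
    ring

section
variable {N : ℕ} {s : ℝ} {v : Euc N × ℝ → ℝ}

theorem exists_bound_integral_truncation (hs : 0 < s) (hs1 : s < 1)
    (hv : ContDiffOn ℝ ∞ v {q : Euc N × ℝ | 0 < q.2}) (hw : WeakSol N s v)
    (hv0 : ∀ q : Euc N × ℝ, 0 < q.2 → 0 ≤ v q) {μ : Measure (Euc N)}
    (hμ : ∀ ζ : Euc N → ℝ, ContDiff ℝ ∞ ζ → HasCompactSupport ζ →
        Tendsto (fun z => ∫ x, v (x, z) * ζ x) (𝓝[>] 0) (𝓝 (∫ x, ζ x ∂μ))) :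
    ∃ C, ∀ δ, 0 < δ → ∃ ζ : Euc N → ℝ, Continuous ζ ∧ HasCompactSupport ζ ∧ (∀ x, 0 ≤ ζ x) ∧
      (∀ x, 1 ≤ ‖x‖ → ‖x‖ ^ (-((N : ℝ) + 2 * s)) - 2 * δ ≤ ζ x) ∧ ∫ x, ζ x ∂μ ≤ C := by
  obtain ⟨θ, θ', θ'', cθ, hθ, hθ', θ0, θn, θ'n, θ'1, θ''n, θl⟩ := exists_ramp
  have hN0 : (0 : ℝ) ≤ N := N.cast_nonneg
  set k : ℝ := (N + 2 * s) / 2 with hkdef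
  have hk0 : 0 < k := by positivity
  obtain ⟨η, η', η'', cη, hη, hη', cη', cη'', ηn, η1, ηL⟩ := exists_smooth_rpow_neg k
  obtain ⟨m, hm⟩ := exists_bound_integral_closedBall hs hs1 hv hw hv0 1
  obtain ⟨M, hM⟩ := isCompact_Icc (a := (0 : ℝ)) (b := 1) |>.exists_bound_of_continuousOn
    (f := fun t => 4 * (t * η'' t + (k + 1) * η' t)) (by fun_prop)
  have hM0 : 0 ≤ M := (norm_nonneg _).trans (hM 0 ⟨le_rfl, zero_le_one⟩)
  have hI0 : ∀ z : ℝ, 0 < z → ∀ R, 0 ≤ ∫ x in closedBall (0 : Euc N) R, v (x, z) := fun z hz R =>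
    integral_nonneg fun x => hv0 (x, z) hz
  have hm0 : 0 ≤ m := (hI0 1 one_pos 1).trans (hm 1 ⟨one_pos, le_rfl⟩)
  refine ⟨M * m / (2 * s), fun δ hδ => ?_⟩
  set g : ℝ → ℝ := fun t => δ * θ (η t / δ - 1) with hg
  set g' : ℝ → ℝ := fun t => θ' (η t / δ - 1) * η' t with hg'
  set g'' : ℝ → ℝ := fun t => θ'' (η t / δ - 1) * η' t ^ 2 / δ + θ' (η t / δ - 1) * η'' t with hg''
  have hgd : ∀ t, HasDerivAt g (g' t) t := fun t => by
    have : HasDerivAt (fun t => δ * θ (η t / δ - 1)) (δ * (θ' (η t / δ - 1) * (η' t / δ))) t :=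
      ((hθ _).comp t (((hη t).div_const δ).sub_const 1)).const_mul δ
    convert this using 1
    simp only [hg']
    field_simp
  have hgd' : ∀ t, HasDerivAt g' (g'' t) t := fun t => by
    have : HasDerivAt (fun t => θ' (η t / δ - 1) * η' t)
        (θ'' (η t / δ - 1) * (η' t / δ) * η' t + θ' (η t / δ - 1) * η'' t) t :=
      HasDerivAt.mul ((hθ' _).comp t (((hη t).div_const δ).sub_const 1)) (hη' t)
    convert this using 1
    simp only [hg'']
    ring
  have cg : ContDiff ℝ ∞ g :=
    contDiff_const.mul (cθ.comp ((cη.div_const δ).sub contDiff_const))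
  have hP : ∀ z : ℝ, HasDerivAt (fun z : ℝ => z ^ 2) (2 * z) z := fun z => by
    simpa using hasDerivAt_pow 2 z
  have hP' : ∀ z : ℝ, HasDerivAt (fun z : ℝ => 2 * z) ((fun _ => 2) z) z := fun z => by
    simpa using (hasDerivAt_id z).const_mul 2
  obtain ⟨R, hR1, hR⟩ : ∃ R : ℝ, 1 ≤ R ∧ ∀ t, R ≤ t → g t = 0 := by
    have h1 := (tendsto_rpow_neg_atTop hk0).eventually (gt_mem_nhds hδ)
    obtain ⟨R, hR⟩ := eventually_atTop.1 (h1.and (eventually_ge_atTop 1))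
    refine ⟨max R 1, le_max_right _ _, fun t ht => ?_⟩
    have h2 := hR t ((le_max_left _ _).trans ht)
    have h3 : η t / δ ≤ 1 := by
      rw [η1 t h2.2, div_le_one hδ]
      exact h2.1.le
    simp only [hg]
    rw [θ0 _ (by linarith), mul_zero]
  set Ψ : Euc N × ℝ → ℝ := fun w => g (‖w.1 - 0‖ ^ 2 + (fun z : ℝ => z ^ 2) w.2) with hΨdef
  have cΨ : ContDiff ℝ ∞ Ψ :=
    cg.comp (((contDiff_fst.sub contDiff_const).norm_sq ℝ).add (contDiff_snd.pow 2))
  have hk : IsCompact (closedBall (0 : Euc N) R) := isCompact_closedBall _ _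
  have hΨk : ∀ x ∉ closedBall (0 : Euc N) R, ∀ z, Ψ (x, z) = 0 := fun x hx z => by
    have hx' : R < ‖x‖ := by simpa using hx
    refine hR _ ?_
    simp only [sub_zero]
    nlinarith [sq_nonneg z]
  have hMop : ∀ x z, Mop N s Ψ (x, z) = z * (4 * (‖x‖ ^ 2 + z ^ 2) *
      (θ'' (η (‖x‖ ^ 2 + z ^ 2) / δ - 1) * η' (‖x‖ ^ 2 + z ^ 2) ^ 2 / δ) +
      θ' (η (‖x‖ ^ 2 + z ^ 2) / δ - 1) * (4 * ((‖x‖ ^ 2 + z ^ 2) * η'' (‖x‖ ^ 2 + z ^ 2) +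
        (k + 1) * η' (‖x‖ ^ 2 + z ^ 2)))) := fun x z => by
    rw [hΨdef, Mop_radial s 0 hgd hgd' hP hP' (x, z)]
    simp only [sub_zero, hg', hg'', hkdef]
    ring
  have hpos1 : ∀ x z, 0 < z → 1 ≤ ‖x‖ ^ 2 + z ^ 2 → 0 ≤ Mop N s Ψ (x, z) := fun x z hz h => by
    rw [hMop, ηL _ h, mul_zero, mul_zero, add_zero]
    have := θ''n (η (‖x‖ ^ 2 + z ^ 2) / δ - 1)
    positivity
  have hneg : ∀ x z, 0 < z → -(M * z) ≤ Mop N s Ψ (x, z) := fun x z hz => by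
    rcases le_total 1 (‖x‖ ^ 2 + z ^ 2) with h | h
    · exact le_trans (by simpa using mul_nonneg hM0 hz.le) (hpos1 x z hz h)
    · rw [hMop]
      have h0 : 0 ≤ ‖x‖ ^ 2 + z ^ 2 := by positivity
      have h1 := neg_le_of_abs_le (hM _ ⟨h0, h⟩)
      have h2 := θ''n (η (‖x‖ ^ 2 + z ^ 2) / δ - 1)
      have h3 := θ'n (η (‖x‖ ^ 2 + z ^ 2) / δ - 1)
      have h4 := θ'1 (η (‖x‖ ^ 2 + z ^ 2) / δ - 1)
      have h5 : -M ≤ θ' (η (‖x‖ ^ 2 + z ^ 2) / δ - 1) * (4 * ((‖x‖ ^ 2 + z ^ 2) *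
        η'' (‖x‖ ^ 2 + z ^ 2) + (k + 1) * η' (‖x‖ ^ 2 + z ^ 2))) := by
        have := mul_le_mul_of_nonneg_left h1 h3
        nlinarith
      have h6 : 0 ≤ 4 * (‖x‖ ^ 2 + z ^ 2) *
        (θ'' (η (‖x‖ ^ 2 + z ^ 2) / δ - 1) * η' (‖x‖ ^ 2 + z ^ 2) ^ 2 / δ) := by positivity
      nlinarith
  obtain ⟨mR, hmR⟩ := exists_bound_integral_closedBall hs hs1 hv hw hv0 R
  have hmR0 : 0 ≤ mR := (hI0 1 one_pos R).trans (hmR 1 ⟨one_pos, le_rfl⟩)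
  obtain ⟨K, hK⟩ := isCompact_Icc (a := (0 : ℝ)) (b := R ^ 2 + 1) |>.exists_bound_of_continuousOn
    (f := g') (continuous_iff_continuousAt.2 fun t => (hgd' t).continuousAt).continuousOn
  have hK0 : 0 ≤ K := (norm_nonneg _).trans (hK 0 ⟨le_rfl, by positivity⟩)
  set W := fun z => z * deriv (slice v Ψ) z - 2 * s * slice v Ψ z -
      2 * z * slice v (fun q => fderiv ℝ Ψ q (0, 1)) z with hW
  have hWfar : W (R + 1) = 0 := by
    have h1 : ∀ x z, R < z → Ψ (x, z) = 0 := fun x z hz => by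
      refine hR _ ?_
      simp only [sub_zero]
      nlinarith [sq_nonneg ‖x‖]
    have h2 : slice v Ψ =ᶠ[𝓝 (R + 1)] fun _ => 0 := by
      filter_upwards [Ioi_mem_nhds (lt_add_one R)] with z hz
      simp [slice, h1 _ z hz]
    have h3 : ∀ x, fderiv ℝ Ψ (x, R + 1) (0, 1) = 0 := fun x => by
      have : Ψ =ᶠ[𝓝 (x, R + 1)] fun _ => 0 := by
        filter_upwards [(isOpen_Ioi.preimage continuous_snd).mem_nhds
          (show (x, R + 1) ∈ Prod.snd ⁻¹' Ioi R from lt_add_one R)] with q hq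
        exact h1 q.1 q.2 hq
      rw [this.fderiv_eq]
      simp
    have h4 : slice v (fun q => fderiv ℝ Ψ q (0, 1)) (R + 1) = 0 := by simp [slice, h3]
    simp only [hW]
    rw [h2.deriv_eq, h2.self_of_nhds, h4]
    simp
  have hWz : ∀ z ∈ Ioc (0 : ℝ) 1, -(M * m) ≤ W z := fun z hz => by
    have h1 := flux_sub_le (m := M * m) hv hw cΨ hk hΨk hz.1 hz.2 fun y hy => by
      have hy0 : 0 < y := hz.1.trans_le hy.1
      refine le_trans ?_ (neg_mul_le_slice (M := M * y) (R := 1) hv hv0 (cΨ.Mop s).continuous hk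
        (fun x hx z => Mop_eq_zero_of_notMem s hk.isClosed hΨk hx z) hy0
        (fun x _ => hneg x y hy0) (fun x hx => hpos1 x y hy0 (by nlinarith [sq_nonneg y])))
      rw [neg_le_neg_iff]
      refine mul_le_mul (mul_le_of_le_one_right hM0 hy.2) (hm y ⟨hy0, hy.2⟩) (hI0 y hy0 1) hM0
    have h2 := flux_sub_le (m := 0) hv hw cΨ hk hΨk one_pos (show 1 ≤ R + 1 by linarith)
      fun y hy => by
      have hy0 : 0 < y := one_pos.trans_le hy.1
      rw [neg_zero]
      exact slice_nonneg hv0 hy0 fun x => hpos1 x y hy0 (by nlinarith [sq_nonneg ‖x‖, hy.1])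
    have h3 : W 1 - W z ≤ M * m * (1 - z) := h1
    have h4 : W (R + 1) - W 1 ≤ 0 * (R + 1 - 1) := h2
    have h5 : 0 ≤ M * m * z := mul_nonneg (mul_nonneg hM0 hm0) hz.1.le
    linarith
  have hE : ∀ z ∈ Ioc (0 : ℝ) 1, |slice v (fun q => fderiv ℝ Ψ q (0, 1)) z| ≤ K * (2 * z) * mR :=
    fun z hz => by
    refine (abs_slice_le hv hv0 (fun x hx z => fderiv_eq_zero_of_notMem hk.isClosed hΨk (0, 1) hx z)
      hz.1 (M := K * (2 * z)) fun x => ?_).trans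
      (mul_le_mul_of_nonneg_left (hmR z hz) (mul_nonneg hK0 (by linarith [hz.1])))
    by_cases hx : x ∈ closedBall (0 : Euc N) R
    · rw [hΨdef, fderiv_radial 0 hgd hP (x, z) (0, 1)]
      simp only [sub_zero, inner_zero_right, mul_zero, zero_add, mul_one]
      rw [abs_mul, abs_of_pos (show 0 < 2 * z by linarith [hz.1])]
      have hx' : ‖x‖ ≤ R := by simpa using hx
      refine mul_le_mul_of_nonneg_right (hK _ ⟨by positivity, ?_⟩) (by linarith [hz.1])
      have := pow_le_one₀ (n := 2) hz.1.le hz.2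
      nlinarith [norm_nonneg x]
    · rw [fderiv_eq_zero_of_notMem hk.isClosed hΨk (0, 1) hx z, abs_zero]
      exact mul_nonneg hK0 (by linarith [hz.1])
  have hB := fun z (hz : z ∈ Ioc (0 : ℝ) 1) => le_of_flux_inequality (K := 4 * K * mR)
    (c := M * m) hs hs1 (by positivity)
    (fun z hz => hasDerivAt_slice hv cΨ hk hΨk hz.1) (fun z hz => by
      have h1 := hWz z hz
      have h2 := mul_le_mul_of_nonneg_left (hE z hz) hz.1.le
      have h4 := mul_le_mul_of_nonneg_left
        (neg_abs_le (slice v (fun q => fderiv ℝ Ψ q (0, 1)) z)) hz.1.le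
      have h3 : W z = z * deriv (slice v Ψ) z - 2 * s * slice v Ψ z -
        2 * z * slice v (fun q => fderiv ℝ Ψ q (0, 1)) z := rfl
      linarith) hz
  set ζ : Euc N → ℝ := fun x => Ψ (x, 0) with hζ
  have cζ : ContDiff ℝ ∞ ζ := cΨ.comp (contDiff_id.prodMk contDiff_const)
  have hζc : HasCompactSupport ζ := HasCompactSupport.intro hk fun x hx => hΨk x hx 0
  have hdiff : ∀ z ∈ Ioc (0 : ℝ) 1, ∀ x, |ζ x - Ψ (x, z)| ≤ K * z ^ 2 := fun z hz x => by
    by_cases hx : x ∈ closedBall (0 : Euc N) R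
    · have hx' : ‖x‖ ≤ R := by simpa using hx
      have hz2 := pow_le_one₀ (n := 2) hz.1.le hz.2
      have hxR : ‖x‖ ^ 2 ≤ R ^ 2 := by nlinarith [norm_nonneg x]
      have := (convex_Icc (0 : ℝ) (R ^ 2 + 1)).norm_image_sub_le_of_norm_hasDerivWithin_le
        (fun t _ => (hgd t).hasDerivWithinAt) hK
        (x := ‖x‖ ^ 2 + z ^ 2) (y := ‖x‖ ^ 2) ⟨by positivity, by linarith⟩
        ⟨by positivity, by linarith⟩
      simp only [hζ, hΨdef, sub_zero]
      simpa using this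
    · simp only [hζ]
      rw [hΨk x hx, hΨk x hx, sub_zero, abs_zero]
      positivity
  have hle : ∀ z ∈ Ioc (0 : ℝ) 1, ∫ x, v (x, z) * ζ x ≤ M * m / (2 * s) + z ^ (2 * s) *
      (slice v Ψ 1 - M * m / (2 * s) + 4 * K * mR / (2 - 2 * s)) + K * z ^ 2 * mR := fun z hz => by
    have i1 := integrable_slice (Ψ := fun q => ζ q.1) hv (cζ.continuous.comp continuous_fst) hk
      (fun x hx _ => hΨk x hx 0) hz.1
    have i2 := integrable_slice hv cΨ.continuous hk hΨk hz.1
    have h1 := abs_slice_le (Ψ := fun q => ζ q.1 - Ψ (q.1, z)) (R := R) hv hv0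
      (fun x hx y => by simp only [hζ]; rw [hΨk x hx, hΨk x hx, sub_zero]) hz.1 (hdiff z hz)
    have h2 : slice v (fun q => ζ q.1 - Ψ (q.1, z)) z = (∫ x, v (x, z) * ζ x) - slice v Ψ z := by
      unfold slice
      rw [← integral_sub i1 i2]
      congr 1
      funext x
      ring
    rw [h2] at h1
    have h3 := mul_le_mul_of_nonneg_left (hmR z hz) (show 0 ≤ K * z ^ 2 by positivity)
    linarith [hB z hz, le_abs_self ((∫ x, v (x, z) * ζ x) - slice v Ψ z)]
  refine ⟨ζ, cζ.continuous, hζc, fun x => mul_nonneg hδ.le (θn _), fun x hx => ?_, ?_⟩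
  · have h1 : (1 : ℝ) ≤ ‖x‖ ^ 2 := one_le_pow₀ hx
    have h2 : η (‖x‖ ^ 2) = ‖x‖ ^ (-((N : ℝ) + 2 * s)) := by
      rw [η1 _ h1, ← Real.rpow_natCast, ← Real.rpow_mul (norm_nonneg x)]
      congr 1
      simp only [hkdef]
      push_cast
      ring
    have h3 := mul_le_mul_of_nonneg_left (θl (η (‖x‖ ^ 2) / δ - 1)) hδ.le
    have h4 : δ * (η (‖x‖ ^ 2) / δ - 1 - 1) = η (‖x‖ ^ 2) - 2 * δ := by
      field_simp
      ring
    have h5 : ζ x = δ * θ (η (‖x‖ ^ 2) / δ - 1) := by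
      simp [hζ, hΨdef, hg]
    rw [h5, ← h2, ← h4]
    exact h3
  · have ht : Tendsto (fun z : ℝ => M * m / (2 * s) + z ^ (2 * s) *
        (slice v Ψ 1 - M * m / (2 * s) + 4 * K * mR / (2 - 2 * s)) + K * z ^ 2 * mR) (𝓝[>] 0)
        (𝓝 (M * m / (2 * s))) := by
      have hc : ContinuousAt (fun z : ℝ => M * m / (2 * s) + z ^ (2 * s) *
        (slice v Ψ 1 - M * m / (2 * s) + 4 * K * mR / (2 - 2 * s)) + K * z ^ 2 * mR) 0 :=
        ((continuousAt_const.add ((Real.continuousAt_rpow_const 0 (2 * s)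
          (Or.inr (by linarith))).mul continuousAt_const))).add (by fun_prop)
      have := hc.tendsto.mono_left (nhdsWithin_le_nhds (s := Ioi 0))
      simpa [Real.zero_rpow (show 2 * s ≠ 0 by linarith)] using this
    refine le_of_tendsto_of_tendsto (hμ ζ cζ hζc) ht ?_
    filter_upwards [Ioc_mem_nhdsGT one_pos] with z hz using hle z hz

theorem lintegral_rpow_lt_top (hs : 0 < s) {μ : Measure (Euc N)} [IsLocallyFiniteMeasure μ] {C : ℝ}
    (hC : ∀ δ, 0 < δ → ∃ ζ : Euc N → ℝ, Continuous ζ ∧ HasCompactSupport ζ ∧ (∀ x, 0 ≤ ζ x) ∧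
      (∀ x, 1 ≤ ‖x‖ → ‖x‖ ^ (-((N : ℝ) + 2 * s)) - 2 * δ ≤ ζ x) ∧ ∫ x, ζ x ∂μ ≤ C) :
    ∫⁻ x : Euc N, ENNReal.ofReal ((1 + ‖x‖) ^ (-((N : ℝ) + 2 * s))) ∂μ < ⊤ := by
  choose ζ ζc ζs ζ0 ζl ζi using fun n : ℕ => hC (1 / ((n : ℝ) + 1)) (by positivity)
  have hk : 0 < (N : ℝ) + 2 * s := by positivity
  have hfatou : ∫⁻ x, liminf (fun n => ENNReal.ofReal (ζ n x)) atTop ∂μ ≤ ENNReal.ofReal C := by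
    refine (lintegral_liminf_le fun n => (ζc n).measurable.ennreal_ofReal).trans ?_
    refine liminf_le_of_le (by isBoundedDefault) fun b hb => ?_
    obtain ⟨n, hn⟩ := hb.exists
    refine hn.trans ?_
    rw [← ofReal_integral_eq_lintegral_ofReal ((ζc n).integrable_of_hasCompactSupport (ζs n))
      (ae_of_all _ (ζ0 n))]
    exact ENNReal.ofReal_le_ofReal (ζi n)
  have hpt : ∀ x : Euc N, ENNReal.ofReal ((1 + ‖x‖) ^ (-((N : ℝ) + 2 * s))) ≤
      (closedBall (0 : Euc N) 1).indicator (fun _ => 1) x +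
        liminf (fun n => ENNReal.ofReal (ζ n x)) atTop := fun x => by
    rcases le_total ‖x‖ 1 with hx | hx
    · refine le_add_right ?_
      rw [indicator_of_mem (by simpa using hx)]
      refine ENNReal.ofReal_le_one.2 (Real.rpow_le_one_of_one_le_of_nonpos ?_ (by linarith))
      linarith [norm_nonneg x]
    · refine le_add_left ?_
      have h1 : (1 + ‖x‖) ^ (-((N : ℝ) + 2 * s)) ≤ ‖x‖ ^ (-((N : ℝ) + 2 * s)) :=
        Real.rpow_le_rpow_of_nonpos (by linarith) (by linarith) (by linarith)
      have h2 : Tendsto (fun n : ℕ => ENNReal.ofReal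
          (‖x‖ ^ (-((N : ℝ) + 2 * s)) - 2 * (1 / ((n : ℝ) + 1)))) atTop
          (𝓝 (ENNReal.ofReal (‖x‖ ^ (-((N : ℝ) + 2 * s))))) := by
        refine (ENNReal.continuous_ofReal.tendsto _).comp ?_
        simpa using (tendsto_one_div_add_atTop_nhds_zero_nat (𝕜 := ℝ)).const_mul 2 |>.const_sub
          (‖x‖ ^ (-((N : ℝ) + 2 * s)))
      refine (ENNReal.ofReal_le_ofReal h1).trans ?_
      rw [← h2.liminf_eq]
      exact liminf_le_liminf (Eventually.of_forall fun n => ENNReal.ofReal_le_ofReal (ζl n x hx))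
  refine (lintegral_mono hpt).trans_lt ?_
  rw [lintegral_add_left (measurable_const.indicator measurableSet_closedBall),
    lintegral_indicator measurableSet_closedBall]
  simp only [lintegral_const, Measure.restrict_apply_univ, one_mul]
  exact ENNReal.add_lt_top.2 ⟨(isCompact_closedBall _ _).measure_lt_top,
    hfatou.trans_lt ENNReal.ofReal_lt_top⟩

end

/-- Trace theorem, existence part: a nonnegative locally integrable
distributional solution of `div(z^{1-2s}∇u) = 0` in the half-space is (a.e. equal to)
a smooth function admitting a nonnegative Radon-measure boundary trace `μ` with
`∫ (1+|x|)^{-N-2s} dμ < ∞`. -/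
theorem stmt0 (N : ℕ) (hN : 1 ≤ N) (s : ℝ) (hs : s ∈ Set.Ioo (0:ℝ) 1)
    (u : Euc N × ℝ → ℝ)
    (hloc : LocallyIntegrableOn u {q : Euc N × ℝ | 0 < q.2})
    (hpos : ∀ q : Euc N × ℝ, 0 < q.2 → 0 ≤ u q)
    (hweak : ∀ φ : Euc N × ℝ → ℝ, ContDiff ℝ (⊤ : ℕ∞) φ → HasCompactSupport φ →
      tsupport φ ⊆ {q : Euc N × ℝ | 0 < q.2} →
      ∫ q in {q : Euc N × ℝ | 0 < q.2}, u q * CSop N s φ q = 0) :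
    ∃ (v : Euc N × ℝ → ℝ) (μ : Measure (Euc N)),
      IsLocallyFiniteMeasure μ ∧
      (∀ᵐ q ∂(volume.restrict {q : Euc N × ℝ | 0 < q.2}), u q = v q) ∧
      ContDiffOn ℝ (⊤ : ℕ∞) v {q : Euc N × ℝ | 0 < q.2} ∧
      (∀ ζ : Euc N → ℝ, ContDiff ℝ (⊤ : ℕ∞) ζ → HasCompactSupport ζ →
        Tendsto (fun z : ℝ => ∫ x : Euc N, v (x, z) * ζ x) (𝓝[>] (0:ℝ))
          (𝓝 (∫ x, ζ x ∂μ))) ∧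
      (∫⁻ x : Euc N, ENNReal.ofReal ((1 + ‖x‖) ^ (-((N:ℝ) + 2*s))) ∂μ) < ⊤ := by
  obtain ⟨v, hv, hv0, huv⟩ := (weakSol_of_CSop hloc hweak).exists_smooth hs.1 hpos
  have hw : WeakSol N s v := by
    refine ⟨hv.continuousOn.locallyIntegrableOn (isOpen_halfSpace N).measurableSet,
      fun F hF hFc hFs => ?_⟩
    refine Eq.trans (integral_congr_ae ?_) ((weakSol_of_CSop hloc hweak).2 F hF hFc hFs)
    filter_upwards [huv] with q hq
    rw [hq]
  obtain ⟨μ, hμ, htr⟩ := exists_trace_measure hs.1 hs.2 hv hw hv0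
  obtain ⟨C, hC⟩ := exists_bound_integral_truncation hs.1 hs.2 hv hw hv0 htr
  exact ⟨v, μ, hμ, huv, hv, htr, lintegral_rpow_lt_top hs.1 hC⟩
end

section
/- Let N ≥ 1 be an integer, s ∈ (0,1) with N > 2s, and p ≥ N/(N-2s). Then the set E_1 of self-similar solutions of the lifted fractional Emden–Fowler equation reduces to {0}: every u ∈ C(cl(ℝ^{N+1}_+)∖{0}) ∩ C²(ℝ^{N+1}_+) that is positively homogeneous of degree -2s/(p-1), satisfies div(z^{1-2s}∇u) = 0 in ℝ^{N+1}_+ and ∂_{ν^s}u(x,0) + |u(x,0)|^{p-1}u(x,0) = 0 for every x ∈ ℝ^N∖{0}, is identically zero. -/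
open MeasureTheory Filter Topology Set Metric Asymptotics

lemma second_deriv_nonneg_of_isLocalMin {h h' : ℝ → ℝ} {h'' : ℝ}
    (h1 : ∀ᶠ t in 𝓝 (0:ℝ), HasDerivAt h (h' t) t) (h2 : HasDerivAt h' h'' 0)
    (hmin : IsLocalMin h 0) : h' 0 = 0 ∧ 0 ≤ h'' := by
  have h0 : h' 0 = 0 := hmin.hasDerivAt_eq_zero h1.self_of_nhds
  refine ⟨h0, ?_⟩
  by_contra! hneg
  have hd : deriv h =ᶠ[𝓝 0] h' := h1.mono fun t ht => ht.deriv
  have hdd : deriv (deriv h) 0 = h'' := by rw [hd.deriv_eq, h2.deriv]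
  have hmax : IsLocalMax h 0 :=
    isLocalMax_of_deriv_deriv_neg (by rw [hdd]; exact hneg) (by rw [hd.self_of_nhds, h0])
      h1.self_of_nhds.continuousAt
  have hconst : h =ᶠ[𝓝 0] fun _ => h 0 := by
    filter_upwards [hmin, hmax] with t ht1 ht2 using le_antisymm ht2 ht1
  have hz : deriv (deriv h) 0 = 0 := by
    rw [hconst.deriv.deriv_eq]
    simp
  linarith

lemma line_derivs {N : ℕ} {u : Euc N × ℝ → ℝ} {q : Euc N × ℝ} (hu : ContDiffAt ℝ 2 u q)
    (v : Euc N × ℝ) :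
    (∀ᶠ t in 𝓝 (0:ℝ), HasDerivAt (fun t : ℝ => u (q + t • v)) (fderiv ℝ u (q + t • v) v) t) ∧
      HasDerivAt (fun t : ℝ => fderiv ℝ u (q + t • v) v) (d2 u q v) 0 := by
  have hl : ∀ t : ℝ, HasDerivAt (fun t : ℝ => q + t • v) v t := fun t => by
    simpa using ((hasDerivAt_id t).smul_const v).const_add q
  have hc : Tendsto (fun t : ℝ => q + t • v) (𝓝 0) (𝓝 q) := by
    simpa using (hl 0).continuousAt.tendsto
  constructor
  · have hev : ∀ᶠ w in 𝓝 q, DifferentiableAt ℝ u w :=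
      (hu.eventually (by simp)).mono fun w hw => hw.differentiableAt (by simp)
    filter_upwards [hc.eventually hev] with t ht
    exact ht.hasFDerivAt.comp_hasDerivAt t (hl t)
  · have hd : DifferentiableAt ℝ (fun w => fderiv ℝ u w v) q :=
      ((hu.fderiv_right (m := 1) (by norm_num)).differentiableAt (by simp)).clm_apply
        (differentiableAt_const v)
    have h3 : HasFDerivAt (fun w => fderiv ℝ u w v) (fderiv ℝ (fun w => fderiv ℝ u w v) q)
        (q + (0:ℝ) • v) := by simpa using hd.hasFDerivAt
    exact h3.comp_hasDerivAt (0:ℝ) (hl 0)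

lemma hasDerivAt_quadratic_rpow (R b γ t : ℝ) (h : 0 < R + 2*b*t + t^2) :
    HasDerivAt (fun t : ℝ => (R + 2*b*t + t^2) ^ γ)
      (γ * (R + 2*b*t + t^2) ^ (γ-1) * (2*b + 2*t)) t := by
  have h1 : HasDerivAt (fun t : ℝ => R + 2*b*t + t^2) (2*b + 2*t) t := by
    simpa using (((hasDerivAt_id t).const_mul (2*b)).const_add R).fun_add (hasDerivAt_pow 2 t)
  convert h1.rpow_const (p := γ) (Or.inl h.ne') using 1
  ring

lemma hasDerivAt_quadratic_rpow_deriv (R b γ : ℝ) (h : 0 < R) :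
    HasDerivAt (fun t : ℝ => γ * (R + 2*b*t + t^2) ^ (γ-1) * (2*b + 2*t))
      (4*γ*(γ-1)*R^(γ-2)*b^2 + 2*γ*R^(γ-1)) 0 := by
  have h1 : HasDerivAt (fun t : ℝ => 2*b + 2*t) 2 0 := by
    simpa using ((hasDerivAt_id (0:ℝ)).const_mul 2).const_add (2*b)
  have h2 := ((hasDerivAt_quadratic_rpow R b (γ-1) 0 (by simpa using h)).const_mul γ).mul h1
  refine h2.congr_deriv ?_
  have e : γ - 1 - 1 = γ - 2 := by ring
  simp only [e, mul_zero, add_zero, ne_eq, OfNat.ofNat_ne_zero, not_false_eq_true, zero_pow]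
  ring

lemma eventually_quadratic_pos (R b : ℝ) (h : 0 < R) : ∀ᶠ t in 𝓝 (0:ℝ), 0 < R + 2*b*t + t^2 := by
  have hc : Continuous fun t : ℝ => R + 2*b*t + t^2 := by fun_prop
  exact hc.continuousAt.eventually (lt_mem_nhds (by simpa using h))

/-- The barrier `ρ^{-α} + δ z^{2s} ρ^{-α-2s}`. -/
noncomputable def barrier {N : ℕ} (s α δ : ℝ) (q : Euc N × ℝ) : ℝ :=
  (‖q.1‖^2 + q.2^2) ^ (-α/2) + δ * q.2 ^ (2*s) * (‖q.1‖^2 + q.2^2) ^ (-α/2 - s)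

lemma sq_norm_add_sq_pos {N : ℕ} {q : Euc N × ℝ} (hq : q ≠ 0) : 0 < ‖q.1‖^2 + q.2^2 := by
  by_contra! h
  have h1 : ‖q.1‖ = 0 := by nlinarith [sq_nonneg ‖q.1‖, sq_nonneg q.2]
  have h2 : q.2 = 0 := by nlinarith [sq_nonneg ‖q.1‖, sq_nonneg q.2]
  exact hq (Prod.ext (norm_eq_zero.mp h1) h2)

lemma barrier_pos {N : ℕ} {s α δ : ℝ} (hδ : 0 ≤ δ) {q : Euc N × ℝ} (hq : q ≠ 0)
    (hz : 0 ≤ q.2) : 0 < barrier s α δ q := by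
  have h := sq_norm_add_sq_pos hq
  have h1 := Real.rpow_pos_of_pos h (-α/2)
  have h2 := Real.rpow_pos_of_pos h (-α/2 - s)
  have h3 := Real.rpow_nonneg hz (2*s)
  unfold barrier
  positivity

lemma barrier_smul {N : ℕ} (s α δ : ℝ) {l : ℝ} (hl : 0 < l) {q : Euc N × ℝ} (hz : 0 ≤ q.2) :
    barrier s α δ (l • q.1, l * q.2) = l ^ (-α) * barrier s α δ q := by
  have hR : 0 ≤ ‖q.1‖^2 + q.2^2 := by positivity
  have e : ‖l • q.1‖^2 + (l * q.2)^2 = l^2 * (‖q.1‖^2 + q.2^2) := by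
    rw [norm_smul, Real.norm_eq_abs, mul_pow, sq_abs]; ring
  have hp : ∀ c : ℝ, (l^2) ^ c = l ^ (2*c) := fun c => by
    rw [← Real.rpow_natCast l 2, ← Real.rpow_mul hl.le]; norm_num
  simp only [barrier, e]
  rw [Real.mul_rpow (by positivity) hR, Real.mul_rpow (by positivity) hR,
    Real.mul_rpow hl.le hz, hp, hp]
  have e1 : 2 * (-α/2) = -α := by ring
  have e2 : l ^ (-α) = l ^ (2*s) * l ^ (2 * (-α/2 - s)) := by
    rw [← Real.rpow_add hl]; congr 1; ring
  rw [e1, mul_add, e2]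
  ring

lemma continuousOn_barrier {N : ℕ} {s α δ : ℝ} (hs : 0 < s) :
    ContinuousOn (barrier (N := N) s α δ) {0}ᶜ := by
  have hc : Continuous fun q : Euc N × ℝ => ‖q.1‖^2 + q.2^2 := by fun_prop
  have h1 : ∀ c : ℝ, ContinuousOn (fun q : Euc N × ℝ => (‖q.1‖^2 + q.2^2) ^ c) {0}ᶜ := fun c =>
    hc.continuousOn.rpow_const fun q hq => Or.inl (sq_norm_add_sq_pos hq).ne'
  have h2 : Continuous fun q : Euc N × ℝ => q.2 ^ (2*s) :=
    continuous_snd.rpow_const fun q => Or.inr (by positivity)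
  exact (h1 _).add ((continuousOn_const.mul h2.continuousOn).mul (h1 _))

lemma barrier_add_single {N : ℕ} (s α δ : ℝ) (q : Euc N × ℝ) (i : Fin N) (t : ℝ) :
    barrier s α δ (q + t • ((EuclideanSpace.single i (1:ℝ), (0:ℝ)) : Euc N × ℝ)) =
      (‖q.1‖^2 + q.2^2 + 2 * q.1 i * t + t^2) ^ (-α/2) +
        δ * q.2 ^ (2*s) * (‖q.1‖^2 + q.2^2 + 2 * q.1 i * t + t^2) ^ (-α/2 - s) := by
  have e : ‖q.1 + t • EuclideanSpace.single i (1:ℝ)‖^2 = ‖q.1‖^2 + 2 * q.1 i * t + t^2 := by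
    rw [norm_add_sq_real, inner_smul_right, EuclideanSpace.inner_single_right, norm_smul]
    simp
    ring
  have e' : ‖q.1‖^2 + 2 * q.1 i * t + t^2 + q.2^2 = ‖q.1‖^2 + q.2^2 + 2 * q.1 i * t + t^2 := by
    ring
  simp only [barrier, Prod.fst_add, Prod.snd_add, Prod.smul_fst, Prod.smul_snd, smul_eq_mul,
    mul_zero, add_zero, e, e']

lemma barrier_add_vertical {N : ℕ} (s α δ : ℝ) (q : Euc N × ℝ) (t : ℝ) :
    barrier s α δ (q + t • (((0 : Euc N), (1:ℝ)) : Euc N × ℝ)) =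
      (‖q.1‖^2 + q.2^2 + 2 * q.2 * t + t^2) ^ (-α/2) +
        δ * (q.2 + t) ^ (2*s) * (‖q.1‖^2 + q.2^2 + 2 * q.2 * t + t^2) ^ (-α/2 - s) := by
  have e' : ‖q.1‖^2 + (q.2 + t)^2 = ‖q.1‖^2 + q.2^2 + 2 * q.2 * t + t^2 := by ring
  simp only [barrier, Prod.fst_add, Prod.snd_add, Prod.smul_fst, Prod.smul_snd, smul_eq_mul,
    smul_zero, mul_one, add_zero, e']

/-- A solution cannot touch a positive multiple of the barrier from below at an interior point,
because the barrier is a strict supersolution. -/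
lemma not_isLocalMin_barrier_sub {N : ℕ} {s α δ M : ℝ} (hs : 0 < s) (hα : 0 < α)
    (hαN : α ≤ N - 2*s) (hδ : 0 < δ) (hM : 0 < M) {u : Euc N × ℝ → ℝ} {q : Euc N × ℝ}
    (hz : 0 < q.2) (hu : ContDiffAt ℝ 2 u q) (hop : CSop N s u q = 0)
    (hmin : IsLocalMin (fun w => M * barrier s α δ w - u w) q) : False := by
  obtain ⟨x, z⟩ := q
  dsimp only at hz
  set R : ℝ := ‖x‖^2 + z^2 with hR
  have hRpos : 0 < R := by positivity
  have hline : ∀ v : Euc N × ℝ,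
      IsLocalMin (fun t : ℝ => M * barrier s α δ ((x, z) + t • v) - u ((x, z) + t • v)) 0 := by
    intro v
    have hc : ContinuousAt (fun t : ℝ => (x, z) + t • v) 0 := by fun_prop
    have hmin' : IsLocalMin (fun w => M * barrier s α δ w - u w) ((x, z) + (0:ℝ) • v) := by
      simpa using hmin
    exact IsMinFilter.comp_tendsto (g := fun t : ℝ => (x, z) + t • v) hmin' hc.tendsto
  have hx : ∀ i : Fin N, d2 u (x, z) (EuclideanSpace.single i (1:ℝ), (0:ℝ)) ≤
      M * ((4*(-α/2)*(-α/2-1)*R^(-α/2-2)*(x i)^2 + 2*(-α/2)*R^(-α/2-1)) + δ * z^(2*s) *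
        (4*(-α/2-s)*(-α/2-s-1)*R^(-α/2-s-2)*(x i)^2 + 2*(-α/2-s)*R^(-α/2-s-1))) := by
    intro i
    obtain ⟨hu1, hu2⟩ := line_derivs hu (EuclideanSpace.single i (1:ℝ), (0:ℝ))
    have hb := hline (EuclideanSpace.single i (1:ℝ), (0:ℝ))
    simp only [barrier_add_single] at hb
    have := (second_deriv_nonneg_of_isLocalMin (hu1.mp <| (eventually_quadratic_pos R (x i) hRpos).mono
      fun t ht hut => (((hasDerivAt_quadratic_rpow R (x i) (-α/2) t ht).add
        ((hasDerivAt_quadratic_rpow R (x i) (-α/2-s) t ht).const_mul (δ * z^(2*s)))).const_mul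
          M).sub hut)
      ((((hasDerivAt_quadratic_rpow_deriv R (x i) (-α/2) hRpos).add
        ((hasDerivAt_quadratic_rpow_deriv R (x i) (-α/2-s) hRpos).const_mul
          (δ * z^(2*s)))).const_mul M).sub hu2) hb).2
    linarith
  obtain ⟨hv1, hv2⟩ : fderiv ℝ u (x, z) ((0 : Euc N), (1:ℝ)) =
      M * ((-α/2) * R^(-α/2-1) * (2*z) + δ * (2*s*z^(2*s-1) * R^(-α/2-s) +
        z^(2*s) * ((-α/2-s)*R^(-α/2-s-1)*(2*z)))) ∧
      d2 u (x, z) ((0 : Euc N), (1:ℝ)) ≤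
      M * ((4*(-α/2)*(-α/2-1)*R^(-α/2-2)*z^2 + 2*(-α/2)*R^(-α/2-1)) + δ *
        (2*s*(2*s-1)*z^(2*s-2)*R^(-α/2-s) + 2*(2*s*z^(2*s-1)*((-α/2-s)*R^(-α/2-s-1)*(2*z))) +
        z^(2*s) * (4*(-α/2-s)*(-α/2-s-1)*R^(-α/2-s-2)*z^2 + 2*(-α/2-s)*R^(-α/2-s-1)))) := by
    obtain ⟨hu1, hu2⟩ := line_derivs hu ((0 : Euc N), (1:ℝ))
    have hb := hline ((0 : Euc N), (1:ℝ))
    simp only [barrier_add_vertical] at hb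
    have hzt : ∀ᶠ t in 𝓝 (0:ℝ), 0 < z + t := by
      have hc : Continuous fun t : ℝ => z + t := by fun_prop
      exact hc.continuousAt.eventually (lt_mem_nhds (by simpa using hz))
    have hpow : ∀ (c t : ℝ), 0 < z + t →
        HasDerivAt (fun t : ℝ => (z + t)^c) (c * (z + t)^(c-1)) t := by
      intro c t ht
      have h1 : HasDerivAt (fun t : ℝ => z + t) 1 t := (hasDerivAt_id t).const_add z
      simpa using h1.rpow_const (p := c) (Or.inl ht.ne')
    have hz0 : 0 < z + 0 := by simpa using hz
    have hR0 : 0 < R + 2*z*0 + 0^2 := by simpa using hRpos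
    have key := second_deriv_nonneg_of_isLocalMin (hu1.mp <|
      ((eventually_quadratic_pos R z hRpos).and hzt).mono
      fun t ht hut => (((hasDerivAt_quadratic_rpow R z (-α/2) t ht.1).add
        (((hpow (2*s) t ht.2).const_mul δ).mul
          (hasDerivAt_quadratic_rpow R z (-α/2-s) t ht.1))).const_mul M).sub hut)
      ((((hasDerivAt_quadratic_rpow_deriv R z (-α/2) hRpos).add
        (((((hpow (2*s-1) 0 hz0).const_mul (2*s)).const_mul δ).mul
          (hasDerivAt_quadratic_rpow R z (-α/2-s) 0 hR0)).add
          (((hpow (2*s) 0 hz0).const_mul δ).mul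
          (hasDerivAt_quadratic_rpow_deriv R z (-α/2-s) hRpos)))).const_mul M).sub hu2) hb
    have e : 2*s - 1 - 1 = 2*s - 2 := by ring
    simp only [e, mul_zero, add_zero, ne_eq, OfNat.ofNat_ne_zero, not_false_eq_true, zero_pow,
      zero_smul] at key
    constructor <;> linarith [key.1, key.2]
  have hsum := Finset.sum_le_sum fun i (_ : i ∈ Finset.univ) => hx i
  have hX : ∑ i : Fin N, (x i)^2 = ‖x‖^2 := by
    rw [EuclideanSpace.norm_sq_eq]; simp
  simp only [← Finset.mul_sum, Finset.sum_add_distrib, hX, Finset.sum_const, Finset.card_univ,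
    Fintype.card_fin, nsmul_eq_mul] at hsum
  have hRp : ∀ c : ℝ, R^(c-1) = R^(c-2) * R ∧ R^c = R^(c-2) * R^2 := fun c => by
    constructor
    · rw [← Real.rpow_add_one hRpos.ne']; congr 1; ring
    · rw [← Real.rpow_natCast R 2, ← Real.rpow_add hRpos]; congr 1; norm_num
  have hZ1 : z^(2*s-1) = z^(2*s-2) * z := by
    rw [← Real.rpow_add_one hz.ne']; congr 1; ring
  have hZ2 : z^(2*s) = z^(2*s-2) * z^2 := by
    rw [← Real.rpow_natCast z 2, ← Real.rpow_add hz]; congr 1; norm_num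
  have hA := Real.rpow_pos_of_pos hRpos (-α/2-2)
  have hB := Real.rpow_pos_of_pos hRpos (-α/2-s-2)
  have hZ := Real.rpow_pos_of_pos hz (2*s-2)
  rw [(hRp (-α/2)).1] at hsum hv1 hv2
  rw [(hRp (-α/2-s)).1, hZ2] at hsum hv1 hv2
  rw [(hRp (-α/2-s)).2, hZ1] at hv1 hv2
  set A := R^(-α/2-2)
  set B := R^(-α/2-s-2)
  set Z := z^(2*s-2)
  have hop' : z * ((∑ i : Fin N, d2 u (x, z) (EuclideanSpace.single i (1:ℝ), (0:ℝ))) +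
      d2 u (x, z) ((0 : Euc N), (1:ℝ))) +
      (1 - 2*s) * fderiv ℝ u (x, z) ((0 : Euc N), (1:ℝ)) = 0 := by
    have hw := Real.rpow_pos_of_pos hz (-(2*s))
    have e : z^(1-2*s) = z^(-(2*s)) * z := by
      rw [← Real.rpow_add_one hz.ne']; congr 1; ring
    simp only [CSop, e] at hop
    apply mul_left_cancel₀ hw.ne'
    linarith
  rw [hv1] at hop'
  have hle := mul_le_mul_of_nonneg_left (add_le_add hsum hv2) hz.le
  have hXR : ‖x‖^2 = R - z^2 := by rw [hR]; ring
  rw [hXR] at hle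
  have hfin : 0 ≤ z * (M * (A * R * (-(α * (N - 2*s - α))) +
      δ * Z * B * R * z^2 * (-((α + 2*s) * (N - α))))) := by
    linear_combination hle - hop'
  have p1 : 0 ≤ A * R * (α * (N - 2*s - α)) :=
    mul_nonneg (by positivity) (mul_nonneg hα.le (by linarith))
  have p2 : 0 < δ * Z * B * R * z^2 * ((α + 2*s) * (N - α)) :=
    mul_pos (by positivity) (mul_pos (by positivity) (by linarith))
  have p3 : 0 < z * (M * (A * R * (α * (N - 2*s - α)) +
      δ * Z * B * R * z^2 * ((α + 2*s) * (N - α)))) := by positivity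
  linarith

/-- A function whose weighted derivative at `0` is negative becomes smaller than its value
at `0`. -/
lemma exists_lt_of_weighted_deriv_tendsto_neg {f f' : ℝ → ℝ} {a L : ℝ}
    (hf : ContinuousOn f (Ici 0)) (hd : ∀ z, 0 < z → HasDerivAt f (f' z) z)
    (hL : Tendsto (fun z : ℝ => z^a * f' z) (𝓝[>] 0) (𝓝 L)) (hneg : L < 0) :
    ∃ z, 0 < z ∧ f z < f 0 := by
  obtain ⟨η, hη, hη'⟩ := mem_nhdsGT_iff_exists_Ioo_subset.mp (hL.eventually (gt_mem_nhds hneg))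
  have hη0 : (0:ℝ) < η := hη
  refine ⟨η/2, by positivity, ?_⟩
  have hanti : StrictAntiOn f (Icc 0 (η/2)) := by
    refine strictAntiOn_of_deriv_neg (convex_Icc _ _) (hf.mono fun z hz => hz.1) fun z hz => ?_
    rw [interior_Icc] at hz
    rw [(hd z hz.1).deriv]
    have h1 : z^a * f' z < 0 := hη' ⟨hz.1, by linarith [hz.2]⟩
    exact neg_of_mul_neg_right h1 (Real.rpow_nonneg hz.1.le a)
  exact hanti ⟨le_rfl, by positivity⟩ ⟨by positivity, le_rfl⟩ (by positivity)

/-- The vertical derivative of the barrier above a boundary point of norm one. -/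
lemma barrier_vertical_deriv {N : ℕ} {s : ℝ} (α δ : ℝ) (hs : s ∈ Ioo (0:ℝ) 1) {x : Euc N}
    (hx : ‖x‖ = 1) : ∃ b' : ℝ → ℝ, (∀ z, 0 < z →
      HasDerivAt (fun z : ℝ => barrier s α δ (x, z)) (b' z) z) ∧
      Tendsto (fun z : ℝ => z^(1-2*s) * b' z) (𝓝[>] 0) (𝓝 (2*s*δ)) := by
  refine ⟨fun z => -α/2 * (1 + 2*0*z + z^2)^(-α/2-1) * (2*0+2*z) +
    (δ * (2*s*z^(2*s-1)) * (1 + 2*0*z + z^2)^(-α/2-s) +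
      δ * z^(2*s) * ((-α/2-s) * (1 + 2*0*z + z^2)^(-α/2-s-1) * (2*0+2*z))), ?_, ?_⟩
  · intro z hz
    have hp : 0 < 1 + 2*0*z + z^2 := by nlinarith [sq_nonneg z]
    have h1 := (hasDerivAt_quadratic_rpow 1 0 (-α/2) z hp).add
      (((Real.hasDerivAt_rpow_const (p := 2*s) (Or.inl hz.ne')).const_mul δ).mul
        (hasDerivAt_quadratic_rpow 1 0 (-α/2-s) z hp))
    have e : (fun z : ℝ => barrier s α δ (x, z)) = fun z => (1 + 2*0*z + z^2)^(-α/2) +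
        δ * z^(2*s) * (1 + 2*0*z + z^2)^(-α/2-s) := by
      funext z
      simp [barrier, hx]
    rw [e]
    exact h1
  · have hP : ∀ c : ℝ, ContinuousAt (fun z : ℝ => (1 + z^2)^c) 0 := fun c =>
      ContinuousAt.rpow_const (by fun_prop) (Or.inl (by norm_num))
    have hQ : ContinuousAt (fun z : ℝ => z^(2-2*s)) 0 :=
      Real.continuousAt_rpow_const _ _ (Or.inr (by linarith [hs.2]))
    have hc : ContinuousAt (fun z : ℝ => -α * (z^(2-2*s) * (1+z^2)^(-α/2-1)) +
        δ * (2*s*(1+z^2)^(-α/2-s) + (-α-2*s) * z^2 * (1+z^2)^(-α/2-s-1))) 0 := by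
      have h1 := hP (-α/2-1)
      have h2 := hP (-α/2-s)
      have h3 := hP (-α/2-s-1)
      fun_prop
    have h0 : (0:ℝ)^(2-2*s) = 0 := Real.zero_rpow (by linarith [hs.2])
    have ht := hc.tendsto.mono_left (nhdsWithin_le_nhds (s := Ioi (0:ℝ)))
    simp only [h0, ne_eq, OfNat.ofNat_ne_zero, not_false_eq_true, zero_pow, add_zero,
      Real.one_rpow, mul_zero, mul_one, zero_add] at ht
    rw [mul_comm δ] at ht
    refine ht.congr' ?_
    filter_upwards [self_mem_nhdsWithin] with z hz
    have hz : 0 < z := hz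
    have e1 : z^(2-2*s) = z^(1-2*s) * z := by
      rw [← Real.rpow_add_one hz.ne']; congr 1; ring
    have e2 : z^(1-2*s) * z^(2*s-1) = 1 := by
      rw [← Real.rpow_add hz]; norm_num
    have e3 : z^(1-2*s) * z^(2*s) = z := by
      rw [← Real.rpow_add hz]; norm_num
    simp only [mul_zero, zero_mul, add_zero, zero_add, e1]
    linear_combination (-2*s*δ*(1+z^2)^(-α/2-s)) * e2 -
      (δ * (-α/2-s) * (1+z^2)^(-α/2-s-1) * 2 * z) * e3

lemma SelfSim.neg_mem {N : ℕ} {s p ε : ℝ} {u : Euc N × ℝ → ℝ} (hu : u ∈ SelfSim N s p ε) :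
    -u ∈ SelfSim N s p ε := by
  obtain ⟨h1, h2, h3, h4, h5⟩ := hu
  have hd : ∀ w v : Euc N × ℝ, fderiv ℝ (-u) w v = -(fderiv ℝ u w v) := fun w v => by
    rw [fderiv_neg]; simp
  have hdd : ∀ q v : Euc N × ℝ, d2 (-u) q v = -d2 u q v := fun q v => by
    simp only [d2, hd, fderiv_fun_neg]; simp
  refine ⟨h1.neg, h2.neg, fun l hl q => by simp [h3 l hl q], fun q hq => ?_, fun x hx => ?_⟩
  · have := h4 q hq
    simp only [CSop, hdd, hd, Finset.sum_neg_distrib] at this ⊢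
    linarith
  · have := (h5 x hx).neg
    simpa only [hd, Pi.neg_apply, abs_neg, mul_neg] using this

theorem SelfSim.nonpos {N : ℕ} {s p : ℝ} (hs : s ∈ Ioo (0:ℝ) 1)
    (h2s : 2*s < N) (hp : (N:ℝ)/((N:ℝ) - 2*s) ≤ p)
    {u : Euc N × ℝ → ℝ} (hu : u ∈ SelfSim N s p 1) {q : Euc N × ℝ} (hq2 : 0 ≤ q.2)
    (hq : q ≠ 0) : u q ≤ 0 := by
  obtain ⟨hcont, hC2, hhom, hop, hflux⟩ := hu
  have hN2 : 0 < (N:ℝ) - 2*s := by linarith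
  have hs0 := hs.1
  have hp' : (N:ℝ) ≤ p * (N - 2*s) := (div_le_iff₀ hN2).mp hp
  have hp1 : 0 < p - 1 := by nlinarith
  set α : ℝ := 2*s/(p-1) with hαdef
  have hα : 0 < α := by positivity
  have hαN : α ≤ N - 2*s := by
    rw [hαdef, div_le_iff₀ hp1]; linarith
  have hhom' : ∀ l : ℝ, 0 < l → ∀ q : Euc N × ℝ, u (l • q.1, l * q.2) = l ^ (-α) * u q := by
    intro l hl q
    rw [hhom l hl q, hαdef, neg_div]
  set K : Set (Euc N × ℝ) := {q | 0 ≤ q.2 ∧ ‖q.1‖^2 + q.2^2 = 1} with hK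
  have hK0 : ∀ q ∈ K, q ≠ 0 := by
    rintro q hq rfl
    simp [hK] at hq
  have hproj : ∀ q : Euc N × ℝ, 0 ≤ q.2 → q ≠ 0 → ∃ l : ℝ, 0 < l ∧ (l • q.1, l * q.2) ∈ K := by
    intro q hz hq
    have hR := sq_norm_add_sq_pos hq
    have hr := Real.sqrt_pos.mpr hR
    refine ⟨(√(‖q.1‖^2 + q.2^2))⁻¹, by positivity, by positivity, ?_⟩
    simp only [norm_smul, Real.norm_eq_abs, mul_pow, sq_abs]
    rw [← mul_add, inv_pow, Real.sq_sqrt hR.le, inv_mul_cancel₀ hR.ne']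
  have hKc : IsCompact K := by
    apply Metric.isCompact_of_isClosed_isBounded
    · exact (isClosed_le continuous_const continuous_snd).inter
        (isClosed_eq (by fun_prop) continuous_const)
    · refine (Metric.isBounded_closedBall (x := (0 : Euc N × ℝ)) (r := 1)).subset ?_
      rintro ⟨x, z⟩ ⟨-, h⟩
      simp only at h
      rw [mem_closedBall_zero_iff, Prod.norm_mk, max_le_iff]
      constructor
      · exact abs_le_one_iff_mul_self_le_one.mpr (by nlinarith [sq_nonneg z]) |> (le_abs_self _).trans
      · exact abs_le_one_iff_mul_self_le_one.mpr (by nlinarith [sq_nonneg ‖x‖])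
  by_contra! hpos
  obtain ⟨l, hl, hlK⟩ := hproj q hq2 hq
  set m : ℝ := u (l • q.1, l * q.2) / 2 with hm
  have hm0 : 0 < m := by
    rw [hm, hhom' l hl]
    have := Real.rpow_pos_of_pos hl (-α)
    positivity
  obtain ⟨δ, hδ, hδ1, hδm⟩ : ∃ δ : ℝ, 0 < δ ∧ δ ≤ 1 ∧ 2*s*δ < m^(p-1) := by
    have hmp := Real.rpow_pos_of_pos hm0 (p-1)
    refine ⟨min 1 (m^(p-1)/(4*s)), by positivity, min_le_left _ _, ?_⟩
    calc 2*s*min 1 (m^(p-1)/(4*s)) ≤ 2*s*(m^(p-1)/(4*s)) := by gcongr; exact min_le_right _ _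
      _ = m^(p-1)/2 := by field_simp; norm_num
      _ < m^(p-1) := by linarith
  have hFc : ContinuousOn (fun q => u q / barrier s α δ q) K :=
    (hcont.mono fun q hq => ⟨hq.1, hK0 q hq⟩).div
      ((continuousOn_barrier hs0).mono fun q hq => hK0 q hq)
      fun q hq => (barrier_pos hδ.le (hK0 q hq) hq.1).ne'
  obtain ⟨q0, hq0K, hmax⟩ := hKc.exists_isMaxOn ⟨_, hlK⟩ hFc
  set M : ℝ := u q0 / barrier s α δ q0 with hMdef
  have hb0 := barrier_pos (s := s) (α := α) hδ.le (hK0 q0 hq0K) hq0K.1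
  have hMu : M * barrier s α δ q0 = u q0 := div_mul_cancel₀ _ hb0.ne'
  have hKle : ∀ q ∈ K, u q ≤ M * barrier s α δ q := fun q hq =>
    (div_le_iff₀ (barrier_pos hδ.le (hK0 q hq) hq.1)).mp (hmax hq)
  have hmM : m ≤ M := by
    have hle2 : barrier s α δ (l • q.1, l * q.2) ≤ 2 := by
      have h1 := hlK.2
      have h2 : (l * q.2) ^ (2*s) ≤ 1 :=
        Real.rpow_le_one hlK.1 (by nlinarith [sq_nonneg ‖l • q.1‖]) (by positivity)
      have h3 := Real.rpow_nonneg hlK.1 (2*s)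
      simp only [barrier]
      simp only at h1 h3
      rw [h1, Real.one_rpow, Real.one_rpow]
      nlinarith
    have h4 : u (l • q.1, l * q.2) / barrier s α δ (l • q.1, l * q.2) ≤ M := hmax hlK
    refine le_trans ?_ h4
    have h5 := barrier_pos (s := s) (α := α) hδ.le (hK0 _ hlK) hlK.1
    have h6 : 0 < u (l • q.1, l * q.2) := by linarith
    exact div_le_div_of_nonneg_left h6.le h5 hle2
  have hM : 0 < M := hm0.trans_le hmM
  have hle : ∀ q : Euc N × ℝ, 0 ≤ q.2 → q ≠ 0 → u q ≤ M * barrier s α δ q := by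
    intro q hz hq
    obtain ⟨l, hl, hlK⟩ := hproj q hz hq
    have h1 := hKle _ hlK
    rw [hhom' l hl, barrier_smul s α δ hl hz] at h1
    exact le_of_mul_le_mul_left (by linarith) (Real.rpow_pos_of_pos hl (-α))
  have hopen : IsOpen {q : Euc N × ℝ | 0 < q.2} := isOpen_lt continuous_const continuous_snd
  rcases hq0K.1.lt_or_eq with hz | hz
  · refine not_isLocalMin_barrier_sub hs0 hα hαN hδ hM hz
      (hC2.contDiffAt (hopen.mem_nhds hz)) (hop q0 hz) ?_
    filter_upwards [hopen.mem_nhds hz] with w hw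
    have hw' : 0 < w.2 := hw
    have := hle w hw'.le (by rintro rfl; simp at hw')
    linarith
  · obtain ⟨x, z⟩ := q0
    simp only at hz
    subst hz
    have hx1 : ‖x‖ = 1 := by
      have := hq0K.2
      simp only [ne_eq, OfNat.ofNat_ne_zero, not_false_eq_true, zero_pow, add_zero] at this
      exact (pow_eq_one_iff_of_nonneg (norm_nonneg x) two_ne_zero).mp this
    have hx0 : x ≠ 0 := by rintro rfl; simp at hx1
    have hne : ∀ z : ℝ, (x, z) ≠ (0 : Euc N × ℝ) := fun z h => hx0 (congrArg Prod.fst h)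
    obtain ⟨b', hb1, hb2⟩ := barrier_vertical_deriv (N := N) α δ hs hx1
    have huM : u (x, 0) = M := by
      rw [← hMu]
      simp [barrier, hx1, Real.zero_rpow (show 2*s ≠ 0 by positivity)]
    have hlim := (hb2.const_mul M).sub (hflux x hx0)
    rw [huM, abs_of_pos hM] at hlim
    have hMp : m^(p-1) ≤ M^(p-1) := Real.rpow_le_rpow hm0.le hmM hp1.le
    have hcz : ContinuousOn (fun z : ℝ => M * barrier s α δ (x, z) - u (x, z)) (Ici 0) := by
      have hi : ContinuousOn (fun z : ℝ => (x, z)) (Ici 0) := by fun_prop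
      exact (continuousOn_const.mul ((continuousOn_barrier hs0).comp hi fun z _ => hne z)).sub
        (hcont.comp hi fun z hz => ⟨hz, hne z⟩)
    have hdz : ∀ z : ℝ, 0 < z → HasDerivAt (fun z : ℝ => M * barrier s α δ (x, z) - u (x, z))
        (M * b' z - fderiv ℝ u (x, z) ((0 : Euc N), (1:ℝ))) z := by
      intro z hz
      have hdu : DifferentiableAt ℝ u (x, z) :=
        (hC2.contDiffAt (hopen.mem_nhds (show 0 < (x, z).2 from hz))).differentiableAt (by simp)
      have hi : HasDerivAt (fun z : ℝ => (x, z)) ((0 : Euc N), (1:ℝ)) z :=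
        (hasDerivAt_const z x).prodMk (hasDerivAt_id z)
      exact ((hb1 z hz).const_mul M).sub (hdu.hasFDerivAt.comp_hasDerivAt z hi)
    obtain ⟨z, hz, hlt⟩ := exists_lt_of_weighted_deriv_tendsto_neg (a := 1 - 2*s)
      (L := M * (2*s*δ) - 1 * M^(p-1) * M) hcz hdz (hlim.congr fun z => by ring) (by nlinarith)
    have := hle (x, z) hz.le (hne z)
    linarith

/-- Theorem A, part 1: if `p ≥ N/(N-2s)` then `E₁ = {0}`. -/
theorem stmt2 (N : ℕ) (hN : 1 ≤ N) (s p : ℝ) (hs : s ∈ Set.Ioo (0:ℝ) 1)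
    (h2s : 2*s < N) (hp : (N:ℝ)/((N:ℝ) - 2*s) ≤ p)
    (u : Euc N × ℝ → ℝ) (hu : u ∈ SelfSim N s p 1) :
    ∀ q : Euc N × ℝ, 0 ≤ q.2 → q ≠ 0 → u q = 0 := by
  intro q hq2 hq
  refine le_antisymm (SelfSim.nonpos hs h2s hp hu hq2 hq) ?_
  have := SelfSim.nonpos hs h2s hp (SelfSim.neg_mem hu) hq2 hq
  simpa using this
end
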